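/- arXiv:1812.01534 — 4 statements merged into one kernel-verified Lean document; each statement's English description precedes it below -/
import Mathlib

section
/- Fix ε > 0. There exists Δ₀ such that for every Δ ≥ Δ₀ the following holds, where δ = (192 log Δ)^{2/ε}. Let G be a finite triangle-free simple graph of maximum degree at most Δ, and let L : V(G) → 2^{ℤ⁺} be a list assignment of G such that for all v ∈ V(G), |L(v)| ≥ (1+ε)·max{deg(v)/log deg(v), δ/log δ}. Then there exists a proper colouring c : V(G) → ℤ⁺ of G such that c(v) ∈ L(v) for all v ∈ V(G). -/
namespace LocalMolloy
open Finset
open scoped Classical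

lemma one_sub_ge (s l : ℕ) (hs : 1 ≤ s) (hl : s + 1 ≤ l) :
    Real.exp (-((1 + 1 / (s : ℝ)) * (1 / (l : ℝ)))) ≤ 1 - 1 / (l : ℝ) := by
  have hs' : (1 : ℝ) ≤ s := by exact_mod_cast hs
  have hl' : (s : ℝ) + 1 ≤ l := by exact_mod_cast hl
  have hl1 : (0 : ℝ) < l - 1 := by linarith
  have h1 : 1 / ((l : ℝ) - 1) ≤ (1 + 1 / (s : ℝ)) * (1 / (l : ℝ)) := by
    have : (1 + 1 / (s : ℝ)) * (1 / (l : ℝ)) = (s + 1) / (s * l) := by field_simp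
    have hl0 : (0 : ℝ) < l := by linarith
    rw [this, div_le_div_iff₀ hl1 (by positivity)]
    nlinarith
  have h2 : Real.exp (-((1 + 1 / (s : ℝ)) * (1 / (l : ℝ)))) ≤ Real.exp (-(1 / ((l : ℝ) - 1))) :=
    Real.exp_le_exp.2 (by linarith)
  refine h2.trans ?_
  rw [Real.exp_neg]
  have h3 : (l : ℝ) / (l - 1) ≤ Real.exp (1 / ((l : ℝ) - 1)) := by
    have := Real.add_one_le_exp (1 / ((l : ℝ) - 1))
    have e : (l : ℝ) / (l - 1) = 1 / ((l : ℝ) - 1) + 1 := by field_simp; ring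
    rw [e]; exact this
  have h4 : 1 - 1 / (l : ℝ) = ((l : ℝ) / (l - 1))⁻¹ := by
    have : (l : ℝ) ≠ 0 := by linarith
    field_simp
  rw [h4]
  exact inv_anti₀ (by apply div_pos <;> linarith) h3

lemma exp_sum_ge {α : Type} (K : Finset α) (z : α → ℝ) (hK : 0 < (K.card : ℝ)) :
    (K.card : ℝ) * Real.exp (-((∑ c ∈ K, z c) / K.card)) ≤ ∑ c ∈ K, Real.exp (-z c) := by
  set m := (∑ c ∈ K, z c) / K.card with hm
  have h : ∀ c ∈ K, Real.exp (-m) * (1 + m - z c) ≤ Real.exp (-z c) := by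
    intro c _
    have e : Real.exp (-z c) = Real.exp (-m) * Real.exp (m - z c) := by
      rw [← Real.exp_add]; congr 1; ring
    rw [e]
    refine mul_le_mul_of_nonneg_left ?_ (Real.exp_pos _).le
    linarith [Real.add_one_le_exp (m - z c)]
  refine le_trans (le_of_eq ?_) (sum_le_sum h)
  rw [← mul_sum, sum_sub_distrib, sum_const, nsmul_eq_mul]
  have : ∑ c ∈ K, z c = m * K.card := by rw [hm]; field_simp
  rw [this]; ring

lemma M_lower {V α : Type} (N : Finset V) (A : V → Finset α) (K : Finset α) (s : ℕ) (hs : 1 ≤ s)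
    (d : ℝ) (hd : (N.card : ℝ) ≤ d) (hK : 0 < K.card)
    (hp0 : ∀ (u : V) (c : α), (0 : ℝ) ≤ (if c ∈ A u then 1 / ((A u).card : ℝ) else 0) ∧
      (if c ∈ A u then 1 / ((A u).card : ℝ) else 0) ≤ 1)
    (hbad : (s : ℝ) * (s + 1) * ((N.filter (fun u => (A u).card ≤ s)).card : ℝ) ≤ K.card) :
    (s / (s + 1) * (K.card : ℝ)) *
      Real.exp (-((1 + 1 / (s : ℝ)) * d / (s / (s + 1) * (K.card : ℝ)))) ≤
    ∑ c ∈ K, ∏ u ∈ N, (1 - if c ∈ A u then 1 / ((A u).card : ℝ) else 0) := by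
  set B := N.filter (fun u => (A u).card ≤ s) with hB
  set K' := K \ B.biUnion A with hK'
  have hs' : (1 : ℝ) ≤ s := by exact_mod_cast hs
  have hk : (0 : ℝ) < K.card := by exact_mod_cast hK
  have hU : ((B.biUnion A).card : ℝ) ≤ s * B.card := by
    have : (B.biUnion A).card ≤ B.card * s :=
      card_biUnion_le_card_mul _ _ _ (fun u hu => (mem_filter.1 hu).2)
    rw [mul_comm]; exact_mod_cast this
  have hk' : s / (s + 1) * (K.card : ℝ) ≤ K'.card := by
    have h1 : K.card - (B.biUnion A).card ≤ K'.card := le_card_sdiff _ _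
    have h2 : (K.card : ℝ) ≤ K'.card + (B.biUnion A).card := by
      have : K.card ≤ K'.card + (B.biUnion A).card := by omega
      exact_mod_cast this
    rw [div_mul_eq_mul_div, div_le_iff₀ (by linarith)]
    nlinarith
  have hk'' : 0 < s / (s + 1) * (K.card : ℝ) := by positivity
  have hK'0 : (0 : ℝ) < K'.card := lt_of_lt_of_le hk'' hk'
  have nn : ∀ c, 0 ≤ ∏ u ∈ N, (1 - if c ∈ A u then 1 / ((A u).card : ℝ) else 0) := fun c =>
    prod_nonneg fun u _ => by linarith [(hp0 u c).2]
  have h1 : ∑ c ∈ K', ∏ u ∈ N, (1 - if c ∈ A u then 1 / ((A u).card : ℝ) else 0) ≤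
      ∑ c ∈ K, ∏ u ∈ N, (1 - if c ∈ A u then 1 / ((A u).card : ℝ) else 0) :=
    sum_le_sum_of_subset_of_nonneg sdiff_subset (fun c _ _ => nn c)
  refine le_trans ?_ h1
  let z : α → ℝ := fun c => ∑ u ∈ N, (1 + 1 / (s : ℝ)) * (if c ∈ A u then 1 / ((A u).card : ℝ) else 0)
  have h2 : ∀ c ∈ K', Real.exp (-z c) ≤
      ∏ u ∈ N, (1 - if c ∈ A u then 1 / ((A u).card : ℝ) else 0) := by
    intro c hc
    simp only [z]
    rw [← sum_neg_distrib, Real.exp_sum]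
    refine prod_le_prod (fun u _ => (Real.exp_pos _).le) fun u hu => ?_
    by_cases hcu : c ∈ A u
    · simp only [hcu, if_true]
      refine one_sub_ge s _ hs ?_
      by_contra hlt
      have : u ∈ B := mem_filter.2 ⟨hu, by omega⟩
      exact (mem_sdiff.1 hc).2 (mem_biUnion.2 ⟨u, this, hcu⟩)
    · simp [hcu]
  refine le_trans ?_ (sum_le_sum h2)
  refine le_trans ?_ (exp_sum_ge K' z hK'0)
  have hz : ∑ c ∈ K', z c ≤ (1 + 1 / (s : ℝ)) * d := by
    simp only [z]
    rw [sum_comm]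
    have : ∀ u ∈ N, ∑ c ∈ K', (1 + 1 / (s : ℝ)) * (if c ∈ A u then 1 / ((A u).card : ℝ) else 0)
        ≤ (1 + 1 / (s : ℝ)) := by
      intro u _
      rw [← mul_sum, ← sum_filter, sum_const, nsmul_eq_mul]
      have h3 : ((K'.filter (fun c => c ∈ A u)).card : ℝ) * (1 / ((A u).card : ℝ)) ≤ 1 := by
        have : ((K'.filter (fun c => c ∈ A u)).card : ℝ) ≤ (A u).card := by
          exact_mod_cast card_le_card (fun c hc => (mem_filter.1 hc).2)
        rw [mul_one_div]
        exact div_le_one_of_le₀ this (by positivity)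
      exact mul_le_of_le_one_right (by positivity) h3
    refine (sum_le_sum this).trans ?_
    rw [sum_const, nsmul_eq_mul, mul_comm]
    exact mul_le_mul_of_nonneg_left hd (by positivity)
  have hd0 : 0 ≤ d := le_trans (by positivity) hd
  refine mul_le_mul hk' (Real.exp_le_exp.2 (neg_le_neg ?_)) (Real.exp_pos _).le hK'0.le
  exact div_le_div₀ (by positivity) hz hk'' hk'

section core
variable {V : Type} [Fintype V] {α : Type} (G : SimpleGraph V) (L : V → Finset α) (a0 : α)

/-- Colours of `L v` not used by `f` on the neighbours of `v` in `S`. -/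
noncomputable def avail (S : Finset V) (v : V) (f : V → α) : Finset α :=
  (L v).filter (fun c => ∀ u ∈ S, G.Adj v u → f u ≠ c)

/-- Proper list colourings of `G[S]`, extended by `a0` outside `S`. -/
noncomputable def Col (S : Finset V) : Finset (V → α) :=
  (Fintype.piFinset (fun v => if v ∈ S then L v else {a0})).filter
    (fun f => ∀ u ∈ S, ∀ v ∈ S, G.Adj u v → f u ≠ f v)

lemma mem_avail {S : Finset V} {v : V} {f : V → α} {c : α} :
    c ∈ avail G L S v f ↔ c ∈ L v ∧ ∀ u ∈ S, G.Adj v u → f u ≠ c := by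
  simp [avail]

lemma mem_Col {S : Finset V} {f : V → α} :
    f ∈ Col G L a0 S ↔ (∀ v ∈ S, f v ∈ L v) ∧ (∀ v, v ∉ S → f v = a0) ∧
      ∀ u ∈ S, ∀ v ∈ S, G.Adj u v → f u ≠ f v := by
  simp only [Col, mem_filter, Fintype.mem_piFinset]
  constructor
  · rintro ⟨h, h2⟩
    refine ⟨fun v hv => by simpa [hv] using h v, fun v hv => by simpa [hv] using h v, h2⟩
  · rintro ⟨h, h1, h2⟩
    refine ⟨fun v => ?_, h2⟩
    by_cases hv : v ∈ S
    · simpa [hv] using h v hv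
    · simpa [hv] using h1 v hv

lemma avail_update {S : Finset V} {u w : V} (h : ¬ G.Adj u w) (f : V → α) (x : α) :
    avail G L S u (Function.update f w x) = avail G L S u f := by
  ext c
  simp only [mem_avail]
  refine and_congr_right fun _ => forall₂_congr fun z _ => ?_
  refine imp_congr_right fun hz => ?_
  have : z ≠ w := by rintro rfl; exact h hz
  rw [Function.update_of_ne this]

lemma avail_insert_self {S : Finset V} {v : V} (f : V → α) :
    avail G L (insert v S) v f = avail G L S v f := by
  ext c
  simp [mem_avail]

lemma self_mem_avail {S : Finset V} {u : V} (hu : u ∈ S) {f : V → α} (hf : f ∈ Col G L a0 S) :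
    f u ∈ avail G L S u f := by
  rw [mem_Col] at hf
  rw [mem_avail]
  exact ⟨hf.1 u hu, fun w hw h => hf.2.2 w hw u hu h.symm⟩

lemma sum_Col_insert {S : Finset V} {v : V} (hv : v ∉ S) (h : (V → α) → ℝ) :
    ∑ f ∈ Col G L a0 (insert v S), h f =
      ∑ f ∈ Col G L a0 S, ∑ x ∈ avail G L S v f, h (Function.update f v x) := by
  rw [Finset.sum_sigma']
  refine Finset.sum_bij' (fun f _ => ⟨Function.update f v a0, f v⟩)
    (fun p _ => Function.update p.1 v p.2) ?_ ?_ ?_ ?_ ?_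
  · intro f hf
    have hf' := (mem_Col G L a0).1 hf
    rw [mem_sigma, mem_Col]
    have key : ∀ w ∈ S, w ≠ v := fun w hw e => hv (e ▸ hw)
    dsimp only
    refine ⟨⟨?_, ?_, ?_⟩, ?_⟩
    · intro w hw
      rw [Function.update_of_ne (key w hw)]
      exact hf'.1 w (mem_insert_of_mem hw)
    · intro w hw
      by_cases e : w = v
      · simp [e]
      · rw [Function.update_of_ne e]
        exact hf'.2.1 w (by simp [e, hw])
    · intro u hu w hw huw
      rw [Function.update_of_ne (key w hw), Function.update_of_ne (key u hu)]
      exact hf'.2.2 u (mem_insert_of_mem hu) w (mem_insert_of_mem hw) huw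
    · have := self_mem_avail G L a0 (mem_insert_self v S) hf
      rw [avail_insert_self] at this
      rw [avail_update G L (G.irrefl)]
      exact this
  · rintro ⟨f, x⟩ hp
    rw [mem_sigma] at hp
    obtain ⟨hf, hx⟩ := hp
    have hf' := (mem_Col G L a0).1 hf
    have hx' := (mem_avail G L).1 hx
    have key : ∀ w ∈ S, w ≠ v := fun w hw e => hv (e ▸ hw)
    rw [mem_Col]
    dsimp only at *
    refine ⟨?_, ?_, ?_⟩
    · intro w hw
      rcases mem_insert.1 hw with rfl | hw
      · simpa using hx'.1
      · rw [Function.update_of_ne (key w hw)]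
        exact hf'.1 w hw
    · intro w hw
      rw [mem_insert, not_or] at hw
      rw [Function.update_of_ne hw.1]
      exact hf'.2.1 w hw.2
    · intro u hu w hw huw
      rcases mem_insert.1 hu with rfl | hu' <;> rcases mem_insert.1 hw with rfl | hw'
      · exact absurd huw G.irrefl
      · rw [Function.update_self, Function.update_of_ne (key w hw')]
        exact (hx'.2 w hw' huw).symm
      · rw [Function.update_self, Function.update_of_ne (key u hu')]
        exact (hx'.2 u hu' huw.symm)
      · rw [Function.update_of_ne (key w hw'), Function.update_of_ne (key u hu')]
        exact hf'.2.2 u hu' w hw' huw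
  · intro f hf
    simp
  · rintro ⟨f, x⟩ hp
    rw [mem_sigma] at hp
    have hf' := (mem_Col G L a0).1 hp.1
    have := hf'.2.1 v hv
    dsimp only at *
    simp [← this]
  · intro f hf
    simp

lemma sum_Col_resample {S : Finset V} {u : V} (hu : u ∈ S) (h : (V → α) → ℝ) :
    ∑ f ∈ Col G L a0 S, h f =
      ∑ f ∈ Col G L a0 S, (1 / ((avail G L S u f).card : ℝ)) *
        ∑ x ∈ avail G L S u f, h (Function.update f u x) := by
  obtain ⟨T, hT, rfl⟩ : ∃ T, u ∉ T ∧ insert u T = S :=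
    ⟨S.erase u, by simp, insert_erase hu⟩
  rw [sum_Col_insert G L a0 hT, sum_Col_insert G L a0 hT]
  refine sum_congr rfl fun g _ => ?_
  simp only [avail_update G L (G.irrefl), avail_insert_self, Function.update_idem]
  rw [sum_const, nsmul_eq_mul]
  rcases (avail G L T u g).eq_empty_or_nonempty with h0 | h0
  · simp [h0]
  · have : ((avail G L T u g).card : ℝ) ≠ 0 := by
      exact_mod_cast h0.card_pos.ne'
    field_simp

lemma one_ball (A K : Finset α) (a : α → ℝ) (ha : ∀ c, 0 ≤ a c) (ha1 : ∀ c, a c ≤ 1)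
    (hA : A.Nonempty) :
    (1 / (A.card : ℝ)) * ∑ x ∈ A, ∏ c ∈ K, (1 - a c * (if x ≠ c then 1 else 0)) ≤
      ∏ c ∈ K, (1 - a c * (1 - if c ∈ A then 1 / (A.card : ℝ) else 0)) := by
  have hl : (0 : ℝ) < A.card := by exact_mod_cast hA.card_pos
  have hl1 : (1 : ℝ) ≤ A.card := by exact_mod_cast hA.card_pos
  have hp : ∀ c, (0 : ℝ) ≤ (if c ∈ A then 1 / (A.card : ℝ) else 0) := by
    intro c; split_ifs <;> positivity
  induction K using Finset.induction_on with
  | empty => simp [hl.ne']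
  | insert c0 K hc ih =>
    simp only [prod_insert hc]
    set P := ∏ c ∈ K, (1 - a c * (1 - if c ∈ A then 1 / (A.card : ℝ) else 0)) with hP
    have hb : ∏ c ∈ K, (1 - a c) ≤ P := by
      refine prod_le_prod (fun c _ => by linarith [ha1 c]) fun c _ => ?_
      nlinarith [ha c, hp c]
    have e1 : ∑ x ∈ A, (1 - a c0 * (if x ≠ c0 then 1 else 0)) *
          ∏ c ∈ K, (1 - a c * (if x ≠ c then 1 else 0)) =
        (1 - a c0) * ∑ x ∈ A, ∏ c ∈ K, (1 - a c * (if x ≠ c then 1 else 0)) +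
          a c0 * (if c0 ∈ A then 1 else 0) * ∏ c ∈ K, (1 - a c) := by
      have e2 : ∀ x ∈ A, (1 - a c0 * (if x ≠ c0 then 1 else 0)) *
          ∏ c ∈ K, (1 - a c * (if x ≠ c then 1 else 0)) =
          (1 - a c0) * ∏ c ∈ K, (1 - a c * (if x ≠ c then 1 else 0)) +
          (if c0 = x then a c0 * ∏ c ∈ K, (1 - a c) else 0) := by
        intro x _
        by_cases h : c0 = x
        · subst h
          have : ∏ c ∈ K, (1 - a c * (if c0 ≠ c then 1 else 0)) = ∏ c ∈ K, (1 - a c) := by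
            refine prod_congr rfl fun c hcK => ?_
            have : c0 ≠ c := by rintro rfl; exact hc hcK
            simp [this]
          rw [this]; simp; ring
        · have h' : x ≠ c0 := fun e => h e.symm
          simp [h, h']
      rw [sum_congr rfl e2, sum_add_distrib, ← mul_sum, sum_ite_eq]
      split_ifs <;> simp
    rw [e1]
    have e3 : (1 / (A.card : ℝ)) * ((1 - a c0) * ∑ x ∈ A, ∏ c ∈ K, (1 - a c * (if x ≠ c then 1 else 0)) +
          a c0 * (if c0 ∈ A then 1 else 0) * ∏ c ∈ K, (1 - a c)) =
        (1 - a c0) * ((1 / (A.card : ℝ)) * ∑ x ∈ A, ∏ c ∈ K, (1 - a c * (if x ≠ c then 1 else 0))) +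
        a c0 * (if c0 ∈ A then 1 / (A.card : ℝ) else 0) * ∏ c ∈ K, (1 - a c) := by
      split_ifs <;> ring
    rw [e3]
    have := mul_le_mul_of_nonneg_left ih (show 0 ≤ 1 - a c0 by linarith [ha1 c0])
    have h2 := mul_le_mul_of_nonneg_left hb (mul_nonneg (ha c0) (hp c0))
    nlinarith

lemma p_bounds (A : Finset α) (c : α) :
    (0 : ℝ) ≤ (if c ∈ A then 1 / (A.card : ℝ) else 0) ∧
      (if c ∈ A then 1 / (A.card : ℝ) else 0) ≤ 1 := by
  split_ifs with h
  · have : (1 : ℝ) ≤ A.card := by exact_mod_cast (card_pos.2 ⟨c, h⟩)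
    exact ⟨by positivity, by rw [div_le_one (by linarith)]; exact this⟩
  · simp

lemma neg_dep {S : Finset V} (K : Finset α) (N : Finset V) :
    N ⊆ S → (∀ u ∈ N, ∀ w ∈ N, ¬ G.Adj u w) →
    ∀ (Φ : (V → α) → ℝ) (θ : α → ℝ), (∀ f, 0 ≤ Φ f) →
      (∀ w ∈ N, ∀ f x, Φ (Function.update f w x) = Φ f) →
      (∀ c, 0 ≤ θ c) → (∀ c, θ c ≤ 1) →
    ∑ f ∈ Col G L a0 S, Φ f * ∏ c ∈ K, (1 - θ c * (if ∀ u ∈ N, f u ≠ c then 1 else 0)) ≤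
    ∑ f ∈ Col G L a0 S, Φ f * ∏ c ∈ K, (1 - θ c * ∏ u ∈ N,
      (1 - if c ∈ avail G L S u f then 1 / ((avail G L S u f).card : ℝ) else 0)) := by
  induction N using Finset.induction_on with
  | empty => intros; simp
  | insert w N hw ih =>
    intro hS hind Φ θ hΦ hinv hθ0 hθ1
    have hwS : w ∈ S := hS (mem_insert_self _ _)
    have hNS : N ⊆ S := fun x hx => hS (mem_insert_of_mem hx)
    have ih' := ih hNS (fun u hu x hx => hind u (mem_insert_of_mem hu) x (mem_insert_of_mem hx))
    have hwN : ∀ u ∈ N, u ≠ w := fun u hu e => hw (e ▸ hu)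
    -- auxiliary weights
    let Φx : α → (V → α) → ℝ := fun x f =>
      Φ f * (if x ∈ avail G L S w f then 1 / ((avail G L S w f).card : ℝ) else 0)
    let θx : α → α → ℝ := fun x c => θ c * (if x ≠ c then 1 else 0)
    have hθx0 : ∀ x c, 0 ≤ θx x c := fun x c => by
      simp only [θx]; have := hθ0 c; split_ifs <;> simp [this]
    have hθx1 : ∀ x c, θx x c ≤ 1 := fun x c => by
      simp only [θx]; have := hθ1 c; split_ifs <;> simp [this]
    have IH := fun x => ih' (Φx x) (θx x)
      (fun f => mul_nonneg (hΦ f) (p_bounds _ _).1)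
      (fun u hu f y => by
        simp only [Φx]
        rw [hinv u (mem_insert_of_mem hu),
          avail_update G L (hind w (mem_insert_self _ _) u (mem_insert_of_mem hu))])
      (hθx0 x) (hθx1 x)
    have swap : ∀ F : α → (V → α) → ℝ,
        ∑ f ∈ Col G L a0 S, (1 / ((avail G L S w f).card : ℝ)) *
          ∑ x ∈ avail G L S w f, Φ f * F x f
        = ∑ x ∈ L w, ∑ f ∈ Col G L a0 S, Φx x f * F x f := by
      intro F
      rw [sum_comm]
      refine sum_congr rfl fun f _ => ?_
      have hsub : avail G L S w f ⊆ L w := filter_subset _ _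
      rw [← sum_subset hsub, mul_sum]
      · refine sum_congr rfl fun x hx => ?_
        simp only [Φx, hx, if_true]; ring
      · intro x _ hx
        simp [Φx, hx]
    rw [sum_Col_resample G L a0 hwS]
    have step1 : ∑ f ∈ Col G L a0 S, (1 / ((avail G L S w f).card : ℝ)) *
          ∑ x ∈ avail G L S w f, (Φ (Function.update f w x) * ∏ c ∈ K, (1 - θ c *
            (if ∀ u ∈ insert w N, (Function.update f w x) u ≠ c then 1 else 0)))
        = ∑ f ∈ Col G L a0 S, (1 / ((avail G L S w f).card : ℝ)) *
          ∑ x ∈ avail G L S w f, Φ f * ∏ c ∈ K, (1 - θx x c *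
            (if ∀ u ∈ N, f u ≠ c then 1 else 0)) := by
      refine sum_congr rfl fun f _ => ?_
      congr 1
      refine sum_congr rfl fun x _ => ?_
      rw [hinv w (mem_insert_self _ _)]
      congr 1
      refine prod_congr rfl fun c _ => ?_
      have : (∀ u ∈ insert w N, (Function.update f w x) u ≠ c) ↔ (x ≠ c ∧ ∀ u ∈ N, f u ≠ c) := by
        rw [forall_mem_insert, Function.update_self]
        refine and_congr_right fun _ => forall₂_congr fun u hu => ?_
        rw [Function.update_of_ne (hwN u hu)]
      simp only [this, θx]
      by_cases h1 : x = c <;> by_cases h2 : ∀ u ∈ N, f u ≠ c <;> simp [h1, h2]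
    rw [step1, swap]
    refine (sum_le_sum fun x _ => IH x).trans ?_
    rw [← swap]
    refine sum_le_sum fun f hf => ?_
    rw [← mul_sum]
    have hne : (avail G L S w f).Nonempty := ⟨_, self_mem_avail G L a0 hwS hf⟩
    have q0 : ∀ c, 0 ≤ ∏ u ∈ N,
      (1 - if c ∈ avail G L S u f then 1 / ((avail G L S u f).card : ℝ) else 0) := fun c =>
      prod_nonneg fun u _ => by linarith [(p_bounds (avail G L S u f) c).2]
    have q1 : ∀ c, ∏ u ∈ N,
      (1 - if c ∈ avail G L S u f then 1 / ((avail G L S u f).card : ℝ) else 0) ≤ 1 := fun c =>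
      prod_le_one (fun u _ => by linarith [(p_bounds (avail G L S u f) c).2])
        (fun u _ => by linarith [(p_bounds (avail G L S u f) c).1])
    have := one_ball (avail G L S w f) K (fun c => θ c * ∏ u ∈ N,
      (1 - if c ∈ avail G L S u f then 1 / ((avail G L S u f).card : ℝ) else 0))
      (fun c => mul_nonneg (hθ0 c) (q0 c)) (fun c => mul_le_one₀ (hθ1 c) (q0 c) (q1 c)) hne
    have e := mul_le_mul_of_nonneg_left this (hΦ f)
    refine le_trans (le_of_eq ?_) (e.trans (le_of_eq ?_))
    · rw [mul_left_comm]
      congr 2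
      refine sum_congr rfl fun x _ => prod_congr rfl fun c _ => ?_
      simp only [θx]; ring
    · congr 1
      refine prod_congr rfl fun c _ => ?_
      rw [prod_insert hw]; ring


/-- Number of neighbours of `v` in `S` having at most `s` available colours. -/
noncomputable def badN (S : Finset V) (s : ℕ) (v : V) (f : V → α) : ℕ :=
  ((S.filter (fun u => G.Adj v u)).filter (fun u => (avail G L S u f).card ≤ s)).card

lemma markov {S : Finset V} {s : ℕ} {ρ d : ℝ} {v : V} (hρ : 0 ≤ ρ)
    (hd : ((S.filter (fun u => G.Adj v u)).card : ℝ) ≤ d)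
    (hK : 0 < (L v).card)
    (hP : ∀ u ∈ S, (((Col G L a0 S).filter (fun f => (avail G L S u f).card ≤ s)).card : ℝ)
      ≤ ρ * (Col G L a0 S).card) :
    (((Col G L a0 S).filter
      (fun f => ¬ ((s : ℝ) * (s + 1) * (badN G L S s v f : ℝ) ≤ (L v).card))).card : ℝ) ≤
      (s : ℝ) * (s + 1) * d / (L v).card * ρ * (Col G L a0 S).card := by
  have hk : (0 : ℝ) < (L v).card := by exact_mod_cast hK
  have h1 : ∑ f ∈ Col G L a0 S, (badN G L S s v f : ℝ) ≤ d * (ρ * (Col G L a0 S).card) := by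
    have e : ∀ f, (badN G L S s v f : ℝ) =
        ∑ u ∈ S.filter (fun u => G.Adj v u), if (avail G L S u f).card ≤ s then (1 : ℝ) else 0 := by
      intro f
      rw [badN, sum_boole]
    simp only [e]
    rw [sum_comm]
    have : ∀ u ∈ S.filter (fun u => G.Adj v u), ∑ f ∈ Col G L a0 S,
        (if (avail G L S u f).card ≤ s then (1 : ℝ) else 0) ≤ ρ * (Col G L a0 S).card := by
      intro u hu
      rw [sum_boole]
      exact hP u (mem_filter.1 hu).1
    refine (sum_le_sum this).trans ?_
    rw [sum_const, nsmul_eq_mul]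
    exact mul_le_mul_of_nonneg_right hd (by positivity)
  have h2 : (((Col G L a0 S).filter
      (fun f => ¬ ((s : ℝ) * (s + 1) * (badN G L S s v f : ℝ) ≤ (L v).card))).card : ℝ)
      ≤ ∑ f ∈ Col G L a0 S, (s : ℝ) * (s + 1) / (L v).card * (badN G L S s v f : ℝ) := by
    rw [← sum_boole]
    refine sum_le_sum fun f _ => ?_
    by_cases h : (s : ℝ) * (s + 1) * (badN G L S s v f : ℝ) ≤ (L v).card
    · simp only [h, not_true, if_false]
      positivity
    · simp only [h, not_false_eq_true, if_true]
      rw [not_le] at h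
      rw [div_mul_eq_mul_div, le_div_iff₀ hk]; linarith
  refine h2.trans ?_
  rw [← mul_sum]
  refine (mul_le_mul_of_nonneg_left h1 (by positivity)).trans (le_of_eq ?_)
  ring

lemma chernoff {S : Finset V} {s : ℕ} {μ d : ℝ} {v : V} (hs : 1 ≤ s)
    (hG : ∀ u w, G.Adj v u → G.Adj v w → ¬ G.Adj u w)
    (hd : ((S.filter (fun u => G.Adj v u)).card : ℝ) ≤ d)
    (hK : 0 < (L v).card)
    (hμ : μ ≤ (s / (s + 1) * ((L v).card : ℝ)) *
      Real.exp (-((1 + 1 / (s : ℝ)) * d / (s / (s + 1) * ((L v).card : ℝ))))) (y : ℝ) :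
    (((Col G L a0 S).filter
      (fun f => ((s : ℝ) * (s + 1) * (badN G L S s v f : ℝ) ≤ (L v).card) ∧
        ((avail G L S v f).card : ℝ) ≤ y)).card : ℝ) ≤
      Real.exp y * Real.exp (-(μ / 2)) * (Col G L a0 S).card := by
  set N := S.filter (fun u => G.Adj v u) with hN
  let Φ : (V → α) → ℝ := fun f =>
    if (s : ℝ) * (s + 1) * (badN G L S s v f : ℝ) ≤ (L v).card then 1 else 0
  have hadj : ∀ u ∈ N, ∀ w ∈ N, ¬ G.Adj u w := fun u hu w hw =>
    hG u w (mem_filter.1 hu).2 (mem_filter.1 hw).2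
  have hΦ : ∀ f, 0 ≤ Φ f := fun f => by simp only [Φ]; split_ifs <;> simp
  have key := neg_dep G L a0 (S := S) (L v) N (filter_subset _ _) hadj Φ (fun _ => 1 / 2) hΦ
    (by
      intro w hw f x
      have : badN G L S s v (Function.update f w x) = badN G L S s v f := by
        unfold badN
        congr 1
        refine filter_congr fun u hu => ?_
        rw [avail_update G L (hadj u hu w hw)]
      simp only [Φ, this])
    (fun _ => by norm_num) (fun _ => by norm_num)
  have hl : ∀ f : V → α, ∏ c ∈ L v, (1 - (1 / 2 : ℝ) * (if ∀ u ∈ N, f u ≠ c then 1 else 0)) =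
      (1 / 2 : ℝ) ^ (avail G L S v f).card := by
    intro f
    have : ∀ c ∈ L v, (1 - (1 / 2 : ℝ) * (if ∀ u ∈ N, f u ≠ c then 1 else 0)) =
        if (∀ u ∈ S, G.Adj v u → f u ≠ c) then (1 / 2 : ℝ) else 1 := by
      intro c _
      have e : (∀ u ∈ N, f u ≠ c) ↔ (∀ u ∈ S, G.Adj v u → f u ≠ c) := by
        simp only [hN, mem_filter, and_imp]
      simp only [e]
      split_ifs <;> norm_num
    rw [prod_congr rfl this, ← prod_filter, prod_const]
    rfl
  simp only [hl] at key
  have hr : ∑ f ∈ Col G L a0 S, Φ f * ∏ c ∈ L v, (1 - (1 / 2 : ℝ) * ∏ u ∈ N,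
      (1 - if c ∈ avail G L S u f then 1 / ((avail G L S u f).card : ℝ) else 0)) ≤
      ∑ f ∈ Col G L a0 S, Real.exp (-(μ / 2)) := by
    refine sum_le_sum fun f _ => ?_
    by_cases hg : (s : ℝ) * (s + 1) * (badN G L S s v f : ℝ) ≤ (L v).card
    · simp only [Φ, hg, if_true, one_mul]
      have hM := M_lower N (fun u => avail G L S u f) (L v) s hs d hd hK
        (fun u c => p_bounds _ c) hg
      have q0 : ∀ c, 0 ≤ ∏ u ∈ N,
        (1 - if c ∈ avail G L S u f then 1 / ((avail G L S u f).card : ℝ) else 0) := fun c =>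
        prod_nonneg fun u _ => by linarith [(p_bounds (avail G L S u f) c).2]
      have q1 : ∀ c, ∏ u ∈ N,
        (1 - if c ∈ avail G L S u f then 1 / ((avail G L S u f).card : ℝ) else 0) ≤ 1 := fun c =>
        prod_le_one (fun u _ => by linarith [(p_bounds (avail G L S u f) c).2])
          (fun u _ => by linarith [(p_bounds (avail G L S u f) c).1])
      have : ∏ c ∈ L v, (1 - (1 / 2 : ℝ) * ∏ u ∈ N,
          (1 - if c ∈ avail G L S u f then 1 / ((avail G L S u f).card : ℝ) else 0)) ≤
          ∏ c ∈ L v, Real.exp (-((1 / 2 : ℝ) * ∏ u ∈ N,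
          (1 - if c ∈ avail G L S u f then 1 / ((avail G L S u f).card : ℝ) else 0))) := by
        refine prod_le_prod (fun c _ => by linarith [q1 c]) fun c _ => ?_
        have := Real.add_one_le_exp (-((1 / 2 : ℝ) * ∏ u ∈ N,
          (1 - if c ∈ avail G L S u f then 1 / ((avail G L S u f).card : ℝ) else 0)))
        linarith
      refine this.trans ?_
      rw [← Real.exp_sum, sum_neg_distrib, ← mul_sum]
      refine Real.exp_le_exp.2 ?_
      linarith [hμ.trans hM]
    · simp only [Φ, hg, if_false, zero_mul]
      exact (Real.exp_pos _).le
  have hfin := key.trans hr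
  rw [sum_const, nsmul_eq_mul] at hfin
  have hlow : ((((Col G L a0 S).filter
      (fun f => ((s : ℝ) * (s + 1) * (badN G L S s v f : ℝ) ≤ (L v).card) ∧
        ((avail G L S v f).card : ℝ) ≤ y)).card : ℝ)) * Real.exp (-y) ≤
      ∑ f ∈ Col G L a0 S, Φ f * (1 / 2 : ℝ) ^ (avail G L S v f).card := by
    rw [← sum_boole, sum_mul]
    refine sum_le_sum fun f _ => ?_
    split_ifs with h
    · simp only [Φ, h.1, if_true, one_mul]
      have e1 : Real.exp (-1) ≤ 1 / 2 := by
        rw [Real.exp_neg, one_div]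
        exact inv_anti₀ (by norm_num) (by linarith [Real.add_one_le_exp (1 : ℝ)])
      calc Real.exp (-y) ≤ Real.exp (-((avail G L S v f).card : ℝ)) :=
            Real.exp_le_exp.2 (by linarith [h.2])
        _ = Real.exp (-1) ^ (avail G L S v f).card := by
            rw [← Real.exp_nat_mul]; congr 1; ring
        _ ≤ _ := pow_le_pow_left₀ (Real.exp_pos _).le e1 _
    · rw [zero_mul]
      exact mul_nonneg (hΦ f) (by positivity)
  have := hlow.trans hfin
  have e := mul_le_mul_of_nonneg_left this (Real.exp_pos y).le
  have ee : Real.exp y * Real.exp (-y) = 1 := by rw [← Real.exp_add]; simp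
  calc _ = Real.exp y * (((((Col G L a0 S).filter
      (fun f => ((s : ℝ) * (s + 1) * (badN G L S s v f : ℝ) ≤ (L v).card) ∧
        ((avail G L S v f).card : ℝ) ≤ y)).card : ℝ)) * Real.exp (-y)) := by
        rw [mul_left_comm, ee, mul_one]
    _ ≤ _ := e
    _ = _ := by ring

/-- Abstract form of the main result. -/
theorem core_colouring (a0 : α) (s : ℕ) (hs : 1 ≤ s) (ρ : ℝ) (hρ : 0 < ρ) (d μ : V → ℝ)
    (hG : ∀ v u w, G.Adj v u → G.Adj v w → ¬ G.Adj u w)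
    (hd : ∀ v, (((univ : Finset V).filter (fun u => G.Adj v u)).card : ℝ) ≤ d v)
    (hK : ∀ v, 0 < (L v).card) (hμ0 : ∀ v, 0 < μ v)
    (h1 : ∀ v, μ v ≤ (s / (s + 1) * ((L v).card : ℝ)) *
      Real.exp (-((1 + 1 / (s : ℝ)) * d v / (s / (s + 1) * ((L v).card : ℝ)))))
    (h2 : ∀ v, (s : ℝ) * (s + 1) * d v / (L v).card * ρ ≤ 1 / 4)
    (h3 : ∀ v, Real.exp (-(μ v / 4)) ≤ 1 / 4)
    (h4 : ∀ v, s * ((s : ℝ) * (s + 1) * d v / (L v).card * ρ + Real.exp s * Real.exp (-(μ v / 2)))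
      ≤ ρ * (μ v / 8)) :
    ∃ c : V → α, (∀ v, c v ∈ L v) ∧ ∀ u v, G.Adj u v → c u ≠ c v := by
  have hdS : ∀ (S : Finset V) v, ((S.filter (fun u => G.Adj v u)).card : ℝ) ≤ d v := fun S v =>
    le_trans (by exact_mod_cast card_le_card (filter_subset_filter _ (subset_univ S))) (hd v)
  -- extension estimate
  have ext : ∀ S : Finset V,
      (∀ u ∈ S, (((Col G L a0 S).filter (fun f => (avail G L S u f).card ≤ s)).card : ℝ)
        ≤ ρ * (Col G L a0 S).card) → ∀ v, 
      (μ v / 8) * (Col G L a0 S).card ≤ ∑ f ∈ Col G L a0 S, ((avail G L S v f).card : ℝ) := by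
    intro S hP v
    have hm := markov G L a0 hρ.le (hdS S v) (hK v) hP
    have hc := chernoff G L a0 hs (hG v) (hdS S v) (hK v) (h1 v) (μ v / 4)
    have hx : Real.exp (μ v / 4) * Real.exp (-(μ v / 2)) ≤ 1 / 4 := by
      rw [← Real.exp_add]
      refine le_trans (le_of_eq ?_) (h3 v)
      congr 1; ring
    have hn : (0 : ℝ) ≤ (Col G L a0 S).card := by positivity
    have hm' := hm.trans (mul_le_mul_of_nonneg_right (h2 v) hn)
    have hc' := hc.trans (mul_le_mul_of_nonneg_right hx hn)
    rw [← sum_boole] at hm' hc'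
    have hpt : ∀ f ∈ Col G L a0 S, (μ v / 4) * (1 -
        (if ¬ ((s : ℝ) * (s + 1) * (badN G L S s v f : ℝ) ≤ (L v).card) then (1 : ℝ) else 0) -
        (if ((s : ℝ) * (s + 1) * (badN G L S s v f : ℝ) ≤ (L v).card) ∧
        ((avail G L S v f).card : ℝ) ≤ μ v / 4 then (1 : ℝ) else 0)) ≤
        ((avail G L S v f).card : ℝ) := by
      intro f _
      have hμ := hμ0 v
      have h0 : (0 : ℝ) ≤ ((avail G L S v f).card : ℝ) := by positivity
      by_cases hg : ((s : ℝ) * (s + 1) * (badN G L S s v f : ℝ) ≤ (L v).card)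
      · by_cases hy : ((avail G L S v f).card : ℝ) ≤ μ v / 4
        · simp [hg, hy]
        · simp only [hg, hy, not_true, if_false, and_false]; linarith
      · simp [hg]
    have := sum_le_sum hpt
    rw [← mul_sum, sum_sub_distrib, sum_sub_distrib, sum_const, nsmul_eq_mul] at this
    have hμ := hμ0 v
    nlinarith
  have hcard : ∀ (S : Finset V) v, v ∉ S → ((Col G L a0 (insert v S)).card : ℝ) =
      ∑ f ∈ Col G L a0 S, ((avail G L S v f).card : ℝ) := by
    intro S v hv
    have := sum_Col_insert G L a0 hv (fun _ => 1)
    simpa using this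
  -- main induction
  have main : ∀ S : Finset V, 0 < ((Col G L a0 S).card : ℝ) ∧
      ∀ u ∈ S, (((Col G L a0 S).filter (fun f => (avail G L S u f).card ≤ s)).card : ℝ)
        ≤ ρ * (Col G L a0 S).card := by
    intro S
    induction S using Finset.strongInduction with
    | H S ih =>
      constructor
      · rcases S.eq_empty_or_nonempty with rfl | ⟨v, hv⟩
        · have : (fun _ => a0) ∈ Col G L a0 (∅ : Finset V) := by
            rw [mem_Col]; simp
          exact_mod_cast card_pos.2 ⟨_, this⟩
        · obtain ⟨T, hT, rfl⟩ : ∃ T, v ∉ T ∧ insert v T = S :=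
            ⟨S.erase v, by simp, insert_erase hv⟩
          have iT := ih T (ssubset_insert hT)
          rw [hcard T v hT]
          refine lt_of_lt_of_le ?_ (ext T iT.2 v)
          have := hμ0 v
          have := iT.1
          positivity
      · intro u hu
        obtain ⟨T, hT, rfl⟩ : ∃ T, u ∉ T ∧ insert u T = S :=
            ⟨S.erase u, by simp, insert_erase hu⟩
        have iT := ih T (ssubset_insert hT)
        have he := ext T iT.2 u
        rw [← hcard T u hT] at he
        have hm := markov G L a0 hρ.le (hdS T u) (hK u) iT.2
        have hc := chernoff G L a0 hs (hG u) (hdS T u) (hK u) (h1 u) s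
        -- count bad colourings
        have hb : (((Col G L a0 (insert u T)).filter
            (fun f => (avail G L (insert u T) u f).card ≤ s)).card : ℝ) ≤
            s * (((Col G L a0 T).filter (fun f => (avail G L T u f).card ≤ s)).card : ℝ) := by
          rw [← sum_boole, sum_Col_insert G L a0 hT, ← sum_boole, mul_sum]
          refine sum_le_sum fun f _ => ?_
          simp only [avail_insert_self, avail_update G L (G.irrefl)]
          rw [sum_const, nsmul_eq_mul]
          split_ifs with h
          · have : ((avail G L T u f).card : ℝ) ≤ s := by exact_mod_cast h
            linarith
          · simp
        have hsplit : (((Col G L a0 T).filter (fun f => (avail G L T u f).card ≤ s)).card : ℝ) ≤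
            (((Col G L a0 T).filter
              (fun f => ¬ ((s : ℝ) * (s + 1) * (badN G L T s u f : ℝ) ≤ (L u).card))).card : ℝ) +
            (((Col G L a0 T).filter
              (fun f => ((s : ℝ) * (s + 1) * (badN G L T s u f : ℝ) ≤ (L u).card) ∧
              ((avail G L T u f).card : ℝ) ≤ s)).card : ℝ) := by
          rw [← sum_boole, ← sum_boole, ← sum_boole, ← sum_add_distrib]
          refine sum_le_sum fun f _ => ?_
          simp only [Nat.cast_le]
          by_cases hg : ((s : ℝ) * (s + 1) * (badN G L T s u f : ℝ) ≤ (L u).card) <;>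
            by_cases hy : (avail G L T u f).card ≤ s <;> simp [hg, hy]
        have hs0 : (0 : ℝ) ≤ s := by positivity
        have hn : (0 : ℝ) ≤ (Col G L a0 T).card := by positivity
        calc _ ≤ _ := hb
          _ ≤ s * (((s : ℝ) * (s + 1) * d u / (L u).card * ρ * (Col G L a0 T).card) +
              (Real.exp s * Real.exp (-(μ u / 2)) * (Col G L a0 T).card)) :=
              mul_le_mul_of_nonneg_left (hsplit.trans (add_le_add hm hc)) hs0
          _ = (s * ((s : ℝ) * (s + 1) * d u / (L u).card * ρ +
                Real.exp s * Real.exp (-(μ u / 2)))) * (Col G L a0 T).card := by ring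
          _ ≤ (ρ * (μ u / 8)) * (Col G L a0 T).card := mul_le_mul_of_nonneg_right (h4 u) hn
          _ = ρ * (μ u / 8 * (Col G L a0 T).card) := by ring
          _ ≤ _ := mul_le_mul_of_nonneg_left he hρ.le
  have h := (main univ).1
  have h' : 0 < (Col G L a0 univ).card := by exact_mod_cast h
  obtain ⟨f, hf⟩ := card_pos.1 h'
  rw [mem_Col] at hf
  exact ⟨f, fun v => hf.1 v (mem_univ v), fun u v => hf.2.2 u (mem_univ u) v (mem_univ v)⟩

end core

lemma eventually_D (γ : ℝ) (hγ : 0 < γ) (B : ℝ) (hB : 32 ≤ B) :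
    ∃ X0 : ℝ, 1 < X0 ∧ ∀ D : ℝ, X0 ≤ D → 1 ≤ Real.log D ∧
      B * Real.log D ≤ 1 / 2 * (D ^ γ / Real.log D) ∧
      D ^ (γ / 2) ≤ 1 / 2 * (D ^ γ / Real.log D) ∧ 16 ≤ D ^ (γ / 2) := by
  have hB0 : 0 < B := by linarith
  have h1 := (isLittleO_log_rpow_atTop (show 0 < γ / 4 by positivity)).bound
    (show 0 < 1 / B by positivity)
  have h2 := Real.tendsto_log_atTop.eventually_ge_atTop 1
  have h3 := (tendsto_rpow_atTop (show 0 < γ / 4 by positivity)).eventually_ge_atTop 4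
  have h4 := Filter.eventually_gt_atTop (1 : ℝ)
  obtain ⟨X, hX⟩ := Filter.eventually_atTop.1 (h1.and (h2.and (h3.and h4)))
  refine ⟨max X 2, by simp, fun D hD => ?_⟩
  obtain ⟨a1, a2, a3, a4⟩ := hX D (le_trans (le_max_left _ _) hD)
  have hD0 : 0 < D := by linarith
  have e2 : D ^ (γ / 2) = (D ^ (γ / 4)) ^ 2 := by
    rw [← Real.rpow_natCast, ← Real.rpow_mul hD0.le]; congr 1; push_cast; ring
  have e4 : D ^ γ = (D ^ (γ / 4)) ^ 4 := by
    rw [← Real.rpow_natCast, ← Real.rpow_mul hD0.le]; congr 1; push_cast; ring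
  rw [Real.norm_of_nonneg (by linarith), Real.norm_of_nonneg (by positivity)] at a1
  rw [e2, e4]
  set w := D ^ (γ / 4)
  set l := Real.log D
  have a1' : B * l ≤ w := by
    rw [one_div, inv_mul_eq_div, le_div_iff₀ hB0] at a1; linarith
  have hl : 32 * l ≤ w := by nlinarith
  have hl0 : 0 < l := by linarith
  have k : w ^ 2 ≤ 1 / 2 * (w ^ 4 / l) := by
    rw [← mul_div_assoc, le_div_iff₀ hl0]
    have : w ^ 2 * l ≤ w ^ 2 * (1 / 2 * w ^ 2) :=
      mul_le_mul_of_nonneg_left (by nlinarith) (by positivity)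
    nlinarith
  refine ⟨a2, le_trans ?_ k, k, by nlinarith⟩
  nlinarith

lemma eventually_Δ (ε γ : ℝ) (hε : 0 < ε) (hγ : 0 < γ) (C X0 : ℝ) (hC : 0 < C) :
    ∃ Δ₀ : ℕ, ∀ Δ : ℕ, Δ₀ ≤ Δ → 1 ≤ Real.log Δ ∧ X0 ≤ (192 * Real.log Δ) ^ (2 / ε) ∧
      (192 * Real.log Δ) ^ (2 / ε) ≤ Δ ∧
      C * Real.log Δ ≤ Real.exp (((192 * Real.log Δ) ^ (2 / ε)) ^ (γ / 2) / 2) := by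
  have hlog : Filter.Tendsto (fun n : ℕ => Real.log n) Filter.atTop Filter.atTop :=
    Real.tendsto_log_atTop.comp tendsto_natCast_atTop_atTop
  have hy : Filter.Tendsto (fun n : ℕ => 192 * Real.log n) Filter.atTop Filter.atTop :=
    hlog.const_mul_atTop (by norm_num)
  have h1 := hlog.eventually_ge_atTop 1
  have h2 := ((tendsto_rpow_atTop (show 0 < 2 / ε by positivity)).comp hy).eventually_ge_atTop X0
  -- third
  have t3 : ∀ᶠ y : ℝ in Filter.atTop, (192 * y) ^ (2 / ε) ≤ Real.exp y := by
    have := (isLittleO_rpow_exp_pos_mul_atTop (2 / ε) (show (0:ℝ) < 1 / 192 by norm_num)).bound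
      (show (0:ℝ) < 1 by norm_num)
    have h' := (Filter.tendsto_id.const_mul_atTop (show (0:ℝ) < 192 by norm_num)).eventually this
    filter_upwards [h', Filter.eventually_ge_atTop 0] with y hy hy0
    simp only [id] at hy
    rw [Real.norm_of_nonneg (by positivity), Real.norm_of_nonneg (by positivity)] at hy
    convert hy using 1
    rw [one_mul]; congr 1; ring
  have h3 := hlog.eventually t3
  have t4 : ∀ᶠ y : ℝ in Filter.atTop, C * y ≤ Real.exp ((192 * y) ^ (2 / ε * (γ / 2)) / 2) := by
    set b := 2 / ε * (γ / 2) with hb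
    have hb0 : 0 < b := by positivity
    -- with z = (192 y)^b, y = z^(1/b)/192
    have := (isLittleO_rpow_exp_pos_mul_atTop (1 / b) (show (0:ℝ) < 1 / 2 by norm_num)).bound
      (show (0:ℝ) < 192 / C by positivity)
    have hz := ((tendsto_rpow_atTop hb0).comp
      (Filter.tendsto_id.const_mul_atTop (show (0:ℝ) < 192 by norm_num))).eventually this
    filter_upwards [hz, Filter.eventually_ge_atTop 0] with y hy hy0
    simp only [id, Function.comp] at hy
    rw [← Real.rpow_mul (by positivity), mul_one_div_cancel hb0.ne', Real.rpow_one,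
      Real.norm_of_nonneg (by positivity), Real.norm_of_nonneg (by positivity),
      div_mul_eq_mul_div, le_div_iff₀ hC] at hy
    have e : (192 * y) ^ b / 2 = 1 / 2 * (192 * y) ^ b := by ring
    rw [e]; nlinarith
  have h4 := hlog.eventually t4
  obtain ⟨Δ₀, h⟩ := Filter.eventually_atTop.1
    (h1.and (h2.and (h3.and (h4.and (Filter.eventually_ge_atTop 1)))))
  refine ⟨Δ₀, fun Δ hΔ => ?_⟩
  obtain ⟨a1, a2, a3, a4, a5⟩ := h Δ hΔ
  refine ⟨a1, a2, ?_, ?_⟩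
  · rwa [Real.exp_log (by exact_mod_cast a5)] at a3
  · rwa [← Real.rpow_mul (by positivity)]

end LocalMolloy

/-- Molloy's theorem with local list sizes (Theorem 1 of the paper):
for fixed `ε > 0` and sufficiently large `Δ`, with `δ = (192 log Δ)^(2/ε)`,
every triangle-free graph of maximum degree at most `Δ` with lists of size at least
`(1+ε)·max(deg(v)/log deg(v), δ/log δ)` admits a proper colouring from the lists. -/
theorem local_molloy_list_colouring (ε : ℝ) (hε : 0 < ε) :
    ∃ Δ₀ : ℕ, ∀ Δ : ℕ, Δ₀ ≤ Δ →
      ∀ (V : Type) [Fintype V] (G : SimpleGraph V) [DecidableRel G.Adj],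
        G.CliqueFree 3 →
        (∀ v : V, G.degree v ≤ Δ) →
        ∀ L : V → Finset ℕ+,
          (∀ v : V,
            (1 + ε) * max ((G.degree v : ℝ) / Real.log (G.degree v))
                (((192 * Real.log Δ) ^ (2 / ε)) /
                  Real.log ((192 * Real.log Δ) ^ (2 / ε)))
              ≤ ((L v).card : ℝ)) →
          ∃ c : V → ℕ+, (∀ v : V, c v ∈ L v) ∧ ∀ u v : V, G.Adj u v → c u ≠ c v := by
  -- parameters
  obtain ⟨s, hs3⟩ := exists_nat_ge (3 * (2 + ε) / ε)
  have hs3' : 3 * (2 + ε) ≤ s * ε := (div_le_iff₀ hε).1 hs3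
  have hsR : (1 : ℝ) ≤ s := by
    by_contra h
    push Not at h
    nlinarith
  have hs : 1 ≤ s := by exact_mod_cast hsR
  have hs0 : (0 : ℝ) < s := by linarith
  set γ : ℝ := ε / (2 + ε) with hγdef
  have hγ : 0 < γ := by positivity
  have hsq : (1 + 1 / (s : ℝ)) ^ 2 ≤ (1 + ε) * (1 - γ) := by
    have e1 : (1 + ε) * (1 - γ) = 1 + γ := by rw [hγdef]; field_simp; ring
    have e2 : 3 / (s : ℝ) ≤ γ := by
      rw [hγdef, div_le_div_iff₀ hs0 (by positivity)]; linarith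
    have e3 : (1 / (s : ℝ)) ≤ 1 := by rw [div_le_one hs0]; exact hsR
    have e4 : 3 / (s : ℝ) = 3 * (1 / s) := by ring
    have e5 : 0 < 1 / (s : ℝ) := by positivity
    rw [e1]; nlinarith
  set B : ℝ := 16 * (s ^ 2 * (s + 1)) with hB
  have hB32 : 32 ≤ B := by
    have : (1 : ℝ) ≤ (s : ℝ) ^ 2 := by nlinarith
    rw [hB]; nlinarith
  set C : ℝ := 4 * s ^ 2 * (s + 1) * Real.exp s with hC
  have hC0 : 0 < C := by positivity
  obtain ⟨X0, hX0, hD⟩ := LocalMolloy.eventually_D γ hγ B hB32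
  obtain ⟨Δ₀, hΔ₀⟩ := LocalMolloy.eventually_Δ ε γ hε hγ C X0 hC0
  refine ⟨Δ₀, fun Δ hΔ V _ G _ hfree hdeg L hL => ?_⟩
  obtain ⟨b1, b2, b3, b4⟩ := hΔ₀ Δ hΔ
  set δ : ℝ := (192 * Real.log Δ) ^ (2 / ε) with hδ
  have hδ0 : 0 < δ := by linarith
  let D : V → ℝ := fun v => max (G.degree v : ℝ) δ
  have hDδ : ∀ v, δ ≤ D v := fun v => le_max_right _ _
  have hDd : ∀ v, (G.degree v : ℝ) ≤ D v := fun v => le_max_left _ _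
  have hD0 : ∀ v, 0 < D v := fun v => lt_of_lt_of_le hδ0 (hDδ v)
  have hDΔ : ∀ v, Real.log (D v) ≤ Real.log Δ := fun v =>
    Real.log_le_log (hD0 v) (max_le (by exact_mod_cast hdeg v) b3)
  have hDX := fun v => hD (D v) (b2.trans (hDδ v))
  have hk : ∀ v, (1 + ε) * (D v / Real.log (D v)) ≤ (L v).card := by
    intro v
    refine le_trans (mul_le_mul_of_nonneg_left ?_ (by linarith)) (hL v)
    rcases le_total (G.degree v : ℝ) δ with h | h
    · have : D v = δ := max_eq_right h
      rw [this]; exact le_max_right _ _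
    · have : D v = G.degree v := max_eq_left h
      rw [this]; exact le_max_left _ _
  have hl0 : ∀ v, 0 < Real.log (D v) := fun v => by linarith [(hDX v).1]
  have hkpos : ∀ v, (0 : ℝ) < (L v).card := fun v =>
    lt_of_lt_of_le (mul_pos (by linarith) (div_pos (hD0 v) (hl0 v))) (hk v)
  have hdk : ∀ v, (G.degree v : ℝ) / (L v).card ≤ Real.log (D v) / (1 + ε) := by
    intro v
    rw [div_le_div_iff₀ (hkpos v) (by linarith)]
    have := hk v
    rw [← mul_div_assoc, div_le_iff₀ (hl0 v)] at this
    nlinarith [hDd v]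
  have hdk' : ∀ v, (G.degree v : ℝ) / (L v).card ≤ Real.log (D v) := fun v =>
    (hdk v).trans (div_le_self (hl0 v).le (by linarith))
  set ρ : ℝ := 1 / (4 * (s * (s + 1)) * Real.log Δ) with hρ
  have hlΔ : 0 < Real.log Δ := by linarith
  have hρ0 : 0 < ρ := by positivity
  let μ : V → ℝ := fun v => 1 / 2 * (D v ^ γ / Real.log (D v))
  have hμ16 : ∀ v, 16 ≤ μ v := fun v => (hDX v).2.2.2.trans (hDX v).2.2.1
  refine LocalMolloy.core_colouring G L 1 s hs ρ hρ0 (fun v => (G.degree v : ℝ)) μ ?_ ?_ ?_ ?_ ?_ ?_ ?_ ?_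
  · intro v u w hvu hvw huw
    classical
    exact hfree {v, u, w} (SimpleGraph.is3Clique_triple_iff.2 ⟨hvu, hvw, huw⟩)
  · intro v
    rw [← SimpleGraph.card_neighborFinset_eq_degree]
    apply le_of_eq
    congr 2
    ext u; simp
  · intro v; exact_mod_cast hkpos v
  · intro v; linarith [hμ16 v]
  · -- main estimate
    intro v
    have hsd : (1 / 2 : ℝ) ≤ s / (s + 1) := by
      rw [div_le_div_iff₀ (by norm_num) (by linarith)]; linarith
    have hexp : (1 + 1 / (s : ℝ)) * (G.degree v : ℝ) / (s / (s + 1) * ((L v).card : ℝ)) ≤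
        (1 - γ) * Real.log (D v) := by
      have e : (1 + 1 / (s : ℝ)) * (G.degree v : ℝ) / (s / (s + 1) * ((L v).card : ℝ)) =
          (1 + 1 / (s : ℝ)) ^ 2 * ((G.degree v : ℝ) / (L v).card) := by
        have := (hkpos v).ne'
        field_simp
      rw [e]
      calc _ ≤ (1 + 1 / (s : ℝ)) ^ 2 * (Real.log (D v) / (1 + ε)) :=
            mul_le_mul_of_nonneg_left (hdk v) (by positivity)
        _ ≤ ((1 + ε) * (1 - γ)) * (Real.log (D v) / (1 + ε)) :=
            mul_le_mul_of_nonneg_right hsq (div_nonneg (hl0 v).le (by linarith))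
        _ = _ := by field_simp
    have hpow : D v ^ γ / D v = Real.exp (-((1 - γ) * Real.log (D v))) := by
      rw [Real.rpow_def_of_pos (hD0 v)]
      nth_rewrite 2 [← Real.exp_log (hD0 v)]
      rw [← Real.exp_sub]; congr 1; ring
    have hk1 : D v / Real.log (D v) ≤ (L v).card := by
      refine le_trans ?_ (hk v)
      have := div_pos (hD0 v) (hl0 v)
      nlinarith
    have e : μ v = (1 / 2 * (D v / Real.log (D v))) * (D v ^ γ / D v) := by
      have := (hD0 v).ne'
      have := (hl0 v).ne'
      simp only [μ]; field_simp
    rw [e, hpow]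
    refine mul_le_mul (mul_le_mul hsd hk1 (div_pos (hD0 v) (hl0 v)).le (by positivity))
      (Real.exp_le_exp.2 (neg_le_neg hexp)) (Real.exp_pos _).le (by positivity)
  · intro v
    calc (s : ℝ) * (s + 1) * (G.degree v : ℝ) / (L v).card * ρ
        = (s * (s + 1) * ρ) * ((G.degree v : ℝ) / (L v).card) := by ring
      _ ≤ (s * (s + 1) * ρ) * Real.log Δ :=
          mul_le_mul_of_nonneg_left ((hdk' v).trans (hDΔ v)) (by positivity)
      _ = 1 / 4 := by rw [hρ]; field_simp
  · intro v
    have h2 : (2 : ℝ) ≤ Real.exp 1 := by linarith [Real.add_one_le_exp (1 : ℝ)]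
    have : (4 : ℝ) ≤ Real.exp (μ v / 4) := by
      calc (4 : ℝ) ≤ Real.exp 1 * Real.exp 1 := by nlinarith
        _ = Real.exp 2 := by rw [← Real.exp_add]; norm_num
        _ ≤ _ := Real.exp_le_exp.2 (by linarith [hμ16 v])
    rw [Real.exp_neg, one_div]
    exact inv_anti₀ (by norm_num) this
  · intro v
    have p1 : s * ((s : ℝ) * (s + 1) * (G.degree v : ℝ) / (L v).card * ρ) ≤ ρ * (μ v / 16) := by
      calc s * ((s : ℝ) * (s + 1) * (G.degree v : ℝ) / (L v).card * ρ)
          = (s * (s * (s + 1)) * ρ) * ((G.degree v : ℝ) / (L v).card) := by ring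
        _ ≤ (s * (s * (s + 1)) * ρ) * Real.log (D v) :=
            mul_le_mul_of_nonneg_left (hdk' v) (by positivity)
        _ = ρ * (B * Real.log (D v) / 16) := by rw [hB]; ring
        _ ≤ _ := by
            refine mul_le_mul_of_nonneg_left ?_ hρ0.le
            have := (hDX v).2.1
            simp only [μ]; linarith
    have p2 : s * (Real.exp s * Real.exp (-(μ v / 2))) ≤ ρ := by
      have h : C * Real.log Δ ≤ Real.exp (μ v / 2) := by
        refine b4.trans (Real.exp_le_exp.2 ?_)
        have h1 : δ ^ (γ / 2) ≤ D v ^ (γ / 2) :=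
          Real.rpow_le_rpow hδ0.le (hDδ v) (by positivity)
        have h2 : D v ^ (γ / 2) ≤ μ v := (hDX v).2.2.1
        linarith
      rw [hρ, le_div_iff₀ (by positivity), Real.exp_neg]
      have e : s * (Real.exp s * (Real.exp (μ v / 2))⁻¹) * (4 * (s * (s + 1)) * Real.log Δ) =
          C * Real.log Δ / Real.exp (μ v / 2) := by rw [hC]; ring
      rw [e]
      exact div_le_one_of_le₀ h (Real.exp_pos _).le
    have p3 : ρ ≤ ρ * (μ v / 16) := by nlinarith [hμ16 v]
    show s * ((s : ℝ) * (s + 1) * (G.degree v : ℝ) / (L v).card * ρ +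
      Real.exp s * Real.exp (-(μ v / 2))) ≤ ρ * (μ v / 8)
    rw [mul_add]
    linarith
end

section
/- Let G be a finite simple graph and L : V(G) → 2^{ℤ⁺} a list assignment of G. Suppose there is a function ℓ : V(G) → ℤ with ℓ(u) ≥ 3 for all u, such that for all u ∈ V(G): |L(u)| ≥ ℓ(u), and for every colour c ∈ L(u) and every v ∈ N_G(u), the number of neighbours w ∈ N_G(u) with c ∈ L(w) is at most ℓ(v)/8. Then there exists a proper colouring c : V(G) → ℤ⁺ of G such that c(u) ∈ L(u) for all u ∈ V(G). -/
/-- Proper partial list colourings of `S`, extended by `1` outside `S`. -/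
noncomputable def partialColourings {V : Type*} [Fintype V] [DecidableEq V]
    (G : SimpleGraph V) (L : V → Finset ℕ+) (S : Finset V) : Finset (V → ℕ+) :=
  by
    classical
    exact (Fintype.piFinset (fun v => if v ∈ S then L v else {1})).filter
      (fun f => ∀ u ∈ S, ∀ v ∈ S, G.Adj u v → f u ≠ f v)

theorem mem_partialColourings {V : Type*} [Fintype V] [DecidableEq V]
    (G : SimpleGraph V) (L : V → Finset ℕ+) (S : Finset V) (f : V → ℕ+) :
    f ∈ partialColourings G L S ↔ ((∀ v ∈ S, f v ∈ L v) ∧ (∀ v, v ∉ S → f v = 1) ∧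
      ∀ u ∈ S, ∀ v ∈ S, G.Adj u v → f u ≠ f v) := by
  classical
  unfold partialColourings
  rw [Finset.mem_filter, Fintype.mem_piFinset, ← and_assoc]
  refine and_congr_left fun _ => ⟨fun h => ⟨fun v hv => ?_, fun v hv => ?_⟩, fun h v => ?_⟩
  · simpa [hv] using h v
  · simpa [hv] using h v
  · by_cases hv : v ∈ S
    · simpa [hv] using h.1 v hv
    · simpa [hv] using h.2 v hv

/-- Colourings with a prescribed colour at `w` are at most those of `S.erase w`. -/
theorem card_prescribed_le {V : Type*} [Fintype V] [DecidableEq V]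
    (G : SimpleGraph V) (L : V → Finset ℕ+) (S : Finset V) (w : V) (c : ℕ+) :
    ((partialColourings G L S).filter (fun f => f w = c)).card ≤
      (partialColourings G L (S.erase w)).card := by
  refine Finset.card_le_card_of_injOn (fun f => Function.update f w 1) ?_ ?_
  · intro f hf
    have hf := Finset.mem_filter.1 (Finset.mem_coe.1 hf)
    obtain ⟨h1, h2, h3⟩ := (mem_partialColourings G L S f).1 hf.1
    refine Finset.mem_coe.2 ((mem_partialColourings G L _ _).2 ⟨?_, ?_, ?_⟩)
    · intro v hv
      rw [Finset.mem_erase] at hv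
      simpa [hv.1] using h1 v hv.2
    · intro v hv
      by_cases hvw : v = w
      · subst hvw; simp
      · simp only [Function.update_of_ne hvw]
        exact h2 v fun h => hv (Finset.mem_erase.2 ⟨hvw, h⟩)
    · intro u hu v hv huv
      rw [Finset.mem_erase] at hu hv
      simpa [hu.1, hv.1] using h3 u hu.2 v hv.2 huv
  · intro f hf g hg hfg
    have hf := (Finset.mem_filter.1 (Finset.mem_coe.1 hf)).2
    have hg := (Finset.mem_filter.1 (Finset.mem_coe.1 hg)).2
    funext x
    by_cases hx : x = w
    · subst hx; rw [hf, hg]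
    · have := congrFun hfg x
      simpa [hx] using this

/-- Extending colourings of `S` by a vertex `v`: only conflicts with neighbours are lost. -/
theorem card_extend {V : Type*} [Fintype V] [DecidableEq V]
    (G : SimpleGraph V) [DecidableRel G.Adj] (L : V → Finset ℕ+) (S : Finset V) (v : V)
    (hv : v ∉ S) :
    (L v).card * (partialColourings G L S).card ≤
      (partialColourings G L (insert v S)).card +
      ∑ c ∈ L v, ∑ w ∈ (G.neighborFinset v).filter (fun w => c ∈ L w),
        if w ∈ S then ((partialColourings G L S).filter (fun f => f w = c)).card else 0 := by
  classical
  set C := partialColourings G L S with hC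
  let P : ℕ+ × (V → ℕ+) → Prop := fun p => ∀ w ∈ S, G.Adj v w → p.2 w ≠ p.1
  have hsplit := Finset.card_filter_add_card_filter_not (s := (L v) ×ˢ C) P
  rw [Finset.card_product] at hsplit
  rw [← hsplit]
  refine Nat.add_le_add ?_ ?_
  · refine Finset.card_le_card_of_injOn (fun p => Function.update p.2 v p.1) ?_ ?_
    · rintro ⟨c, f⟩ hp
      obtain ⟨hp, hP⟩ := Finset.mem_filter.1 (Finset.mem_coe.1 hp)
      obtain ⟨hc, hf⟩ := Finset.mem_product.1 hp
      obtain ⟨h1, h2, h3⟩ := (mem_partialColourings G L S f).1 hf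
      have hne : ∀ x ∈ S, x ≠ v := fun x hx h => hv (h ▸ hx)
      refine Finset.mem_coe.2 ((mem_partialColourings G L _ _).2 ⟨?_, ?_, ?_⟩)
      · intro x hx
        rcases Finset.mem_insert.1 hx with rfl | hx
        · simpa using hc
        · simpa [hne x hx] using h1 x hx
      · intro x hx
        rw [Finset.mem_insert, not_or] at hx
        simpa [hx.1] using h2 x hx.2
      · intro x hx y hy hxy
        rcases Finset.mem_insert.1 hx with rfl | hxS
        · rcases Finset.mem_insert.1 hy with rfl | hy
          · exact absurd hxy (G.irrefl)
          · simpa [hne y hy] using (hP y hy hxy).symm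
        · rcases Finset.mem_insert.1 hy with rfl | hy
          · simpa [hne x hxS] using hP x hxS hxy.symm
          · simpa [hne x hxS, hne y hy] using h3 x hxS y hy hxy
    · rintro ⟨c, f⟩ hp ⟨d, g⟩ hq h
      have hf := (Finset.mem_product.1 (Finset.mem_filter.1 (Finset.mem_coe.1 hp)).1).2
      have hg := (Finset.mem_product.1 (Finset.mem_filter.1 (Finset.mem_coe.1 hq)).1).2
      have hf := ((mem_partialColourings G L S f).1 hf).2.1 v hv
      have hg := ((mem_partialColourings G L S g).1 hg).2.1 v hv
      have e1 : c = d := by simpa using congrFun h v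
      have e2 : f = g := by
        funext x
        by_cases hx : x = v
        · subst hx; rw [hf, hg]
        · simpa [hx] using congrFun h x
      rw [e1, e2]
  · have hsub : ((L v) ×ˢ C).filter (fun p => ¬ P p) ⊆
        (L v).biUnion fun c => ((G.neighborFinset v).filter (fun w => c ∈ L w)).biUnion fun w =>
          if w ∈ S then {c} ×ˢ (C.filter (fun f => f w = c)) else ∅ := by
      rintro ⟨c, f⟩ hp
      obtain ⟨hp, hP⟩ := Finset.mem_filter.1 hp
      obtain ⟨hc, hf⟩ := Finset.mem_product.1 hp
      have hP : ∃ w ∈ S, G.Adj v w ∧ f w = c := by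
        by_contra hcon
        exact hP fun w hw ha he => hcon ⟨w, hw, ha, he⟩
      obtain ⟨w, hw, ha, he⟩ := hP
      have hL := ((mem_partialColourings G L S f).1 hf).1 w hw
      refine Finset.mem_biUnion.2 ⟨c, hc, Finset.mem_biUnion.2 ⟨w, ?_, ?_⟩⟩
      · rw [Finset.mem_filter, SimpleGraph.mem_neighborFinset]
        exact ⟨ha, he ▸ hL⟩
      · rw [if_pos hw, Finset.mem_product, Finset.mem_filter]
        exact ⟨Finset.mem_singleton.2 rfl, hf, he⟩
    refine (Finset.card_le_card hsub).trans (Finset.card_biUnion_le.trans ?_)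
    refine Finset.sum_le_sum fun c _ => Finset.card_biUnion_le.trans ?_
    refine Finset.sum_le_sum fun w _ => ?_
    split_ifs <;> simp

/-- Reciprocal weights of a set of size at most an eighth of each weight sum to at most `1/8`. -/
theorem sum_inv_le_eighth {V : Type*} (W : Finset V) (ℓ : V → ℝ)
    (h : ∀ w ∈ W, (W.card : ℝ) ≤ ℓ w / 8) : ∑ w ∈ W, 1 / ℓ w ≤ 1 / 8 := by
  rcases W.eq_empty_or_nonempty with rfl | hne
  · simp
  have hW : (0 : ℝ) < W.card := by exact_mod_cast hne.card_pos
  calc ∑ w ∈ W, 1 / ℓ w ≤ ∑ w ∈ W, 1 / (8 * (W.card : ℝ)) := by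
        refine Finset.sum_le_sum fun w hw => ?_
        refine one_div_le_one_div_of_le (by positivity) ?_
        linarith [h w hw]
    _ = 1 / 8 := by
        rw [Finset.sum_const, nsmul_eq_mul]
        field_simp

/-- Corollary 7 of the paper (the local "finishing blow" for list colouring):
given a list assignment `L` and `ℓ : V(G) → ℤ` with `ℓ(u) ≥ 3`, `|L(u)| ≥ ℓ(u)`,
such that for every `u`, every colour `c ∈ L(u)` and every neighbour `v` of `u`, the
number of neighbours `w` of `u` whose list contains `c` is at most `ℓ(v)/8`, there is a
proper colouring of `G` from the lists. -/
theorem finishing_blow_lists {V : Type*} [Fintype V] [DecidableEq V]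
    (G : SimpleGraph V) [DecidableRel G.Adj]
    (L : V → Finset ℕ+) (ℓ : V → ℤ)
    (h3 : ∀ u : V, 3 ≤ ℓ u)
    (hsize : ∀ u : V, ℓ u ≤ ((L u).card : ℤ))
    (hcount : ∀ u : V, ∀ c ∈ L u, ∀ v ∈ G.neighborFinset u,
      ((((G.neighborFinset u).filter fun w => c ∈ L w).card : ℝ)) ≤ (ℓ v : ℝ) / 8) :
    ∃ f : V → ℕ+, (∀ u : V, f u ∈ L u) ∧ ∀ u v : V, G.Adj u v → f u ≠ f v := by
  have hpos : ∀ w, (0 : ℝ) < (ℓ w : ℝ) := fun w => by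
    have : (0 : ℤ) < ℓ w := by linarith [h3 w]
    exact_mod_cast this
  have hsize' : ∀ w, (ℓ w : ℝ) ≤ ((L w).card : ℝ) := fun w => by exact_mod_cast hsize w
  -- Rosenfeld-style counting: adding a vertex multiplies the count by at least half the list size
  have key : ∀ S : Finset V, ∀ v, v ∉ S →
      ((L v).card : ℝ) * (partialColourings G L S).card ≤
        2 * (partialColourings G L (insert v S)).card := by
    intro S
    induction S using Finset.strongInduction with
    | H S ih =>
      intro v hv
      set N : ℝ := ((partialColourings G L S).card : ℝ) with hN
      have hN0 : 0 ≤ N := by positivity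
      have hext : ((L v).card : ℝ) * N ≤ ((partialColourings G L (insert v S)).card : ℝ) +
          ∑ c ∈ L v, ∑ w ∈ (G.neighborFinset v).filter (fun w => c ∈ L w),
            ((if w ∈ S then ((partialColourings G L S).filter (fun f => f w = c)).card
              else 0 : ℕ) : ℝ) := by
        rw [hN]
        exact_mod_cast card_extend G L S v hv
      have hbad : ∑ c ∈ L v, ∑ w ∈ (G.neighborFinset v).filter (fun w => c ∈ L w),
            ((if w ∈ S then ((partialColourings G L S).filter (fun f => f w = c)).card
              else 0 : ℕ) : ℝ) ≤ ∑ c ∈ L v, N / 4 := by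
        refine Finset.sum_le_sum fun c hc => ?_
        have hterm : ∀ w ∈ (G.neighborFinset v).filter (fun w => c ∈ L w),
            ((if w ∈ S then ((partialColourings G L S).filter (fun f => f w = c)).card
              else 0 : ℕ) : ℝ) ≤ 2 * N * (1 / (ℓ w : ℝ)) := by
          intro w _
          have hp := hpos w
          split_ifs with hw
          · have h1 := ih (S.erase w) (Finset.erase_ssubset hw) w (Finset.notMem_erase w S)
            rw [Finset.insert_erase hw, ← hN] at h1
            have h2 : (((partialColourings G L S).filter (fun f => f w = c)).card : ℝ) ≤
                ((partialColourings G L (S.erase w)).card : ℝ) := by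
              exact_mod_cast card_prescribed_le G L S w c
            rw [mul_one_div, le_div_iff₀ hp]
            calc _ ≤ ((partialColourings G L (S.erase w)).card : ℝ) * ((L w).card : ℝ) :=
                  mul_le_mul h2 (hsize' w) hp.le (by positivity)
              _ ≤ 2 * N := by linarith
          · push_cast
            positivity
        refine (Finset.sum_le_sum hterm).trans ?_
        rw [← Finset.mul_sum]
        have h8 := sum_inv_le_eighth ((G.neighborFinset v).filter (fun w => c ∈ L w))
          (fun w => (ℓ w : ℝ))
          (fun w hw => hcount v c hc w (Finset.mem_filter.1 hw).1)
        calc _ ≤ 2 * N * (1 / 8) := mul_le_mul_of_nonneg_left h8 (by positivity)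
          _ = N / 4 := by ring
      rw [Finset.sum_const, nsmul_eq_mul] at hbad
      have : 0 ≤ ((L v).card : ℝ) * N := by positivity
      linarith
  have hall : ∀ S : Finset V, (0 : ℝ) < (partialColourings G L S).card := by
    intro S
    induction S using Finset.induction_on with
    | empty =>
      have : (fun _ => 1) ∈ partialColourings G L ∅ := by
        rw [mem_partialColourings]
        simp
      exact_mod_cast Finset.card_pos.2 ⟨_, this⟩
    | insert v S hv ihS =>
      have h1 := key S v hv
      have h2 : 0 < ((L v).card : ℝ) * (partialColourings G L S).card :=
        mul_pos ((hpos v).trans_le (hsize' v)) ihS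
      linarith
  have hu : 0 < (partialColourings G L Finset.univ).card := by exact_mod_cast hall Finset.univ
  obtain ⟨f, hf⟩ := Finset.card_pos.1 hu
  obtain ⟨h1, -, h2⟩ := (mem_partialColourings G L _ f).1 hf
  exact ⟨f, fun u => h1 u (Finset.mem_univ u),
    fun u v => h2 u (Finset.mem_univ u) v (Finset.mem_univ v)⟩
end

section
/- Fix ε > 0. There exists Δ₀ such that for every Δ ≥ Δ₀ the following holds, where δ = (192 log Δ)^{2/ε}. Let G be a finite triangle-free simple graph of maximum degree at most Δ and let ℋ = (L, H) be a cover of G such that |L(u)| ≥ (1+ε)·max{deg(u)/log deg(u), δ/log δ} for all u ∈ V(G). Then G is ℋ-colourable. -/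
/-- A finite set of vertices is independent in `G`. -/
def IndepFinset {V : Type*} (G : SimpleGraph V) (s : Finset V) : Prop :=
  ∀ u ∈ s, ∀ v ∈ s, ¬ G.Adj u v

instance {V : Type*} (G : SimpleGraph V) [DecidableRel G.Adj] (s : Finset V) :
    Decidable (IndepFinset G s) :=
  inferInstanceAs (Decidable (∀ u ∈ s, ∀ v ∈ s, ¬ G.Adj u v))

/-- `(L, H)` is a cover of the graph `G` (in the sense of correspondence/DP-colouring):
(1) the sets `L u` partition the vertices of `H`; (2) each `L u` induces a complete
subgraph of `H`; (3) edges of `H` only join colours of a vertex or of adjacent vertices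
of `G`; (4) for adjacent `u v`, the edges of `H` between `L u` and `L v` form a matching. -/
def IsCover {V U : Type*} (G : SimpleGraph V) (H : SimpleGraph U) (L : V → Finset U) :
    Prop :=
  (∀ c : U, ∃! u : V, c ∈ L u) ∧
  (∀ u : V, ∀ c ∈ L u, ∀ d ∈ L u, c ≠ d → H.Adj c d) ∧
  (∀ c d : U, H.Adj c d → ∀ u v : V, c ∈ L u → d ∈ L v → u = v ∨ G.Adj u v) ∧
  (∀ u v : V, G.Adj u v →
    ∀ c ∈ L u, ∀ d ∈ L v, ∀ d' ∈ L v, H.Adj c d → H.Adj c d' → d = d')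

/-- The degree `deg*_ℋ(c)` of a colour `c` in the cross-edge subgraph `H*` of the cover:
the number of `H`-neighbours of `c` lying in a part different from that of `c`. -/
def degStar {V U : Type*} [Fintype V] [Fintype U] [DecidableEq U]
    (H : SimpleGraph U) [DecidableRel H.Adj] (L : V → Finset U) (c : U) : ℕ :=
  (Finset.univ.filter fun d : U => H.Adj c d ∧ ∀ u : V, c ∈ L u → d ∉ L u).card

namespace Molloy

open Finset Function Classical

variable {V U : Type} [Fintype V] [Fintype U]

/-- `f` is a colouring of the vertices in `S` (and is undefined elsewhere). -/
def IsCol (H : SimpleGraph U) (L : V → Finset U) (S : Finset V) (f : V → Option U) : Prop :=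
  (∀ u ∈ S, ∃ c ∈ L u, f u = some c) ∧ (∀ u, u ∉ S → f u = none) ∧
    (∀ u v c d, f u = some c → f v = some d → ¬ H.Adj c d)

noncomputable def Col (H : SimpleGraph U) (L : V → Finset U) (S : Finset V) :
    Finset (V → Option U) := univ.filter (fun f => IsCol H L S f)

/-- available colours at `u`, ignoring the colour of `u` itself -/
noncomputable def Av (H : SimpleGraph U) (L : V → Finset U) (f : V → Option U) (u : V) :
    Finset U := (L u).filter (fun c => ∀ w, w ≠ u → ∀ d, f w = some d → ¬ H.Adj c d)

theorem mem_Col {H : SimpleGraph U} {L : V → Finset U} {S : Finset V} {f : V → Option U} :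
    f ∈ Col H L S ↔ IsCol H L S f := by simp [Col]

theorem mem_Av {H : SimpleGraph U} {L : V → Finset U} {u : V} {f : V → Option U} {c : U} :
    c ∈ Av H L f u ↔ c ∈ L u ∧ ∀ w, w ≠ u → ∀ d, f w = some d → ¬ H.Adj c d := by simp [Av]

theorem IsCol.mem {H : SimpleGraph U} {L : V → Finset U} {S : Finset V} {f : V → Option U}
    (h : IsCol H L S f) {u : V} {c : U} (hc : f u = some c) : c ∈ L u := by
  by_cases hu : u ∈ S
  · obtain ⟨d, hd, hd'⟩ := h.1 u hu
    rw [hd'] at hc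
    simp at hc
    exact hc ▸ hd
  · simp [h.2.1 u hu] at hc

theorem Av_update_self (H : SimpleGraph U) (L : V → Finset U) (f : V → Option U) (v : V)
    (x : Option U) : Av H L (update f v x) v = Av H L f v := by
  ext c
  simp only [mem_Av]
  refine and_congr_right fun _ => forall_congr' fun w => forall_congr' fun hw => ?_
  rw [update_of_ne hw]

theorem IsCol.update_insert {H : SimpleGraph U} {L : V → Finset U} {S : Finset V}
    {f : V → Option U} (h : IsCol H L S f) {v : V} {c : U} (hc : c ∈ Av H L f v) :
    IsCol H L (insert v S) (update f v (some c)) := by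
  rw [mem_Av] at hc
  refine ⟨?_, ?_, ?_⟩
  · intro u hu
    by_cases huv : u = v
    · subst huv; exact ⟨c, hc.1, by simp⟩
    · rw [update_of_ne huv]; exact h.1 u ((mem_insert.1 hu).resolve_left huv)
  · intro u hu
    rw [mem_insert, not_or] at hu
    rw [update_of_ne hu.1]; exact h.2.1 u hu.2
  · intro u w a b ha hb
    by_cases huv : u = v
    · subst huv
      simp at ha
      subst ha
      by_cases hwv : w = u
      · subst hwv
        simp at hb
        subst hb
        exact H.irrefl
      · rw [update_of_ne hwv] at hb
        exact hc.2 w hwv b hb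
    · rw [update_of_ne huv] at ha
      by_cases hwv : w = v
      · subst hwv
        simp at hb
        subst hb
        exact fun hh => hc.2 u huv a ha hh.symm
      · rw [update_of_ne hwv] at hb
        exact h.2.2 u w a b ha hb

theorem IsCol.erase {H : SimpleGraph U} {L : V → Finset U} {S : Finset V}
    {g : V → Option U} {v : V} (hv : v ∉ S) (h : IsCol H L (insert v S) g) :
    IsCol H L S (update g v none) := by
  refine ⟨?_, ?_, ?_⟩
  · intro u hu
    have huv : u ≠ v := fun e => hv (e ▸ hu)
    rw [update_of_ne huv]
    exact h.1 u (mem_insert_of_mem hu)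
  · intro u hu
    by_cases huv : u = v
    · subst huv; simp
    · rw [update_of_ne huv]; exact h.2.1 u (by simp [huv, hu])
  · intro u w a b ha hb
    by_cases huv : u = v
    · subst huv; simp at ha
    by_cases hwv : w = v
    · subst hwv; simp at hb
    rw [update_of_ne huv] at ha
    rw [update_of_ne hwv] at hb
    exact h.2.2 u w a b ha hb

theorem sum_Col_insert (H : SimpleGraph U) (L : V → Finset U) (S : Finset V) (v : V)
    (hv : v ∉ S) (Φ : (V → Option U) → ℝ) :
    ∑ g ∈ Col H L (insert v S), Φ g
      = ∑ f ∈ Col H L S, ∑ c ∈ Av H L f v, Φ (update f v (some c)) := by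
  rw [Finset.sum_sigma']
  symm
  refine Finset.sum_bij (fun x _ => update x.1 v (some x.2)) ?_ ?_ ?_ ?_
  · rintro ⟨f, c⟩ hx
    simp only [mem_sigma, mem_Col] at hx
    exact mem_Col.2 (hx.1.update_insert hx.2)
  · rintro ⟨f, c⟩ hx ⟨f', c'⟩ hx' heq
    simp only [mem_sigma, mem_Col] at hx hx'
    have h1 : c = c' := by
      have := congrFun heq v
      simpa using this
    have h2 : f = f' := by
      funext w
      by_cases hw : w = v
      · subst hw; rw [hx.1.2.1 _ hv, hx'.1.2.1 _ hv]
      · have := congrFun heq w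
        simpa [update_of_ne hw] using this
    subst h1; subst h2; rfl
  · intro g hg
    rw [mem_Col] at hg
    obtain ⟨c, hc, hgc⟩ := hg.1 v (mem_insert_self _ _)
    refine ⟨⟨update g v none, c⟩, ?_, ?_⟩
    · simp only [mem_sigma, mem_Col]
      refine ⟨hg.erase hv, ?_⟩
      rw [Av_update_self, mem_Av]
      exact ⟨hc, fun w _ d hd => hg.2.2 v w c d hgc hd⟩
    · simp [← hgc]
  · intros; rfl

theorem resample (H : SimpleGraph U) (L : V → Finset U) (S : Finset V) (u : V)
    (hu : u ∈ S) (Φ : (V → Option U) → ℝ) :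
    ∑ f ∈ Col H L S, Φ f
      = ∑ f ∈ Col H L S,
        (∑ c ∈ Av H L f u, Φ (update f u (some c))) / ((Av H L f u).card : ℝ) := by
  have hS : S = insert u (S.erase u) := (insert_erase hu).symm
  rw [hS, sum_Col_insert H L _ u (by simp), sum_Col_insert H L _ u (by simp)]
  refine sum_congr rfl fun h _ => ?_
  simp only [Av_update_self, update_idem, sum_const, nsmul_eq_mul]
  by_cases h0 : (Av H L h u).card = 0
  · rw [card_eq_zero] at h0; simp [h0]
  · have : ((Av H L h u).card : ℝ) ≠ 0 := by exact_mod_cast h0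
    field_simp

theorem one_step (A L : Finset U) (adj : U → U → Prop) (b : U → ℝ)
    (hb0 : ∀ c, 0 ≤ b c) (hb1 : ∀ c, b c ≤ 1) (hA : A.Nonempty)
    (hadj : ∀ a ∈ A, ∀ c ∈ L, ∀ c' ∈ L, adj a c → adj a c' → c = c') :
    (∑ a ∈ A, ∏ c ∈ L, (1 - b c * (if adj a c then 0 else 1))) / (A.card : ℝ)
      ≤ ∏ c ∈ L, (1 - b c * (1 - ((A.filter fun a => adj a c).card : ℝ) / (A.card : ℝ))) := by
  have hAc : (0 : ℝ) < A.card := by exact_mod_cast hA.card_pos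
  induction L using Finset.induction_on with
  | empty => simp [hAc.ne']
  | insert x L hx ih =>
    have ih' := ih (fun a ha c hc c' hc' => hadj a ha c (mem_insert_of_mem hc) c'
      (mem_insert_of_mem hc'))
    simp only [prod_insert hx]
    set g : U → ℝ := fun a => ∏ c ∈ L, (1 - b c * (if adj a c then 0 else 1)) with hg
    set p : ℝ := ((A.filter fun a => adj a x).card : ℝ) / (A.card : ℝ) with hp
    set m : ℝ := ∏ c ∈ L, (1 - b c) with hm
    have hmg : ∀ a, m ≤ g a := by
      intro a
      refine prod_le_prod (fun c _ => by linarith [hb1 c]) (fun c _ => ?_)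
      split_ifs
      · linarith [hb0 c]
      · linarith
    have hmavg : m ≤ (∑ a ∈ A, g a) / A.card := by
      rw [le_div_iff₀ hAc]
      calc m * A.card = ∑ a ∈ A, m := by simp [mul_comm]
        _ ≤ _ := sum_le_sum fun a _ => hmg a
    have hp0 : 0 ≤ p := by positivity
    have hp1 : p ≤ 1 := by
      rw [hp, div_le_one hAc]
      exact_mod_cast card_filter_le _ _
    have hsum : ∑ a ∈ A, (1 - b x * (if adj a x then 0 else 1)) * g a
        = (1 - b x) * ∑ a ∈ A, g a + b x * (p * A.card * m) := by
      have h1 : ∀ a ∈ A, (1 - b x * (if adj a x then 0 else 1)) * g a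
          = (1 - b x) * g a + b x * (if adj a x then m else 0) := by
        intro a ha
        split_ifs with h
        · have : g a = m := by
            refine prod_congr rfl fun c hc => ?_
            have : ¬ adj a c := fun h' => hx ((hadj a ha c (mem_insert_of_mem hc) x
              (mem_insert_self _ _) h' h) ▸ hc)
            simp [this]
          rw [this]; ring
        · ring
      rw [sum_congr rfl h1, sum_add_distrib, ← mul_sum, ← mul_sum, ← sum_filter, sum_const,
        nsmul_eq_mul, hp]
      field_simp
    rw [hsum]
    calc ((1 - b x) * ∑ a ∈ A, g a + b x * (p * A.card * m)) / A.card
        = (1 - b x) * ((∑ a ∈ A, g a) / A.card) + b x * p * m := by field_simp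
      _ ≤ (1 - b x) * ((∑ a ∈ A, g a) / A.card) + b x * p * ((∑ a ∈ A, g a) / A.card) := by
          have : 0 ≤ b x * p := mul_nonneg (hb0 x) hp0
          gcongr
      _ = (1 - b x * (1 - p)) * ((∑ a ∈ A, g a) / A.card) := by ring
      _ ≤ _ := by
          refine mul_le_mul_of_nonneg_left ih' ?_
          nlinarith [hb0 x, hb1 x]

theorem Av_update_other {G : SimpleGraph V} {H : SimpleGraph U} {L : V → Finset U}
    (hcov : IsCover G H L) {S : Finset V} {f : V → Option U} (hf : IsCol H L S f) {u u' : V}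
    (hne : u' ≠ u) (hadj : ¬ G.Adj u' u) {c : U} (hc : c ∈ L u) :
    Av H L (update f u (some c)) u' = Av H L f u' := by
  ext a
  simp only [mem_Av]
  refine and_congr_right fun ha => forall_congr' fun w => forall_congr' fun hw => ?_
  by_cases hwu : w = u
  · subst hwu
    have key : ∀ d ∈ L w, ¬ H.Adj a d := by
      intro d hd h
      rcases hcov.2.2.1 a d h u' w ha hd with h | h
      · exact hne h
      · exact hadj h
    constructor
    · intro _ d hd
      exact key d (hf.mem hd)
    · intro _ d hd
      simp at hd
      exact hd ▸ key c hc
  · rw [update_of_ne hwu]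

theorem Av_nonempty {H : SimpleGraph U} {L : V → Finset U} {S : Finset V} {f : V → Option U}
    (hf : IsCol H L S f) {u : V} (hu : u ∈ S) : (Av H L f u).Nonempty := by
  obtain ⟨c, hc, hfc⟩ := hf.1 u hu
  exact ⟨c, mem_Av.2 ⟨hc, fun w _ d hd => hf.2.2 u w c d hfc hd⟩⟩

theorem IsCol.update_mem {H : SimpleGraph U} {L : V → Finset U} {S : Finset V}
    {f : V → Option U} (h : IsCol H L S f) {v : V} (hv : v ∈ S) {c : U}
    (hc : c ∈ Av H L f v) : IsCol H L S (update f v (some c)) := by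
  have := h.update_insert hc
  rwa [insert_eq_of_mem hv] at this

noncomputable def pp (H : SimpleGraph U) (L : V → Finset U) (f : V → Option U) (u : V) (c : U) :
    ℝ := (((Av H L f u).filter fun a => H.Adj a c).card : ℝ) / ((Av H L f u).card : ℝ)

noncomputable def YY (H : SimpleGraph U) (f : V → Option U) (u : V) (c : U) : ℝ :=
  if ∃ a, f u = some a ∧ H.Adj a c then 0 else 1

theorem pp_nonneg (H : SimpleGraph U) (L : V → Finset U) (f : V → Option U) (u : V) (c : U) :
    0 ≤ pp H L f u c := by unfold pp; positivity

theorem pp_le_one (H : SimpleGraph U) (L : V → Finset U) (f : V → Option U) (u : V) (c : U) :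
    pp H L f u c ≤ 1 := by
  unfold pp
  refine div_le_one_of_le₀ ?_ (by positivity)
  exact_mod_cast card_filter_le _ _

theorem YY_nonneg (H : SimpleGraph U) (f : V → Option U) (u : V) (c : U) :
    0 ≤ YY H f u c := by unfold YY; split_ifs <;> norm_num

theorem YY_le_one (H : SimpleGraph U) (f : V → Option U) (u : V) (c : U) :
    YY H f u c ≤ 1 := by unfold YY; split_ifs <;> norm_num

theorem mgf {G : SimpleGraph V} {H : SimpleGraph U} {L : V → Finset U}
    (hcov : IsCover G H L) (S : Finset V) (C : Finset U) (W : (V → Option U) → ℝ)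
    (hW : ∀ f, 0 ≤ W f) (Q : Finset V)
    (hQS : ∀ u ∈ Q, u ∈ S) (hQ : ∀ u ∈ Q, ∀ u' ∈ Q, ¬ G.Adj u u')
    (hmatch : ∀ u ∈ Q, ∀ a ∈ L u, ∀ c ∈ C, ∀ c' ∈ C, H.Adj a c → H.Adj a c' → c = c')
    (hWinv : ∀ f ∈ Col H L S, ∀ u ∈ Q, ∀ a ∈ Av H L f u, W (update f u (some a)) = W f) :
    ∀ (B : (V → Option U) → U → ℝ), (∀ f c, 0 ≤ B f c) → (∀ f c, B f c ≤ 1) →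
    (∀ f ∈ Col H L S, ∀ u ∈ Q, ∀ a ∈ Av H L f u, B (update f u (some a)) = B f) →
    ∑ f ∈ Col H L S, W f * ∏ c ∈ C, (1 - B f c * ∏ u ∈ Q, YY H f u c)
      ≤ ∑ f ∈ Col H L S, W f * ∏ c ∈ C, (1 - B f c * ∏ u ∈ Q, (1 - pp H L f u c)) := by
  induction Q using Finset.induction_on with
  | empty => intro B _ _ _; simp
  | insert u Q hu ih =>
    intro B hB0 hB1 hBinv
    have hS : u ∈ S := hQS u (mem_insert_self _ _)
    have hne : ∀ u' ∈ Q, u' ≠ u := fun u' h e => hu (e ▸ h)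
    have ih' := ih (fun x hx => hQS x (mem_insert_of_mem hx))
      (fun x hx y hy => hQ x (mem_insert_of_mem hx) y (mem_insert_of_mem hy))
      (fun x hx => hmatch x (mem_insert_of_mem hx))
      (fun f hf x hx => hWinv f hf x (mem_insert_of_mem hx))
      (fun f c => B f c * (1 - pp H L f u c))
      (fun f c => mul_nonneg (hB0 f c) (by linarith [pp_le_one H L f u c]))
      (fun f c => mul_le_one₀ (hB1 f c) (by linarith [pp_le_one H L f u c])
        (by linarith [pp_nonneg H L f u c]))
      (by
        intro f hf x hx a ha
        funext c
        have h1 : Av H L (update f x (some a)) u = Av H L f u :=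
          Av_update_other hcov (mem_Col.1 hf) (hne x hx).symm
            (hQ u (mem_insert_self _ _) x (mem_insert_of_mem hx)) (mem_Av.1 ha).1
        simp only [hBinv f hf x (mem_insert_of_mem hx) a ha, pp, h1])
    rw [resample H L S u hS]
    refine le_trans (sum_le_sum fun f hf => ?_) (ih'.trans (le_of_eq ?_))
    · have hfc := mem_Col.1 hf
      set b : U → ℝ := fun c => B f c * ∏ x ∈ Q, YY H f x c with hb
      have hY0 : ∀ c, 0 ≤ ∏ x ∈ Q, YY H f x c := fun c => prod_nonneg fun x _ => YY_nonneg H f x c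
      have hY1 : ∀ c, ∏ x ∈ Q, YY H f x c ≤ 1 := fun c =>
        prod_le_one (fun x _ => YY_nonneg H f x c) (fun x _ => YY_le_one H f x c)
      have hos := one_step (Av H L f u) C H.Adj b (fun c => mul_nonneg (hB0 f c) (hY0 c))
        (fun c => mul_le_one₀ (hB1 f c) (hY0 c) (hY1 c)) (Av_nonempty hfc hS)
        (fun a ha => hmatch u (mem_insert_self _ _) a (mem_Av.1 ha).1)
      have heq : ∀ a ∈ Av H L f u, W (update f u (some a)) *
          ∏ c ∈ C, (1 - B (update f u (some a)) c * ∏ x ∈ insert u Q, YY H (update f u (some a)) x c)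
          = W f * ∏ c ∈ C, (1 - b c * (if H.Adj a c then 0 else 1)) := by
        intro a ha
        rw [hWinv f hf u (mem_insert_self _ _) a ha, hBinv f hf u (mem_insert_self _ _) a ha]
        congr 1
        refine prod_congr rfl fun c _ => ?_
        rw [prod_insert hu]
        have h1 : YY H (update f u (some a)) u c = if H.Adj a c then 0 else 1 := by
          simp [YY]
        have h2 : ∏ x ∈ Q, YY H (update f u (some a)) x c = ∏ x ∈ Q, YY H f x c := by
          refine prod_congr rfl fun x hx => ?_
          simp only [YY, update_of_ne (hne x hx)]
        rw [h1, h2, hb]; ring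
      rw [sum_congr rfl heq, ← mul_sum, mul_div_assoc]
      refine mul_le_mul_of_nonneg_left (hos.trans (le_of_eq ?_)) (hW f)
      refine prod_congr rfl fun c _ => ?_
      simp only [hb, pp]; ring
    · refine sum_congr rfl fun f _ => ?_
      congr 1
      refine prod_congr rfl fun c _ => ?_
      rw [prod_insert hu]; ring

theorem half_pow_eq {G : SimpleGraph V} {H : SimpleGraph U} {L : V → Finset U}
    (hcov : IsCover G H L) {S : Finset V} {v : V} (hv : v ∉ S) {f : V → Option U}
    (hf : IsCol H L S f) (N : Finset V) (hN : ∀ u, u ∈ N ↔ G.Adj v u ∧ u ∈ S) :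
    (1 / 2 : ℝ) ^ (Av H L f v).card = ∏ c ∈ L v, (1 - (1 / 2) * ∏ u ∈ N, YY H f u c) := by
  have h1 : ∀ c ∈ L v, (1 - (1 / 2 : ℝ) * ∏ u ∈ N, YY H f u c)
      = if (∀ w, w ≠ v → ∀ d, f w = some d → ¬ H.Adj c d) then 1 / 2 else 1 := by
    intro c hc
    split_ifs with h
    · have : ∏ u ∈ N, YY H f u c = 1 := by
        refine prod_eq_one fun u hu => ?_
        unfold YY
        rw [if_neg]
        rintro ⟨a, ha, hac⟩
        exact h u ((hN u).1 hu).1.ne' a ha hac.symm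
      rw [this]; norm_num
    · push Not at h
      obtain ⟨w, hw, d, hd, hcd⟩ := h
      have hdw := hf.mem hd
      have hadj : G.Adj v w := by
        rcases hcov.2.2.1 c d hcd v w hc hdw with h | h
        · exact absurd h.symm hw
        · exact h
      have hwS : w ∈ S := by
        by_contra hw'
        simp [hf.2.1 w hw'] at hd
      have : ∏ u ∈ N, YY H f u c = 0 := by
        refine prod_eq_zero ((hN w).2 ⟨hadj, hwS⟩) ?_
        unfold YY
        rw [if_pos ⟨d, hd, hcd.symm⟩]
      rw [this]; norm_num
  rw [prod_congr rfl h1, ← prod_filter, prod_const]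
  rfl

/-- colours of `v` which may be hit from a neighbour with few available colours -/
noncomputable def spoil (H : SimpleGraph U) (L : V → Finset U) (N : Finset V) (t : ℕ) (v : V)
    (f : V → Option U) : Finset U :=
  (L v).filter fun c => ∃ u ∈ N, (Av H L f u).card ≤ t ∧ ∃ a ∈ Av H L f u, H.Adj a c

theorem sum_adj_le (A C : Finset U) (H : SimpleGraph U)
    (hm : ∀ a ∈ A, ∀ c ∈ C, ∀ c' ∈ C, H.Adj a c → H.Adj a c' → c = c') :
    ∑ c ∈ C, (A.filter fun a => H.Adj a c).card ≤ A.card := by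
  have : ∑ c ∈ C, (A.filter fun a => H.Adj a c).card
      = ∑ a ∈ A, (C.filter fun c => H.Adj a c).card := by
    simp only [card_filter]
    exact sum_comm
  rw [this, card_eq_sum_ones]
  refine sum_le_sum fun a ha => card_le_one.2 ?_
  intro c hc c' hc'
  rw [mem_filter] at hc hc'
  exact hm a ha c hc.1 c' hc'.1 hc.2 hc'.2

theorem card_spoil_le {G : SimpleGraph V} {H : SimpleGraph U} {L : V → Finset U}
    (hcov : IsCover G H L) {v : V} {N : Finset V} (hN : ∀ u ∈ N, G.Adj v u) (t : ℕ)
    (f : V → Option U) :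
    (spoil H L N t v f).card ≤ ∑ u ∈ N, if (Av H L f u).card ≤ t then t else 0 := by
  have hsub : spoil H L N t v f ⊆ N.biUnion fun u =>
      if (Av H L f u).card ≤ t then (L v).filter (fun c => ∃ a ∈ Av H L f u, H.Adj a c) else ∅ := by
    intro c hc
    simp only [spoil, mem_filter] at hc
    obtain ⟨hc, u, hu, hut, h⟩ := hc
    rw [mem_biUnion]
    refine ⟨u, hu, ?_⟩
    rw [if_pos hut, mem_filter]
    exact ⟨hc, h⟩
  refine (card_le_card hsub).trans (card_biUnion_le.trans (sum_le_sum fun u hu => ?_))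
  split_ifs with h
  · refine le_trans ?_ h
    refine le_trans ?_ (sum_adj_le (Av H L f u) (L v) H ?_)
    · rw [card_filter]
      refine sum_le_sum fun c _ => ?_
      split_ifs with h'
      · obtain ⟨a, ha, hac⟩ := h'
        exact card_pos.2 ⟨a, mem_filter.2 ⟨ha, hac⟩⟩
      · exact Nat.zero_le _
    · intro a ha c hc c' hc'
      exact hcov.2.2.2 u v (hN u hu).symm a (mem_Av.1 ha).1 c hc c' hc'
  · simp

theorem mu_bound {G : SimpleGraph V} {H : SimpleGraph U} {L : V → Finset U}
    (hcov : IsCover G H L) {v : V} {N : Finset V} (hN : ∀ u ∈ N, G.Adj v u) (t : ℕ)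
    (f : V → Option U) (η d : ℝ) (hη0 : 0 < η) (hη1 : η < 1) (ht : 1 / η ≤ t)
    (hd : (N.card : ℝ) ≤ d) (hk : 0 < (L v).card)
    (hsp : ((spoil H L N t v f).card : ℝ) ≤ η * (L v).card) :
    (1 - η) * (L v).card * Real.exp (-((1 + η) / (1 - η) * (d / (L v).card)))
      ≤ ∑ c ∈ L v, ∏ u ∈ N, (1 - pp H L f u c) := by
  set k : ℝ := ((L v).card : ℝ) with hkdef
  have hk0 : 0 < k := by rw [hkdef]; exact_mod_cast hk
  have h1η : 0 < 1 - η := by linarith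
  set m : ℝ := (1 + η) / (1 - η) * (d / k) with hm
  have ht0 : 0 < (t : ℝ) := lt_of_lt_of_le (by positivity) ht
  have hηt : 1 ≤ η * t := by
    rw [div_le_iff₀ hη0] at ht; linarith
  set Gd := L v \ spoil H L N t v f with hGd
  have hGcard : (1 - η) * k ≤ Gd.card := by
    have : Gd.card + (spoil H L N t v f).card = (L v).card :=
      card_sdiff_add_card_eq_card (filter_subset _ _)
    have h2 : (Gd.card : ℝ) + (spoil H L N t v f).card = k := by rw [hkdef]; exact_mod_cast this
    linarith
  have hprod0 : ∀ c, 0 ≤ ∏ u ∈ N, (1 - pp H L f u c) := fun c =>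
    prod_nonneg fun u _ => by linarith [pp_le_one H L f u c]
  set s : U → ℝ := fun c => ∑ u ∈ N, pp H L f u c with hs
  have hs0 : ∀ c, 0 ≤ s c := fun c => sum_nonneg fun u _ => pp_nonneg H L f u c
  have hssum : ∑ c ∈ Gd, s c ≤ d := by
    calc ∑ c ∈ Gd, s c ≤ ∑ c ∈ L v, s c :=
          sum_le_sum_of_subset_of_nonneg sdiff_subset fun c _ _ => hs0 c
      _ = ∑ u ∈ N, ∑ c ∈ L v, pp H L f u c := sum_comm
      _ ≤ ∑ u ∈ N, 1 := by
          refine sum_le_sum fun u hu => ?_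
          unfold pp
          rw [← sum_div]
          refine div_le_one_of_le₀ ?_ (by positivity)
          have := sum_adj_le (Av H L f u) (L v) H (by
            intro a ha c hc c' hc'
            exact hcov.2.2.2 u v (hN u hu).symm a (mem_Av.1 ha).1 c hc c' hc')
          exact_mod_cast this
      _ = N.card := by simp
      _ ≤ d := hd
  have hGood : ∀ c ∈ Gd, Real.exp (-((1 + η) * s c)) ≤ ∏ u ∈ N, (1 - pp H L f u c) := by
    intro c hc
    rw [hs, mul_sum, ← sum_neg_distrib, Real.exp_sum]
    refine prod_le_prod (fun u _ => (Real.exp_pos _).le) fun u hu => ?_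
    set p := pp H L f u c with hp
    have hp0 : 0 ≤ p := pp_nonneg H L f u c
    have hple : p * (1 + η) ≤ η := by
      have hcL : c ∈ L v := (mem_sdiff.1 hc).1
      have hcs : c ∉ spoil H L N t v f := (mem_sdiff.1 hc).2
      by_cases he : ((Av H L f u).filter fun a => H.Adj a c).card = 0
      · have : p = 0 := by rw [hp, pp, he]; simp
        rw [this]; simpa using hη0.le
      · obtain ⟨a, ha⟩ := card_pos.1 (Nat.pos_of_ne_zero he)
        rw [mem_filter] at ha
        have hbig : t < (Av H L f u).card := by
          by_contra hcon
          push Not at hcon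
          exact hcs (mem_filter.2 ⟨hcL, u, hu, hcon, a, ha.1, ha.2⟩)
        have hone : ((Av H L f u).filter fun a => H.Adj a c).card ≤ 1 := by
          refine card_le_one.2 ?_
          intro x hx y hy
          rw [mem_filter] at hx hy
          exact hcov.2.2.2 v u (hN u hu) c hcL x (mem_Av.1 hx.1).1 y (mem_Av.1 hy.1).1
            hx.2.symm hy.2.symm
        have hbig' : (t : ℝ) + 1 ≤ (Av H L f u).card := by exact_mod_cast hbig
        have hpl : p ≤ 1 / (t + 1) := by
          rw [hp, pp]
          exact div_le_div₀ zero_le_one (by exact_mod_cast hone) (by positivity) hbig'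
        calc p * (1 + η) ≤ 1 / (t + 1) * (1 + η) := by gcongr
          _ ≤ η := by
            rw [div_mul_eq_mul_div, div_le_iff₀ (by positivity)]
            linarith
    have hp1 : 0 < 1 - p := by
      have : p ≤ η := by nlinarith
      linarith
    have hlog : -((1 + η) * p) ≤ Real.log (1 - p) := by
      have h := Real.one_sub_inv_le_log_of_pos hp1
      refine le_trans ?_ h
      have : (1 - p)⁻¹ ≤ 1 + (1 + η) * p := by
        rw [inv_le_iff_one_le_mul₀ hp1]
        nlinarith
      linarith
    calc Real.exp (-((1 + η) * p)) ≤ Real.exp (Real.log (1 - p)) := Real.exp_le_exp.2 hlog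
      _ = 1 - p := Real.exp_log hp1
  calc (1 - η) * k * Real.exp (-m) ≤ Gd.card * Real.exp (-m) := by gcongr
    _ ≤ ∑ c ∈ Gd, Real.exp (-m) * (1 + m - (1 + η) * s c) := by
        rw [← mul_sum, sum_sub_distrib, ← mul_sum, sum_const, nsmul_eq_mul, mul_comm]
        refine mul_le_mul_of_nonneg_left ?_ (Real.exp_pos _).le
        have hd0 : 0 ≤ d := le_trans (by positivity) hd
        have hm0 : 0 ≤ m := by positivity
        have h1 : m * ((1 - η) * k) = (1 + η) * d := by
          rw [hm]; field_simp
        have h2 : m * ((1 - η) * k) ≤ m * Gd.card := by gcongr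
        have h3 : (1 + η) * ∑ c ∈ Gd, s c ≤ (1 + η) * d := by gcongr
        linarith
    _ ≤ ∑ c ∈ Gd, Real.exp (-((1 + η) * s c)) := by
        refine sum_le_sum fun c _ => ?_
        have h := Real.add_one_le_exp (m - (1 + η) * s c)
        calc Real.exp (-m) * (1 + m - (1 + η) * s c)
            ≤ Real.exp (-m) * Real.exp (m - (1 + η) * s c) := by
              refine mul_le_mul_of_nonneg_left ?_ (Real.exp_pos _).le
              linarith
          _ = _ := by rw [← Real.exp_add]; congr 1; ring
    _ ≤ ∑ c ∈ Gd, ∏ u ∈ N, (1 - pp H L f u c) := sum_le_sum hGood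
    _ ≤ _ := sum_le_sum_of_subset_of_nonneg sdiff_subset fun c _ _ => hprod0 c

theorem tail {G : SimpleGraph V} {H : SimpleGraph U} {L : V → Finset U}
    (hcov : IsCover G H L) (htri : G.CliqueFree 3) {S : Finset V} {v : V} (hv : v ∉ S)
    (N : Finset V) (hN : ∀ u, u ∈ N ↔ G.Adj v u ∧ u ∈ S) (t : ℕ)
    (η d μ : ℝ) (hη0 : 0 < η) (hη1 : η < 1) (ht : 1 / η ≤ t)
    (hd : (N.card : ℝ) ≤ d) (hk : 0 < (L v).card)
    (hμ : μ ≤ (1 - η) * (L v).card * Real.exp (-((1 + η) / (1 - η) * (d / (L v).card)))) :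
    ∑ f ∈ Col H L S, (if ((spoil H L N t v f).card : ℝ) ≤ η * (L v).card then (1 : ℝ) else 0)
        * (1 / 2 : ℝ) ^ (Av H L f v).card ≤ Real.exp (-(μ / 2)) * (Col H L S).card := by
  have hindep : ∀ u ∈ N, ∀ u' ∈ N, ¬ G.Adj u u' := by
    intro u hu u' hu' h
    refine htri {v, u, u'} ?_
    rw [SimpleGraph.is3Clique_triple_iff]
    exact ⟨((hN u).1 hu).1, ((hN u').1 hu').1, h⟩
  have hNv : ∀ u ∈ N, G.Adj v u := fun u hu => ((hN u).1 hu).1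
  set W : (V → Option U) → ℝ := fun f =>
    if ((spoil H L N t v f).card : ℝ) ≤ η * (L v).card then (1 : ℝ) else 0 with hWdef
  have hWnn : ∀ f, 0 ≤ W f := by intro f; simp only [hWdef]; split_ifs <;> norm_num
  have hWinv : ∀ f ∈ Col H L S, ∀ u ∈ N, ∀ a ∈ Av H L f u, W (update f u (some a)) = W f := by
    intro f hf u hu a ha
    have hAv : ∀ u' ∈ N, Av H L (update f u (some a)) u' = Av H L f u' := by
      intro u' hu'
      by_cases h : u' = u
      · subst h; exact Av_update_self H L f u' _
      · exact Av_update_other hcov (mem_Col.1 hf) h (hindep u' hu' u hu) (mem_Av.1 ha).1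
    have : spoil H L N t v (update f u (some a)) = spoil H L N t v f := by
      ext c
      simp only [spoil, mem_filter]
      refine and_congr_right fun _ => exists_congr fun u' => and_congr_right fun hu' => ?_
      rw [hAv u' hu']
    simp only [hWdef, this]
  have hmgf := mgf hcov S (L v) W hWnn N (fun u hu => ((hN u).1 hu).2) hindep
    (fun u hu a ha c hc c' hc' => hcov.2.2.2 u v (hNv u hu).symm a ha c hc c' hc')
    hWinv (fun _ _ => 1 / 2) (fun _ _ => by norm_num) (fun _ _ => by norm_num)
    (fun _ _ _ _ _ _ => rfl)
  calc ∑ f ∈ Col H L S, W f * (1 / 2 : ℝ) ^ (Av H L f v).card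
      = ∑ f ∈ Col H L S, W f * ∏ c ∈ L v, (1 - (1 / 2) * ∏ u ∈ N, YY H f u c) :=
        sum_congr rfl fun f hf => by rw [half_pow_eq hcov hv (mem_Col.1 hf) N hN]
    _ ≤ _ := hmgf
    _ ≤ ∑ f ∈ Col H L S, Real.exp (-(μ / 2)) := by
        refine sum_le_sum fun f _ => ?_
        simp only [hWdef]
        split_ifs with h
        · rw [one_mul]
          have hmu := mu_bound hcov hNv t f η d hη0 hη1 ht hd hk h
          calc ∏ c ∈ L v, (1 - (1 / 2) * ∏ u ∈ N, (1 - pp H L f u c))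
              ≤ ∏ c ∈ L v, Real.exp (-((1 / 2) * ∏ u ∈ N, (1 - pp H L f u c))) := by
                refine prod_le_prod (fun c _ => ?_) (fun c _ => Real.one_sub_le_exp_neg _)
                have : ∏ u ∈ N, (1 - pp H L f u c) ≤ 1 :=
                  prod_le_one (fun u _ => by linarith [pp_le_one H L f u c])
                    (fun u _ => by linarith [pp_nonneg H L f u c])
                linarith
            _ = Real.exp (-((1 / 2) * ∑ c ∈ L v, ∏ u ∈ N, (1 - pp H L f u c))) := by
                rw [← Real.exp_sum, sum_neg_distrib, mul_sum]
            _ ≤ _ := Real.exp_le_exp.2 (by linarith)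
        · rw [zero_mul]; exact (Real.exp_pos _).le
    _ = _ := by rw [sum_const, nsmul_eq_mul, mul_comm]

/-- Induction hypothesis. -/
def Good (H : SimpleGraph U) (L : V → Finset U) (t : ℕ) (q : ℝ) (S : Finset V) : Prop :=
  0 < (Col H L S).card ∧ ∀ u ∈ S,
    ((((Col H L S).filter fun f => (Av H L f u).card ≤ t).card : ℝ)) ≤ q * (Col H L S).card

theorem step {G : SimpleGraph V} {H : SimpleGraph U} {L : V → Finset U}
    (hcov : IsCover G H L) (htri : G.CliqueFree 3) {S : Finset V} {v : V} (hv : v ∉ S)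
    (N : Finset V) (hN : ∀ u, u ∈ N ↔ G.Adj v u ∧ u ∈ S) (t : ℕ)
    (η d μ q : ℝ) (hη0 : 0 < η) (hη1 : η < 1) (ht : 1 / η ≤ t) (hq : 0 < q)
    (hd : (N.card : ℝ) ≤ d) (hk : 0 < (L v).card)
    (hμ : μ ≤ (1 - η) * (L v).card * Real.exp (-((1 + η) / (1 - η) * (d / (L v).card))))
    (h8 : 8 ≤ μ) (h1 : t * d * q / (η * (L v).card) ≤ 1 / 4)
    (h3 : 8 * t * (t * d * q / (η * (L v).card) + 2 ^ t * Real.exp (-(μ / 2))) ≤ q * μ)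
    (hgood : Good H L t q S) :
    0 < (Col H L (insert v S)).card ∧
    ((((Col H L (insert v S)).filter fun f => (Av H L f v).card ≤ t).card : ℝ))
      ≤ q * (Col H L (insert v S)).card := by
  have hNv : ∀ u ∈ N, G.Adj v u := fun u hu => ((hN u).1 hu).1
  obtain ⟨hpos, hbad⟩ := hgood
  set M : ℝ := ((Col H L S).card : ℝ) with hM
  have hM0 : 0 < M := by rw [hM]; exact_mod_cast hpos
  have hk0 : (0 : ℝ) < (L v).card := by exact_mod_cast hk
  have ht0 : 0 < (t : ℝ) := lt_of_lt_of_le (by positivity) ht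
  set k : ℝ := ((L v).card : ℝ) with hkdef
  have htail := tail hcov htri hv N hN t η d μ hη0 hη1 ht hd hk hμ
  set r : ℝ := t * d * q / (η * k) with hr
  -- spoiled colourings
  set Bd := (Col H L S).filter fun f => ¬ (((spoil H L N t v f).card : ℝ) ≤ η * k) with hBd
  have hBdle : (Bd.card : ℝ) ≤ r * M := by
    have e1 : (Bd.card : ℝ) * (η * k) ≤ ∑ f ∈ Col H L S, ((spoil H L N t v f).card : ℝ) := by
      calc (Bd.card : ℝ) * (η * k) = ∑ f ∈ Bd, η * k := by simp
        _ ≤ ∑ f ∈ Bd, ((spoil H L N t v f).card : ℝ) :=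
            sum_le_sum fun f hf => (not_le.1 (mem_filter.1 hf).2).le
        _ ≤ _ := sum_le_sum_of_subset_of_nonneg (filter_subset _ _) fun _ _ _ => by positivity
    have e2 : ∑ f ∈ Col H L S, ((spoil H L N t v f).card : ℝ) ≤ t * d * q * M := by
      calc ∑ f ∈ Col H L S, ((spoil H L N t v f).card : ℝ)
          ≤ ∑ f ∈ Col H L S, ∑ u ∈ N, if (Av H L f u).card ≤ t then (t : ℝ) else 0 := by
            refine sum_le_sum fun f _ => ?_
            have := card_spoil_le hcov hNv t f
            exact_mod_cast this
        _ = ∑ u ∈ N, ∑ f ∈ Col H L S, if (Av H L f u).card ≤ t then (t : ℝ) else 0 := sum_comm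
        _ ≤ ∑ u ∈ N, t * (q * M) := by
            refine sum_le_sum fun u hu => ?_
            rw [← sum_filter, sum_const, nsmul_eq_mul, mul_comm]
            exact mul_le_mul_of_nonneg_left (hbad u ((hN u).1 hu).2) ht0.le
        _ = N.card * (t * (q * M)) := by simp
        _ ≤ d * (t * (q * M)) := by gcongr
        _ = _ := by ring
    have e3 : r * M = t * d * q * M / (η * k) := by rw [hr]; ring
    rw [e3, le_div_iff₀ (by positivity)]
    linarith
  -- general tail bound
  have hT : ∀ x : ℝ, (((Col H L S).filter fun f => ((Av H L f v).card : ℝ) ≤ x).card : ℝ)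
      ≤ r * M + (2 : ℝ) ^ x * Real.exp (-(μ / 2)) * M := by
    intro x
    set T := (Col H L S).filter fun f => ((Av H L f v).card : ℝ) ≤ x with hTdef
    have hsub : T ⊆ Bd ∪ T \ Bd := by
      intro f hf; by_cases h : f ∈ Bd <;> simp [h, hf]
    have hc1 : (T.card : ℝ) ≤ Bd.card + (T \ Bd).card := by
      exact_mod_cast (card_le_card hsub).trans (card_union_le _ _)
    have hc2 : ((T \ Bd).card : ℝ) * (2 : ℝ) ^ (-x) ≤ Real.exp (-(μ / 2)) * M := by
      refine le_trans ?_ htail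
      calc ((T \ Bd).card : ℝ) * (2 : ℝ) ^ (-x) = ∑ f ∈ T \ Bd, (2 : ℝ) ^ (-x) := by simp
        _ ≤ ∑ f ∈ T \ Bd, (if ((spoil H L N t v f).card : ℝ) ≤ η * k then (1 : ℝ) else 0)
              * (1 / 2 : ℝ) ^ (Av H L f v).card := by
            refine sum_le_sum fun f hf => ?_
            rw [mem_sdiff, hTdef, mem_filter, hBd, mem_filter, not_and, not_not] at hf
            rw [if_pos (hf.2 hf.1.1), one_mul, one_div, inv_pow, ← Real.rpow_natCast,
              ← Real.rpow_neg (by norm_num)]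
            exact Real.rpow_le_rpow_of_exponent_le (by norm_num) (by linarith [hf.1.2])
        _ ≤ _ := by
            refine sum_le_sum_of_subset_of_nonneg ?_ fun f _ _ => ?_
            · exact sdiff_subset.trans (filter_subset _ _)
            · refine mul_nonneg ?_ (by positivity)
              split_ifs <;> norm_num
    have hc3 : ((T \ Bd).card : ℝ) ≤ (2 : ℝ) ^ x * Real.exp (-(μ / 2)) * M := by
      have h2 : (0 : ℝ) < 2 ^ x := by positivity
      rw [Real.rpow_neg (by norm_num), ← div_eq_mul_inv, div_le_iff₀ h2] at hc2
      linarith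
    linarith
  have hNcard : ((Col H L (insert v S)).card : ℝ) = ∑ f ∈ Col H L S, ((Av H L f v).card : ℝ) := by
    have := sum_Col_insert H L S v hv (fun _ => 1)
    simpa using this
  have hNge : μ / 8 * M ≤ (Col H L (insert v S)).card := by
    have hT' := hT (μ / 4)
    have hexp : (2 : ℝ) ^ (μ / 4) * Real.exp (-(μ / 2)) ≤ 1 / 4 := by
      rw [Real.rpow_def_of_pos (by norm_num), ← Real.exp_add]
      have hl2 : Real.log 2 ≤ 1 := by linarith [Real.log_two_lt_d9]
      calc Real.exp (Real.log 2 * (μ / 4) + -(μ / 2)) ≤ Real.exp (-2) := by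
            refine Real.exp_le_exp.2 ?_
            nlinarith
        _ ≤ 1 / 4 := by
            rw [Real.exp_neg, one_div]
            refine inv_anti₀ (by norm_num) ?_
            have := Real.exp_one_gt_d9
            have e : Real.exp 2 = Real.exp 1 * Real.exp 1 := by
              rw [← Real.exp_add]; norm_num
            rw [e]; nlinarith
    have hhalf : (((Col H L S).filter fun f => ((Av H L f v).card : ℝ) ≤ μ / 4).card : ℝ)
        ≤ M / 2 := by
      have a1 : r * M ≤ 1 / 4 * M := by gcongr
      have a2 : (2 : ℝ) ^ (μ / 4) * Real.exp (-(μ / 2)) * M ≤ 1 / 4 * M := by gcongr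
      linarith
    have hsplit : (((Col H L S).filter fun f => ((Av H L f v).card : ℝ) ≤ μ / 4).card : ℝ)
        + (((Col H L S).filter fun f => ¬ ((Av H L f v).card : ℝ) ≤ μ / 4).card : ℝ) = M := by
      rw [hM]
      exact_mod_cast card_filter_add_card_filter_not (s := Col H L S) _
    rw [hNcard]
    calc μ / 8 * M = (μ / 4) * (M / 2) := by ring
      _ ≤ (μ / 4) * (((Col H L S).filter fun f => ¬ ((Av H L f v).card : ℝ) ≤ μ / 4).card : ℝ) := by
          gcongr; linarith
      _ = ∑ f ∈ (Col H L S).filter fun f => ¬ ((Av H L f v).card : ℝ) ≤ μ / 4, μ / 4 := by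
          rw [sum_const, nsmul_eq_mul, mul_comm]
      _ ≤ ∑ f ∈ (Col H L S).filter fun f => ¬ ((Av H L f v).card : ℝ) ≤ μ / 4,
            ((Av H L f v).card : ℝ) :=
          sum_le_sum fun f hf => (not_le.1 (mem_filter.1 hf).2).le
      _ ≤ _ := sum_le_sum_of_subset_of_nonneg (filter_subset _ _) fun _ _ _ => by positivity
  have hpos' : (0 : ℝ) < (Col H L (insert v S)).card :=
    lt_of_lt_of_le (by positivity) hNge
  refine ⟨by exact_mod_cast hpos', ?_⟩
  have hcount : ((((Col H L (insert v S)).filter fun f => (Av H L f v).card ≤ t).card : ℝ))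
      ≤ t * (r * M + (2 : ℝ) ^ t * Real.exp (-(μ / 2)) * M) := by
    have e := sum_Col_insert H L S v hv (fun f => if (Av H L f v).card ≤ t then (1 : ℝ) else 0)
    simp only [Av_update_self, sum_const, nsmul_eq_mul] at e
    rw [← sum_filter, sum_const, nsmul_eq_mul, mul_one] at e
    rw [e]
    have hTt := hT t
    rw [Real.rpow_natCast] at hTt
    calc ∑ f ∈ Col H L S, ((Av H L f v).card : ℝ) * (if (Av H L f v).card ≤ t then (1 : ℝ) else 0)
        ≤ ∑ f ∈ Col H L S, if ((Av H L f v).card : ℝ) ≤ t then (t : ℝ) else 0 := by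
          refine sum_le_sum fun f _ => ?_
          by_cases h : (Av H L f v).card ≤ t
          · have h' : ((Av H L f v).card : ℝ) ≤ t := by exact_mod_cast h
            simp [h, h']
          · simp [h]
      _ = t * (((Col H L S).filter fun f => ((Av H L f v).card : ℝ) ≤ t).card : ℝ) := by
          rw [← sum_filter, sum_const, nsmul_eq_mul, mul_comm]
      _ ≤ _ := by gcongr
  refine hcount.trans ?_
  have f1 : t * (r + 2 ^ t * Real.exp (-(μ / 2))) ≤ q * (μ / 8) := by linarith
  calc t * (r * M + (2 : ℝ) ^ t * Real.exp (-(μ / 2)) * M)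
      = t * (r + 2 ^ t * Real.exp (-(μ / 2))) * M := by ring
    _ ≤ q * (μ / 8) * M := by gcongr
    _ = q * (μ / 8 * M) := by ring
    _ ≤ _ := by gcongr

theorem comb {G : SimpleGraph V} {H : SimpleGraph U} {L : V → Finset U}
    (hcov : IsCover G H L) (htri : G.CliqueFree 3) (t : ℕ)
    (η q : ℝ) (d μ : V → ℝ) (hη0 : 0 < η) (hη1 : η < 1) (ht : 1 / η ≤ t) (hq : 0 < q)
    (hd : ∀ v, ((univ.filter fun u => G.Adj v u).card : ℝ) ≤ d v) (hk : ∀ v, 0 < (L v).card)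
    (hμ : ∀ v, μ v ≤
      (1 - η) * (L v).card * Real.exp (-((1 + η) / (1 - η) * (d v / (L v).card))))
    (h8 : ∀ v, 8 ≤ μ v) (h1 : ∀ v, t * d v * q / (η * (L v).card) ≤ 1 / 4)
    (h3 : ∀ v, 8 * t * (t * d v * q / (η * (L v).card) + 2 ^ t * Real.exp (-(μ v / 2)))
      ≤ q * μ v) :
    ∃ I : Finset U, IndepFinset H I ∧ I.card = Fintype.card V := by
  have main : ∀ n : ℕ, ∀ S : Finset V, S.card = n → Good H L t q S := by
    intro n
    induction n with
    | zero =>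
      intro S hS
      rw [card_eq_zero] at hS
      subst hS
      refine ⟨card_pos.2 ⟨fun _ => none, mem_Col.2 ⟨?_, ?_, ?_⟩⟩, ?_⟩ <;> simp
    | succ n ih =>
      intro S hS
      have key : ∀ v ∈ S, 0 < (Col H L S).card ∧
          ((((Col H L S).filter fun f => (Av H L f v).card ≤ t).card : ℝ))
            ≤ q * (Col H L S).card := by
        intro v hv
        have hg := ih (S.erase v) (by rw [card_erase_of_mem hv, hS]; rfl)
        have hst := step hcov htri (S := S.erase v) (v := v) (by simp)
          (univ.filter fun u => G.Adj v u ∧ u ∈ S.erase v) (by simp) t η (d v) (μ v) q hη0 hη1 ht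
          hq (le_trans (by
            exact_mod_cast card_le_card (by
              intro u hu
              simp only [mem_filter] at hu ⊢
              exact ⟨hu.1, hu.2.1⟩)) (hd v)) (hk v) (hμ v) (h8 v) (h1 v) (h3 v) hg
        rwa [insert_erase hv] at hst
      have hne : S.Nonempty := card_pos.1 (by omega)
      obtain ⟨v, hv⟩ := hne
      exact ⟨(key v hv).1, fun u hu => (key u hu).2⟩
  obtain ⟨f, hf⟩ := card_pos.1 (main _ univ rfl).1
  have hfc := mem_Col.1 hf
  choose g hgL hg using fun v => hfc.1 v (mem_univ v)
  refine ⟨univ.image g, ?_, ?_⟩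
  · intro a ha b hb
    simp only [mem_image, mem_univ, true_and] at ha hb
    obtain ⟨u, rfl⟩ := ha
    obtain ⟨w, rfl⟩ := hb
    exact hfc.2.2 u w _ _ (hg u) (hg w)
  · rw [card_image_of_injective, card_univ]
    intro u w h
    exact (hcov.1 (g u)).unique (hgL u) (h ▸ hgL w)

theorem eventually_log_le (c s : ℝ) (hc : 0 < c) (hs : 0 < s) :
    ∀ᶠ D : ℝ in Filter.atTop, Real.log D ≤ c * D ^ s := by
  have h := (isLittleO_log_rpow_atTop hs).def hc
  filter_upwards [h, Filter.eventually_ge_atTop 1] with D hD h1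
  have h2 : 0 ≤ D ^ s := by positivity
  rw [Real.norm_of_nonneg h2] at hD
  exact (le_abs_self _).trans hD

theorem analytic (ε κ η : ℝ) (t : ℕ) (hκ : 0 < κ) (hη0 : 0 < η) (hη1 : η < 1)
    (ht : 0 < t) :
    ∀ᶠ D : ℝ in Filter.atTop, 1 < D ∧ 8 ≤ D ^ (κ / 2) ∧
      D ^ (κ / 2) * Real.log D ≤ (1 - η) * D ^ κ ∧
      16 * t ^ 2 * Real.log D / η ≤ D ^ (κ / 2) ∧
      128 * t ^ 2 * 2 ^ t * D ^ (ε / 2) * Real.exp (-(D ^ (κ / 2) / 2)) ≤ η := by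
  have hκ2 : 0 < κ / 2 := by linarith
  have ht' : (0 : ℝ) < t := by exact_mod_cast ht
  have hpow := tendsto_rpow_atTop hκ2
  have hlim : Filter.Tendsto (fun D : ℝ => 128 * (t : ℝ) ^ 2 * 2 ^ t *
      ((D ^ (κ / 2)) ^ (ε / κ) * Real.exp (-(1 / 2) * D ^ (κ / 2)))) Filter.atTop
      (nhds (128 * (t : ℝ) ^ 2 * 2 ^ t * 0)) :=
    ((tendsto_rpow_mul_exp_neg_mul_atTop_nhds_zero (ε / κ) (1 / 2) (by norm_num)).comp
      hpow).const_mul _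
  rw [mul_zero] at hlim
  filter_upwards [Filter.eventually_gt_atTop 1, hpow.eventually_ge_atTop 8,
    eventually_log_le (1 - η) (κ / 2) (by linarith) hκ2,
    eventually_log_le (η / (16 * t ^ 2)) (κ / 2) (by positivity) hκ2,
    hlim.eventually_le_const hη0] with D h1 h2 h3 h4 h5
  have hD0 : 0 < D := by linarith
  refine ⟨h1, h2, ?_, ?_, ?_⟩
  · calc D ^ (κ / 2) * Real.log D ≤ D ^ (κ / 2) * ((1 - η) * D ^ (κ / 2)) := by gcongr
      _ = (1 - η) * (D ^ (κ / 2) * D ^ (κ / 2)) := by ring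
      _ = _ := by rw [← Real.rpow_add hD0]; congr 2; ring
  · calc 16 * t ^ 2 * Real.log D / η
        ≤ 16 * t ^ 2 * (η / (16 * t ^ 2) * D ^ (κ / 2)) / η := by gcongr
      _ = _ := by field_simp
  · refine le_trans (le_of_eq ?_) h5
    have e1 : (D ^ (κ / 2)) ^ (ε / κ) = D ^ (ε / 2) := by
      rw [← Real.rpow_mul hD0.le]; congr 1; field_simp
    have e2 : -(1 / 2) * D ^ (κ / 2) = -(D ^ (κ / 2) / 2) := by ring
    rw [e1, e2]; ring

theorem eventually_delta (ε D₀ : ℝ) (hε : 0 < ε) : ∀ᶠ Δ : ℕ in Filter.atTop,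
    0 < Real.log Δ ∧ D₀ ≤ (192 * Real.log Δ) ^ (2 / ε) ∧
      (192 * Real.log Δ) ^ (2 / ε) ≤ (Δ : ℝ) := by
  have hR : ∀ᶠ x : ℝ in Filter.atTop, 0 < Real.log x ∧ D₀ ≤ (192 * Real.log x) ^ (2 / ε) ∧
      (192 * Real.log x) ^ (2 / ε) ≤ x := by
    have h1 : Filter.Tendsto (fun x : ℝ => (192 * Real.log x) ^ (2 / ε)) Filter.atTop
        Filter.atTop :=
      (tendsto_rpow_atTop (by positivity : 0 < 2 / ε)).comp
        (Real.tendsto_log_atTop.const_mul_atTop (by norm_num))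
    filter_upwards [Filter.eventually_gt_atTop 1, h1.eventually_ge_atTop D₀,
      eventually_log_le (1 / 192) (ε / 2) (by norm_num) (by positivity)] with x hx h2 h3
    have hl := Real.log_pos hx
    refine ⟨hl, h2, ?_⟩
    calc (192 * Real.log x) ^ (2 / ε) ≤ (x ^ (ε / 2)) ^ (2 / ε) := by
          refine Real.rpow_le_rpow (by positivity) (by linarith) (by positivity)
      _ = x := by
          rw [← Real.rpow_mul (by linarith), show ε / 2 * (2 / ε) = 1 by field_simp, Real.rpow_one]
  exact tendsto_natCast_atTop_atTop.eventually hR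

end Molloy

/-- Theorem 8 of the paper (local Molloy theorem for correspondence colouring): for fixed
`ε > 0` and sufficiently large `Δ`, with `δ = (192 log Δ)^(2/ε)`, every triangle-free
graph `G` of maximum degree at most `Δ` with a cover `ℋ = (L, H)` satisfying
`|L(u)| ≥ (1+ε)·max(deg(u)/log deg(u), δ/log δ)` is `ℋ`-colourable. -/
theorem local_molloy_correspondence (ε : ℝ) (hε : 0 < ε) :
    ∃ Δ₀ : ℕ, ∀ Δ : ℕ, Δ₀ ≤ Δ →
      ∀ (V U : Type) [Fintype V] [Fintype U] [DecidableEq U]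
        (G : SimpleGraph V) [DecidableRel G.Adj] (H : SimpleGraph U) [DecidableRel H.Adj]
        (L : V → Finset U),
        G.CliqueFree 3 →
        (∀ v : V, G.degree v ≤ Δ) →
        IsCover G H L →
        (∀ u : V,
          (1 + ε) * max ((G.degree u : ℝ) / Real.log (G.degree u))
              (((192 * Real.log Δ) ^ (2 / ε)) /
                Real.log ((192 * Real.log Δ) ^ (2 / ε)))
            ≤ ((L u).card : ℝ)) →
        ∃ I : Finset U, IndepFinset H I ∧ I.card = Fintype.card V := by
  classical
  set κ : ℝ := (ε / 2) / (1 + ε) with hκdef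
  have hκ : 0 < κ := by positivity
  set η : ℝ := min ε 1 / 8 with hηdef
  have hm : 0 < min ε 1 := lt_min hε one_pos
  have hη0 : 0 < η := by positivity
  have hηε : η ≤ ε / 8 := by rw [hηdef]; linarith [min_le_left ε 1]
  have hη8 : η ≤ 1 / 8 := by rw [hηdef]; linarith [min_le_right ε 1]
  have hη1 : η < 1 := by linarith
  set t : ℕ := ⌈1 / η⌉₊ with htdef
  have ht : 1 / η ≤ (t : ℝ) := Nat.le_ceil _
  have htpos : 0 < (t : ℝ) := lt_of_lt_of_le (by positivity) ht
  have htn : 0 < t := by exact_mod_cast htpos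
  clear_value t
  have hratio : (1 + η) / (1 - η) ≤ 1 + ε / 2 := by
    rw [div_le_iff₀ (by linarith)]
    nlinarith
  clear_value η
  have hκ1 : 1 - κ = (1 + ε / 2) / (1 + ε) := by rw [hκdef]; field_simp; ring
  clear_value κ
  obtain ⟨D₀, hD₀⟩ := Filter.eventually_atTop.1 (Molloy.analytic ε κ η t hκ hη0 hη1 htn)
  obtain ⟨Δ₀, hΔ₀⟩ := Filter.eventually_atTop.1 (Molloy.eventually_delta ε D₀ hε)
  refine ⟨Δ₀, ?_⟩
  intro Δ hΔ V U _ _ _ G _ H _ L htri hdeg hcov hL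
  obtain ⟨hlΔ, hδD, hδΔ⟩ := hΔ₀ Δ hΔ
  set δ : ℝ := (192 * Real.log Δ) ^ (2 / ε) with hδ
  have hδε : 192 * Real.log Δ = δ ^ (ε / 2) := by
    rw [hδ, ← Real.rpow_mul (by positivity), show 2 / ε * (ε / 2) = 1 by field_simp,
      Real.rpow_one]
  have hδ0 : 0 ≤ δ := by rw [hδ]; positivity
  clear_value δ
  have hDfacts : ∀ v : V, ∃ D : ℝ, δ ≤ D ∧ (G.degree v : ℝ) ≤ D ∧ D ≤ Δ ∧
      (1 + ε) * (D / Real.log D) ≤ (L v).card := by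
    intro v
    rcases le_total (G.degree v : ℝ) δ with h | h
    · refine ⟨δ, le_rfl, h, hδΔ, le_trans ?_ (hL v)⟩
      exact mul_le_mul_of_nonneg_left (le_max_right _ _) (by linarith)
    · refine ⟨G.degree v, h, le_rfl, by exact_mod_cast hdeg v, le_trans ?_ (hL v)⟩
      exact mul_le_mul_of_nonneg_left (le_max_left _ _) (by linarith)
  choose D hDδ hDd hDΔ hDL using hDfacts
  have hDall := fun v => hD₀ (D v) (hδD.trans (hDδ v))
  have hlog : ∀ v, 0 < Real.log (D v) := fun v => Real.log_pos (hDall v).1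
  have hD0 : ∀ v, 0 < D v := fun v => by linarith [(hDall v).1]
  have hkR : ∀ v, (0 : ℝ) < (L v).card := fun v =>
    lt_of_lt_of_le (by have := hlog v; have := hD0 v; positivity) (hDL v)
  set q : ℝ := η / (8 * t * Real.log Δ) with hq
  have hq0 : 0 < q := by positivity
  clear_value q
  have hdk : ∀ v, (G.degree v : ℝ) / (L v).card ≤ Real.log (D v) / (1 + ε) := by
    intro v
    have h1 := hDL v
    have h2 := hlog v
    have h3 := hkR v
    rw [mul_div_assoc', div_le_iff₀ h2] at h1
    rw [div_le_div_iff₀ h3 (by linarith)]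
    nlinarith [hDd v]
  have hdk' : ∀ v, (G.degree v : ℝ) / (L v).card ≤ Real.log (D v) := fun v =>
    (hdk v).trans (div_le_self (hlog v).le (by linarith))
  have hr : ∀ v, t * (G.degree v : ℝ) * q / (η * (L v).card) ≤ t * q / η * Real.log (D v) := by
    intro v
    calc t * (G.degree v : ℝ) * q / (η * (L v).card)
        = t * q / η * ((G.degree v : ℝ) / (L v).card) := by
          rw [div_mul_div_comm]; congr 1; ring
      _ ≤ _ := mul_le_mul_of_nonneg_left (hdk' v) (by positivity)
  refine Molloy.comb hcov htri t η q (fun v => (G.degree v : ℝ)) (fun v => D v ^ (κ / 2))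
    hη0 hη1 ht hq0 ?_ (fun v => by exact_mod_cast hkR v) ?_ (fun v => (hDall v).2.1) ?_ ?_
  · intro v
    rw [← SimpleGraph.card_neighborFinset_eq_degree, SimpleGraph.neighborFinset_eq_filter]
    exact_mod_cast le_of_eq (by congr)
  · intro v
    obtain ⟨h1, h2, h3, h4, h5⟩ := hDall v
    have hl := hlog v
    have hD := hD0 v
    have e1 : Real.exp (-((1 - κ) * Real.log (D v)))
        ≤ Real.exp (-((1 + η) / (1 - η) * ((G.degree v : ℝ) / (L v).card))) := by
      refine Real.exp_le_exp.2 (neg_le_neg ?_)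
      calc (1 + η) / (1 - η) * ((G.degree v : ℝ) / (L v).card)
          ≤ (1 + ε / 2) * (Real.log (D v) / (1 + ε)) :=
            mul_le_mul hratio (hdk v) (div_nonneg (Nat.cast_nonneg _) (hkR v).le) (by linarith)
        _ = (1 - κ) * Real.log (D v) := by rw [hκ1]; ring
    have e2 : Real.exp (-((1 - κ) * Real.log (D v))) = D v ^ (κ - 1) := by
      rw [Real.rpow_def_of_pos hD]; congr 1; ring
    have e3 : D v / Real.log (D v) ≤ (L v).card := by
      refine le_trans ?_ (hDL v)
      have : 0 ≤ D v / Real.log (D v) := by positivity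
      nlinarith
    have e4 : D v * D v ^ (κ - 1) = D v ^ κ := by
      rw [← Real.rpow_one_add' hD.le (by simpa using hκ.ne')]; congr 1; ring
    have h1η : 0 ≤ 1 - η := by linarith
    calc D v ^ (κ / 2) ≤ (1 - η) * D v ^ κ / Real.log (D v) := by rwa [le_div_iff₀ hl]
      _ = (1 - η) * (D v / Real.log (D v)) * D v ^ (κ - 1) := by rw [← e4]; ring
      _ ≤ (1 - η) * (L v).card * D v ^ (κ - 1) := by gcongr
      _ ≤ _ := by rw [← e2]; exact mul_le_mul_of_nonneg_left e1 (mul_nonneg h1η (hkR v).le)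
  · intro v
    have hlD : Real.log (D v) ≤ Real.log Δ := Real.log_le_log (hD0 v) (hDΔ v)
    calc _ ≤ t * q / η * Real.log (D v) := hr v
      _ ≤ t * q / η * Real.log Δ := mul_le_mul_of_nonneg_left hlD (by positivity)
      _ = 1 / 8 := by rw [hq]; field_simp
      _ ≤ 1 / 4 := by norm_num
  · intro v
    obtain ⟨h1, h2, h3, h4, h5⟩ := hDall v
    have hlΔD : Real.log Δ ≤ D v ^ (ε / 2) := by
      have : δ ^ (ε / 2) ≤ D v ^ (ε / 2) :=
        Real.rpow_le_rpow hδ0 (hDδ v) (by positivity)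
      linarith
    have hE := Real.exp_pos (-(D v ^ (κ / 2) / 2))
    have a1 : 8 * t * (t * (G.degree v : ℝ) * q / (η * (L v).card)) ≤ q * D v ^ (κ / 2) / 2 := by
      calc 8 * t * (t * (G.degree v : ℝ) * q / (η * (L v).card))
          ≤ 8 * t * (t * q / η * Real.log (D v)) :=
            mul_le_mul_of_nonneg_left (hr v) (by positivity)
        _ = q * (16 * t ^ 2 * Real.log (D v) / η) / 2 := by ring
        _ ≤ _ := by gcongr
    have a2 : 8 * t * (2 ^ t * Real.exp (-(D v ^ (κ / 2) / 2))) ≤ q / 2 := by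
      have : 128 * t ^ 2 * 2 ^ t * Real.log Δ * Real.exp (-(D v ^ (κ / 2) / 2)) ≤ η :=
        le_trans (by gcongr) h5
      rw [hq, div_div, le_div_iff₀ (by positivity)]
      calc _ = 128 * t ^ 2 * 2 ^ t * Real.log Δ * Real.exp (-(D v ^ (κ / 2) / 2)) := by ring
        _ ≤ η := this
    have a3 : q / 2 ≤ q * D v ^ (κ / 2) / 2 := by
      have : q * 1 ≤ q * D v ^ (κ / 2) := mul_le_mul_of_nonneg_left (by linarith) hq0.le
      linarith
    rw [mul_add]
    linarith
end

section
/- Fix 0 < ε < 1. There exists Δ₀ such that for every Δ ≥ Δ₀ the following holds, where δ = (192 log Δ)^{2/ε}. Let G be a finite triangle-free simple graph of maximum degree at most Δ and let ℋ = (L, H) be a cover of G with |L(u)| = k(u) := ⌈(1+ε)·max{deg(u)/log deg(u), δ/log δ}⌉ for all u ∈ V(G), and set ℓ(u) = max{deg(u)^{ε/2}, δ^{ε/2}}. Then H contains an independent set I such that (1) |L_I(u)| ≥ ℓ(u) for all u ∈ V(G_I), and (2) deg*_{ℋ_I}(c) ≤ 24·log Δ for all c ∈ V(H_I). -/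
/-- The closed neighbourhood `N_H[I]` of a set `I` of vertices of `H`. -/
def closedNbhd {U : Type*} [Fintype U] [DecidableEq U]
    (H : SimpleGraph U) [DecidableRel H.Adj] (I : Finset U) : Finset U :=
  I ∪ I.biUnion (fun x => H.neighborFinset x)

/-- The reduced list `L_I(u) = L(u) \ N_H(I)` of the cover `ℋ_I`. -/
def coverLI {V U : Type*} [Fintype U] [DecidableEq U]
    (H : SimpleGraph U) [DecidableRel H.Adj] (L : V → Finset U) (I : Finset U)
    (u : V) : Finset U :=
  L u \ I.biUnion (fun x => H.neighborFinset x)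

/-- The domain `dom(I) = {u ∈ V(G) : I ∩ L(u) ≠ ∅}` of an independent set `I` of `H`;
`G_I = G - dom(I)`. -/
def domI {V U : Type*} [Fintype V] [DecidableEq U] (L : V → Finset U) (I : Finset U) :
    Finset V :=
  Finset.univ.filter fun u : V => (I ∩ L u).Nonempty

/-- The degree `deg*_{ℋ_I}(c)` of a colour `c` in the cross-edge subgraph of the cover
`ℋ_I = (L_I, H_I)`, where `H_I = H - N_H[I]`: the number of `H`-neighbours of `c`
surviving in `H_I` and lying in a part different from that of `c`. -/
def degStarI {V U : Type*} [Fintype V] [Fintype U] [DecidableEq U]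
    (H : SimpleGraph U) [DecidableRel H.Adj] (L : V → Finset U) (I : Finset U)
    (c : U) : ℕ :=
  (Finset.univ.filter fun d : U =>
    H.Adj c d ∧ d ∉ closedNbhd H I ∧ ∀ u : V, c ∈ L u → d ∉ L u).card



open Classical in
theorem lll_aux {α V : Type*} (Ω : Finset α) (bad : V → α → Prop)
    (Γ : V → Finset V) (p : ℝ) (D : ℕ) (hp0 : 0 ≤ p) (hD : ∀ u, (Γ u).card ≤ D)
    (hpD : 4 * p * D ≤ 1)
    (h : ∀ (u : V) (W : Finset V), Disjoint W (Γ u) →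
      ((Ω.filter (fun f => bad u f ∧ ∀ w ∈ W, ¬ bad w f)).card : ℝ) ≤
        p * ((Ω.filter (fun f => ∀ w ∈ W, ¬ bad w f)).card : ℝ)) :
    ∀ (n : ℕ) (W : Finset V), W.card = n → ∀ u : V,
      ((Ω.filter (fun f => bad u f ∧ ∀ w ∈ W, ¬ bad w f)).card : ℝ) ≤
        2 * p * ((Ω.filter (fun f => ∀ w ∈ W, ¬ bad w f)).card : ℝ) := by
  intro n
  induction n using Nat.strong_induction_on with
  | _ n ih =>
  intro W hW u
  set W' := W \ Γ u with hW'
  have hdis : Disjoint W' (Γ u) := Finset.sdiff_disjoint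
  have h1 := h u W' hdis
  have hsub : W' ⊆ W := Finset.sdiff_subset
  have hmono : ((Ω.filter (fun f => bad u f ∧ ∀ w ∈ W, ¬ bad w f)).card : ℝ) ≤
      ((Ω.filter (fun f => bad u f ∧ ∀ w ∈ W', ¬ bad w f)).card : ℝ) := by
    exact_mod_cast Finset.card_le_card (by
      intro f hf
      simp only [Finset.mem_filter] at hf ⊢
      exact ⟨hf.1, hf.2.1, fun w hw => hf.2.2 w (hsub hw)⟩)
  have hN0 : (0:ℝ) ≤ ((Ω.filter (fun f => ∀ w ∈ W', ¬ bad w f)).card : ℝ) := by positivity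
  by_cases hm : W' = W
  · rw [hm] at h1 hN0
    nlinarith
  · have hlt : W'.card < n := by
      rw [← hW]; exact Finset.card_lt_card (lt_of_le_of_ne hsub hm)
    have hcov : (Ω.filter (fun f => ∀ w ∈ W', ¬ bad w f)) ⊆
        (Ω.filter (fun f => ∀ w ∈ W, ¬ bad w f)) ∪
          (Γ u).biUnion (fun v => Ω.filter (fun f => bad v f ∧ ∀ w ∈ W', ¬ bad w f)) := by
      intro f hf
      simp only [Finset.mem_filter, Finset.mem_union, Finset.mem_biUnion] at hf ⊢
      by_cases hb : ∀ w ∈ W, ¬ bad w f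
      · exact Or.inl ⟨hf.1, hb⟩
      · push Not at hb
        obtain ⟨w, hw, hbw⟩ := hb
        refine Or.inr ⟨w, ?_, hf.1, hbw, hf.2⟩
        by_contra hwΓ
        exact hf.2 w (by rw [hW']; exact Finset.mem_sdiff.2 ⟨hw, hwΓ⟩) hbw
    have hc1 : ((Ω.filter (fun f => ∀ w ∈ W', ¬ bad w f)).card : ℝ) ≤
        ((Ω.filter (fun f => ∀ w ∈ W, ¬ bad w f)).card : ℝ) +
        ∑ v ∈ Γ u, ((Ω.filter (fun f => bad v f ∧ ∀ w ∈ W', ¬ bad w f)).card : ℝ) := by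
      have := (Finset.card_le_card hcov).trans ((Finset.card_union_le _ _).trans
        (Nat.add_le_add_left Finset.card_biUnion_le _))
      exact_mod_cast this
    have hc2 : ∑ v ∈ Γ u, ((Ω.filter (fun f => bad v f ∧ ∀ w ∈ W', ¬ bad w f)).card : ℝ) ≤
        D * (2 * p * ((Ω.filter (fun f => ∀ w ∈ W', ¬ bad w f)).card : ℝ)) := by
      refine (Finset.sum_le_card_nsmul _ _ _ (fun v _ => ih _ hlt W' rfl v)).trans ?_
      rw [nsmul_eq_mul]
      have : ((Γ u).card : ℝ) ≤ D := by exact_mod_cast hD u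
      gcongr
    generalize ((Ω.filter (fun f => ∀ w ∈ W', ¬ bad w f)).card : ℝ) = N at *
    have : D * (2 * p * N) ≤ N / 2 := by nlinarith
    have h3 : N ≤ 2 * ((Ω.filter (fun f => ∀ w ∈ W, ¬ bad w f)).card : ℝ) := by linarith
    have : p * N ≤ p * (2 * ((Ω.filter (fun f => ∀ w ∈ W, ¬ bad w f)).card : ℝ)) :=
      mul_le_mul_of_nonneg_left h3 hp0
    linarith

open Classical in
theorem lll {α V : Type*} (Ω : Finset α) (bad : V → α → Prop)
    (Γ : V → Finset V) (p : ℝ) (D : ℕ) (hp0 : 0 ≤ p) (hD : ∀ u, (Γ u).card ≤ D)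
    (hpD : 4 * p * D ≤ 1) (hp1 : 4 * p ≤ 1) (hne : Ω.Nonempty)
    (h : ∀ (u : V) (W : Finset V), Disjoint W (Γ u) →
      ((Ω.filter (fun f => bad u f ∧ ∀ w ∈ W, ¬ bad w f)).card : ℝ) ≤
        p * ((Ω.filter (fun f => ∀ w ∈ W, ¬ bad w f)).card : ℝ)) (W : Finset V) :
    ∃ f ∈ Ω, ∀ w ∈ W, ¬ bad w f := by
  have key := lll_aux Ω bad Γ p D hp0 hD hpD h
  suffices hs : (0:ℝ) < ((Ω.filter (fun f => ∀ w ∈ W, ¬ bad w f)).card : ℝ) by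
    have : 0 < (Ω.filter (fun f => ∀ w ∈ W, ¬ bad w f)).card := by exact_mod_cast hs
    obtain ⟨f, hf⟩ := Finset.card_pos.1 this
    exact ⟨f, (Finset.mem_filter.1 hf).1, (Finset.mem_filter.1 hf).2⟩
  induction W using Finset.induction_on with
  | empty => simpa using hne
  | insert u W hu ih =>
    have h1 := key _ W rfl u
    have h2 : ((Ω.filter (fun f => ∀ w ∈ W, ¬ bad w f)).card : ℝ) ≤
        ((Ω.filter (fun f => ∀ w ∈ insert u W, ¬ bad w f)).card : ℝ) +
        ((Ω.filter (fun f => bad u f ∧ ∀ w ∈ W, ¬ bad w f)).card : ℝ) := by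
      have : (Ω.filter (fun f => ∀ w ∈ W, ¬ bad w f)) ⊆
        (Ω.filter (fun f => ∀ w ∈ insert u W, ¬ bad w f)) ∪
        (Ω.filter (fun f => bad u f ∧ ∀ w ∈ W, ¬ bad w f)) := by
        intro f hf
        simp only [Finset.mem_filter, Finset.mem_union, Finset.mem_insert,
          forall_eq_or_imp] at hf ⊢
        tauto
      exact_mod_cast (Finset.card_le_card this).trans (Finset.card_union_le _ _)
    nlinarith

theorem one_add_sum_le_prod' {κ : Type*} (C : Finset κ) (r : κ → ℝ) (h : ∀ c ∈ C, 0 ≤ r c) :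
    1 + ∑ c ∈ C, r c ≤ ∏ c ∈ C, (1 + r c) := by
  classical
  induction C using Finset.induction_on with
  | empty => simp
  | insert a C ha ih =>
    rw [Finset.sum_insert ha, Finset.prod_insert ha]
    have h1 := ih (fun c hc => h c (Finset.mem_insert_of_mem hc))
    have h2 := h a (Finset.mem_insert_self _ _)
    have h3 : 0 ≤ ∑ c ∈ C, r c :=
      Finset.sum_nonneg (fun c hc => h c (Finset.mem_insert_of_mem hc))
    nlinarith

/-- One-vertex averaging. -/
theorem single_vertex {A κ : Type*} (S : Finset A) (C : Finset κ)
    (kill : A → κ → Prop) [∀ a c, Decidable (kill a c)]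
    (huniq : ∀ a ∈ S, ∀ c ∈ C, ∀ c' ∈ C, kill a c → kill a c' → c = c')
    (μ : κ → ℝ) (h0 : ∀ c ∈ C, 0 ≤ μ c) (h1 : ∀ c ∈ C, μ c < 1) :
    ∑ a ∈ S, ∏ c ∈ C, (1 - μ c * (if kill a c then 0 else 1)) ≤
      S.card * ∏ c ∈ C, (1 - μ c * (1 - ((S.filter (fun a => kill a c)).card : ℝ) / S.card)) := by
  classical
  rcases S.eq_empty_or_nonempty with rfl | hS
  · simp
  have hSpos : (0:ℝ) < S.card := by exact_mod_cast hS.card_pos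
  set P := ∏ c ∈ C, (1 - μ c) with hP
  have hP0 : 0 ≤ P := Finset.prod_nonneg (fun c hc => by linarith [h1 c hc])
  have e1 : ∀ a ∈ S, ∏ c ∈ C, (1 - μ c * (if kill a c then 0 else 1)) =
      P * (1 + ∑ c ∈ C, (if kill a c then 1 else 0) * (μ c / (1 - μ c))) := by
    intro a ha
    by_cases hk : ∃ c ∈ C, kill a c
    · obtain ⟨c, hc, hkc⟩ := hk
      have hoth : ∀ c' ∈ C, c' ≠ c → ¬ kill a c' := fun c' hc' hne hk' =>
        hne (huniq a ha c' hc' c hc hk' hkc)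
      rw [Finset.sum_eq_single_of_mem c hc (fun c' hc' hne => by simp [hoth c' hc' hne])]
      rw [hP, ← Finset.mul_prod_erase _ _ hc, ← Finset.mul_prod_erase _ _ hc]
      have : ∏ x ∈ C.erase c, (1 - μ x * (if kill a x then 0 else 1)) =
          ∏ x ∈ C.erase c, (1 - μ x) := by
        refine Finset.prod_congr rfl (fun x hx => ?_)
        rw [if_neg (hoth x (Finset.mem_of_mem_erase hx) (Finset.ne_of_mem_erase hx)), mul_one]
      rw [this, if_pos hkc, if_pos hkc]
      have : 1 - μ c ≠ 0 := by linarith [h1 c hc]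
      field_simp
      ring
    · push Not at hk
      rw [Finset.sum_eq_zero (fun c hc => by simp [hk c hc])]
      rw [hP, add_zero, mul_one]
      exact Finset.prod_congr rfl (fun x hx => by simp [hk x hx])
  rw [Finset.sum_congr rfl e1, ← Finset.mul_sum, Finset.sum_add_distrib, Finset.sum_comm]
  have e2 : ∀ c ∈ C, ∑ a ∈ S, (if kill a c then (1:ℝ) else 0) * (μ c / (1 - μ c)) =
      S.card * (((S.filter (fun a => kill a c)).card : ℝ) / S.card * (μ c / (1 - μ c))) := by
    intro c _
    rw [← Finset.sum_mul, Finset.sum_boole]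
    field_simp
  rw [Finset.sum_congr rfl e2, ← Finset.mul_sum]
  have e3 : ∏ c ∈ C, (1 - μ c * (1 - ((S.filter (fun a => kill a c)).card : ℝ) / S.card)) =
      P * ∏ c ∈ C, (1 + ((S.filter (fun a => kill a c)).card : ℝ) / S.card * (μ c / (1 - μ c))) := by
    rw [hP, ← Finset.prod_mul_distrib]
    refine Finset.prod_congr rfl (fun c hc => ?_)
    have : 1 - μ c ≠ 0 := by linarith [h1 c hc]
    field_simp
    ring
  rw [e3]
  have e4 : 1 + ∑ c ∈ C, (((S.filter (fun a => kill a c)).card : ℝ) / S.card * (μ c / (1 - μ c))) ≤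
     ∏ c ∈ C, (1 + ((S.filter (fun a => kill a c)).card : ℝ) / S.card * (μ c / (1 - μ c))) := by
    have hnn : ∀ c ∈ C, 0 ≤ ((S.filter (fun a => kill a c)).card : ℝ) / S.card * (μ c / (1 - μ c)) :=
      fun c hc => mul_nonneg (by positivity) (div_nonneg (h0 c hc) (by linarith [h1 c hc]))
    exact one_add_sum_le_prod' _ _ hnn
  have e5 := mul_le_mul_of_nonneg_left e4 (mul_nonneg hSpos.le hP0)
  simp only [Finset.sum_const, nsmul_eq_mul, mul_one]
  linarith

theorem sum_update {V β : Type*} [Fintype V] [DecidableEq V] (A : V → Finset β) (v : V)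
    (F : (V → β) → ℝ) :
    ∑ f ∈ Fintype.piFinset A, ∑ a ∈ A v, F (Function.update f v a) =
      (A v).card * ∑ f ∈ Fintype.piFinset A, F f := by
  have h1 : (A v).card * ∑ f ∈ Fintype.piFinset A, F f =
      ∑ f ∈ Fintype.piFinset A, ∑ a ∈ A v, F f := by
    simp [Finset.mul_sum]
  rw [h1, ← Finset.sum_product', ← Finset.sum_product']
  refine Finset.sum_nbij' (fun x => (Function.update x.1 v x.2, x.1 v))
    (fun x => (Function.update x.1 v x.2, x.1 v)) ?_ ?_ ?_ ?_ ?_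
  · rintro ⟨f, a⟩ h
    simp only [Finset.mem_product, Fintype.mem_piFinset] at h ⊢
    refine ⟨fun w => ?_, h.1 v⟩
    by_cases hw : w = v
    · subst hw; simpa using h.2
    · simpa [hw] using h.1 w
  · rintro ⟨f, a⟩ h
    simp only [Finset.mem_product, Fintype.mem_piFinset] at h ⊢
    refine ⟨fun w => ?_, h.1 v⟩
    by_cases hw : w = v
    · subst hw; simpa using h.2
    · simpa [hw] using h.1 w
  · rintro ⟨f, a⟩ _; simp
  · rintro ⟨f, a⟩ _; simp
  · rintro ⟨f, a⟩ _; simp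

theorem many_vertices {V β κ : Type*} [Fintype V] [DecidableEq V] (A : V → Finset β)
    (C : Finset κ) (kill : V → β → κ → Prop) [∀ v a c, Decidable (kill v a c)]
    (s : Finset V) (hne : ∀ v ∈ s, (A v).Nonempty)
    (huniq : ∀ v ∈ s, ∀ a ∈ A v, ∀ c ∈ C, ∀ c' ∈ C, kill v a c → kill v a c' → c = c') :
    ∀ lam : κ → ℝ, (∀ c ∈ C, 0 ≤ lam c) → (∀ c ∈ C, lam c < 1) →
    ∑ f ∈ Fintype.piFinset A, ∏ c ∈ C,
        (1 - lam c * ∏ v ∈ s, (if kill v (f v) c then (0:ℝ) else 1)) ≤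
      (Fintype.piFinset A).card * ∏ c ∈ C, (1 - lam c * ∏ v ∈ s,
        (1 - (((A v).filter (fun a => kill v a c)).card : ℝ) / (A v).card)) := by
  induction s using Finset.induction_on with
  | empty => intro lam _ _; simp
  | insert v s hv ih =>
    intro lam h0 h1
    have ih' := ih (fun w hw => hne w (Finset.mem_insert_of_mem hw))
      (fun w hw => huniq w (Finset.mem_insert_of_mem hw))
    set p : κ → ℝ := fun c => (((A v).filter (fun a => kill v a c)).card : ℝ) / (A v).card with hp
    have hApos : (0:ℝ) < (A v).card := by
      exact_mod_cast (hne v (Finset.mem_insert_self _ _)).card_pos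
    have hp0 : ∀ c, 0 ≤ p c := fun c => by simp only [hp]; positivity
    have hp1 : ∀ c, p c ≤ 1 := fun c => by
      simp only [hp]
      rw [div_le_one hApos]
      exact_mod_cast Finset.card_filter_le _ _
    have hprod0 : ∀ (f : V → β) c, 0 ≤ ∏ w ∈ s, (if kill w (f w) c then (0:ℝ) else 1) :=
      fun f c => Finset.prod_nonneg (fun w _ => by split_ifs <;> norm_num)
    have hprod1 : ∀ (f : V → β) c, ∏ w ∈ s, (if kill w (f w) c then (0:ℝ) else 1) ≤ 1 :=
      fun f c => Finset.prod_le_one (fun w _ => by split_ifs <;> norm_num)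
        (fun w _ => by split_ifs <;> norm_num)
    have step := sum_update A v (fun f => ∏ c ∈ C,
        (1 - lam c * ∏ v ∈ insert v s, (if kill v (f v) c then (0:ℝ) else 1)))
    have e1 : ∀ f ∈ Fintype.piFinset A, ∑ a ∈ A v, ∏ c ∈ C,
        (1 - lam c * ∏ w ∈ insert v s,
          (if kill w (Function.update f v a w) c then (0:ℝ) else 1)) ≤
        (A v).card * ∏ c ∈ C, (1 - (lam c * (1 - p c)) *
          ∏ w ∈ s, (if kill w (f w) c then (0:ℝ) else 1)) := by
      intro f _
      have := single_vertex (A v) C (kill v) (huniq v (Finset.mem_insert_self _ _))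
        (fun c => lam c * ∏ w ∈ s, (if kill w (f w) c then (0:ℝ) else 1))
        (fun c hc => mul_nonneg (h0 c hc) (hprod0 f c))
        (fun c hc => lt_of_le_of_lt (mul_le_of_le_one_right (h0 c hc) (hprod1 f c)) (h1 c hc))
      refine le_trans (le_of_eq ?_) (this.trans (le_of_eq ?_))
      · refine Finset.sum_congr rfl (fun a _ => Finset.prod_congr rfl (fun c _ => ?_))
        rw [Finset.prod_insert hv, Function.update_self]
        have : ∏ w ∈ s, (if kill w (Function.update f v a w) c then (0:ℝ) else 1) =
            ∏ w ∈ s, (if kill w (f w) c then (0:ℝ) else 1) := by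
          refine Finset.prod_congr rfl (fun w hw => ?_)
          rw [Function.update_of_ne (show w ≠ v from fun h => hv (h ▸ hw))]
        rw [this]; ring
      · congr 1
        refine Finset.prod_congr rfl (fun c _ => ?_)
        simp only [hp]; ring
    have e2 := ih' (fun c => lam c * (1 - p c))
      (fun c hc => mul_nonneg (h0 c hc) (by linarith [hp1 c]))
      (fun c hc => lt_of_le_of_lt
        (mul_le_of_le_one_right (h0 c hc) (by linarith [hp0 c])) (h1 c hc))
    have e3 := Finset.sum_le_sum e1
    rw [← Finset.mul_sum, step] at e3
    have e4 := le_of_mul_le_mul_left e3 hApos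
    refine e4.trans (e2.trans (le_of_eq ?_))
    congr 1
    refine Finset.prod_congr rfl (fun c _ => ?_)
    rw [Finset.prod_insert hv]
    simp only [hp]; ring

/-- Lower tail of the number of surviving colours. -/
theorem kept_tail {V β κ : Type*} [Fintype V] [DecidableEq V] (A : V → Finset β)
    (C : Finset κ) (kill : V → β → κ → Prop) [∀ v a c, Decidable (kill v a c)]
    (s : Finset V) (hC : C.Nonempty)
    (hnone : ∀ v ∈ s, ∃ b ∈ A v, ∀ c ∈ C, ¬ kill v b c)
    (huniq : ∀ v ∈ s, ∀ a ∈ A v, ∀ c ∈ C, ∀ c' ∈ C, kill v a c → kill v a c' → c = c')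
    (huniq' : ∀ v ∈ s, ∀ c ∈ C, ∀ a ∈ A v, ∀ a' ∈ A v, kill v a c → kill v a' c → a = a')
    (l : ℝ) :
    (((Fintype.piFinset A).filter (fun f =>
      ((C.filter (fun c => ∀ v ∈ s, ¬ kill v (f v) c)).card : ℝ) < l)).card : ℝ) ≤
    Real.exp (l - C.card * Real.exp (-(s.card / C.card)) / 2) * (Fintype.piFinset A).card := by
  classical
  set k : ℝ := (C.card : ℝ) with hk
  have hkpos : 0 < k := by rw [hk]; exact_mod_cast hC.card_pos
  set N : ℝ := ((Fintype.piFinset A).card : ℝ) with hN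
  have hN0 : 0 ≤ N := by rw [hN]; positivity
  set m : κ → V → ℝ := fun c v => (((A v).filter (fun a => kill v a c)).card : ℝ) with hm
  set q : κ → ℝ := fun c => ∏ v ∈ s, (1 - m c v / (A v).card) with hq
  have main := many_vertices A C kill s (fun v hv => (hnone v hv).imp fun b hb => hb.1) huniq
    (fun _ => 1 / 2) (fun _ _ => by norm_num) (fun _ _ => by norm_num)
  -- lower bound for q
  have hm1 : ∀ v ∈ s, ∀ c ∈ C, m c v = 0 ∨ m c v = 1 := by
    intro v hv c hc
    have : ((A v).filter (fun a => kill v a c)).card ≤ 1 := by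
      rw [Finset.card_le_one]
      intro a ha b hb
      simp only [Finset.mem_filter] at ha hb
      exact huniq' v hv c hc a ha.1 b hb.1 ha.2 hb.2
    simp only [hm]
    interval_cases ((A v).filter (fun a => kill v a c)).card <;> simp
  have hsum1 : ∀ v ∈ s, ∑ c ∈ C, m c v ≤ (A v).card - 1 := by
    intro v hv
    obtain ⟨b, hb, hbk⟩ := hnone v hv
    have hdisj : ((C : Set κ)).PairwiseDisjoint (fun c => (A v).filter (fun a => kill v a c)) := by
      intro c hc c' hc' hne
      refine Finset.disjoint_left.2 (fun a ha ha' => hne ?_)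
      simp only [Finset.mem_filter] at ha ha'
      exact huniq v hv a ha.1 c hc c' hc' ha.2 ha'.2
    have h1 := Finset.card_biUnion hdisj
    have h2 : C.biUnion (fun c => (A v).filter (fun a => kill v a c)) ⊆ (A v).erase b := by
      intro a ha
      simp only [Finset.mem_biUnion, Finset.mem_filter, Finset.mem_erase] at ha ⊢
      obtain ⟨c, hc, haA, hka⟩ := ha
      exact ⟨fun h => hbk c hc (h ▸ hka), haA⟩
    have h3 := Finset.card_le_card h2
    rw [h1, Finset.card_erase_of_mem hb] at h3
    have hpos : 1 ≤ (A v).card := Finset.card_pos.2 ⟨b, hb⟩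
    have h4 : ∑ c ∈ C, ((A v).filter (fun a => kill v a c)).card + 1 ≤ (A v).card := by omega
    have h5 : ((∑ c ∈ C, ((A v).filter (fun a => kill v a c)).card + 1 : ℕ) : ℝ) ≤ (A v).card := by
      exact_mod_cast h4
    push_cast at h5
    simp only [hm]
    linarith
  set t : κ → V → ℝ := fun c v => m c v / ((A v).card - 1) with ht
  have hmnn : ∀ c v, 0 ≤ m c v := fun c v => by simp only [hm]; positivity
  have hcv : ∀ v ∈ s, ∀ c ∈ C, Real.exp (-(t c v)) ≤ 1 - m c v / (A v).card := by
    intro v hv c hc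
    rcases hm1 v hv c hc with h | h
    · simp [ht, h]
    · have h2 : m c v ≤ (A v).card - 1 :=
        (Finset.single_le_sum (f := fun c => m c v) (fun c _ => hmnn c v) hc).trans (hsum1 v hv)
      simp only [ht]
      rw [h] at h2 ⊢
      set n : ℝ := ((A v).card : ℝ)
      have hn1 : 0 < n - 1 := by linarith
      have hn : 0 < n := by linarith
      rw [Real.exp_neg]
      have h6 : n / (n - 1) ≤ Real.exp (1 / (n - 1)) := by
        have := Real.add_one_le_exp (1 / (n - 1))
        have e : n / (n - 1) = 1 / (n - 1) + 1 := by field_simp; ring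
        linarith
      have h7 : (Real.exp (1 / (n - 1)))⁻¹ ≤ (n / (n - 1))⁻¹ :=
        inv_anti₀ (by positivity) h6
      refine h7.trans (le_of_eq ?_)
      field_simp
  have hqexp : ∀ c ∈ C, Real.exp (-(∑ v ∈ s, t c v)) ≤ q c := by
    intro c hc
    rw [← Finset.sum_neg_distrib, Real.exp_sum]
    exact Finset.prod_le_prod (fun v _ => (Real.exp_pos _).le) (fun v hv => hcv v hv c hc)
  have hT : ∑ c ∈ C, ∑ v ∈ s, t c v ≤ s.card := by
    rw [Finset.sum_comm]
    refine (Finset.sum_le_card_nsmul s _ 1 (fun v hv => ?_)).trans (by simp)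
    simp only [ht]
    rw [← Finset.sum_div]
    have h1 := hsum1 v hv
    exact div_le_one_of_le₀ h1 ((Finset.sum_nonneg (fun c _ => hmnn c v)).trans h1)
  set a : ℝ := (s.card : ℝ) / k with ha
  have hqsum : k * Real.exp (-a) ≤ ∑ c ∈ C, q c := by
    have h1 : ∀ c ∈ C, Real.exp (-a) * (1 + a - ∑ v ∈ s, t c v) ≤ q c := by
      intro c hc
      refine le_trans ?_ (hqexp c hc)
      have e : -(∑ v ∈ s, t c v) = -a + (a - ∑ v ∈ s, t c v) := by ring
      rw [e, Real.exp_add]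
      have := Real.add_one_le_exp (a - ∑ v ∈ s, t c v)
      exact mul_le_mul_of_nonneg_left (by linarith) (Real.exp_pos _).le
    refine le_trans ?_ (Finset.sum_le_sum h1)
    rw [← Finset.mul_sum, Finset.sum_sub_distrib, Finset.sum_const, nsmul_eq_mul, ← hk, mul_comm]
    have hka : k * a = s.card := by rw [ha]; field_simp
    exact mul_le_mul_of_nonneg_left (by linarith) (Real.exp_pos _).le
  have hq0 : ∀ c ∈ C, 0 ≤ q c := fun c hc => (Real.exp_pos _).le.trans (hqexp c hc)
  have hq1 : ∀ c ∈ C, q c ≤ 1 := fun c hc => Finset.prod_le_one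
    (fun v hv => (Real.exp_pos _).le.trans (hcv v hv c hc))
    (fun v _ => by
      have : 0 ≤ m c v / (A v).card := div_nonneg (hmnn c v) (by positivity)
      linarith)
  have hR : ∏ c ∈ C, (1 - 1 / 2 * q c) ≤ Real.exp (-(k * Real.exp (-a) / 2)) := by
    calc ∏ c ∈ C, (1 - 1 / 2 * q c) ≤ ∏ c ∈ C, Real.exp (-(1 / 2 * q c)) := by
          refine Finset.prod_le_prod (fun c hc => by linarith [hq1 c hc]) (fun c _ => ?_)
          linarith [Real.add_one_le_exp (-(1 / 2 * q c))]
      _ = Real.exp (-(1 / 2 * ∑ c ∈ C, q c)) := by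
          rw [← Real.exp_sum, Finset.sum_neg_distrib, Finset.mul_sum]
      _ ≤ _ := by
          apply Real.exp_le_exp.2
          linarith
  have hL : ∀ f : V → β, ∏ c ∈ C, (1 - 1 / 2 * ∏ v ∈ s, (if kill v (f v) c then (0:ℝ) else 1)) =
      (1 / 2) ^ (C.filter (fun c => ∀ v ∈ s, ¬ kill v (f v) c)).card := by
    intro f
    rw [← Finset.prod_const, Finset.prod_filter]
    refine Finset.prod_congr rfl (fun c _ => ?_)
    split_ifs with h
    · rw [Finset.prod_eq_one (fun v hv => by simp [h v hv])]; norm_num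
    · push Not at h
      obtain ⟨v, hv, hkv⟩ := h
      rw [Finset.prod_eq_zero hv (by simp [hkv])]; norm_num
  set Bad := (Fintype.piFinset A).filter (fun f =>
      ((C.filter (fun c => ∀ v ∈ s, ¬ kill v (f v) c)).card : ℝ) < l) with hBad
  have hlow : Bad.card * Real.exp (-l) ≤ ∑ f ∈ Fintype.piFinset A, ∏ c ∈ C,
        (1 - 1 / 2 * ∏ v ∈ s, (if kill v (f v) c then (0:ℝ) else 1)) := by
    rw [← nsmul_eq_mul]
    calc Bad.card • Real.exp (-l) ≤ ∑ f ∈ Bad, ∏ c ∈ C,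
          (1 - 1 / 2 * ∏ v ∈ s, (if kill v (f v) c then (0:ℝ) else 1)) := by
          refine Finset.card_nsmul_le_sum _ _ _ (fun f hf => ?_)
          rw [hL]
          have h1 := (Finset.mem_filter.1 hf).2
          set Y := (C.filter (fun c => ∀ v ∈ s, ¬ kill v (f v) c)).card
          have h2 : Real.exp (-1) ≤ 1 / 2 := by
            rw [Real.exp_neg, one_div]
            exact inv_anti₀ (by norm_num) (by linarith [Real.add_one_le_exp (1:ℝ)])
          calc Real.exp (-l) ≤ Real.exp (Y * (-1)) := Real.exp_le_exp.2 (by linarith)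
            _ = Real.exp (-1) ^ Y := by rw [← Real.exp_nat_mul]
            _ ≤ _ := pow_le_pow_left₀ (Real.exp_pos _).le h2 _
      _ ≤ _ := by
          refine Finset.sum_le_sum_of_subset_of_nonneg (Finset.filter_subset _ _) (fun f _ _ => ?_)
          rw [hL]; positivity
  have hfin : Bad.card * Real.exp (-l) ≤ N * Real.exp (-(k * Real.exp (-a) / 2)) :=
    hlow.trans (main.trans (mul_le_mul_of_nonneg_left hR hN0))
  have e : Real.exp (l - k * Real.exp (-a) / 2) =
      Real.exp (-(k * Real.exp (-a) / 2)) * Real.exp l := by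
    rw [← Real.exp_add]; ring_nf
  rw [e]
  have e2 : Real.exp (-l) * Real.exp l = 1 := by rw [← Real.exp_add]; simp
  calc (Bad.card : ℝ) = Bad.card * Real.exp (-l) * Real.exp l := by rw [mul_assoc, e2, mul_one]
    _ ≤ N * Real.exp (-(k * Real.exp (-a) / 2)) * Real.exp l :=
      mul_le_mul_of_nonneg_right hfin (Real.exp_pos _).le
    _ = _ := by ring

/-- Upper tail for the number of uncoloured neighbours of a surviving colour. -/
theorem deg_tail {V β : Type*} [Fintype V] [DecidableEq V] [DecidableEq β] (A : V → Finset β)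
    (s : Finset V) (nn : β) (kill : V → β → Prop) [∀ v a, Decidable (kill v a)]
    (hA : ∀ v ∈ s, nn ∈ A v) (hk : ∀ v ∈ s, ¬ kill v nn) (t : ℝ) :
    (((Fintype.piFinset A).filter (fun f => (∀ v ∈ s, ¬ kill v (f v)) ∧
      t < ((s.filter (fun v => f v = nn ∧ ∃ a ∈ A v, kill v a)).card : ℝ))).card : ℝ) ≤
    Real.exp (-(2 / 3 * t)) * (Fintype.piFinset A).card := by
  set g : V → β → ℝ := fun v a => if v ∈ s then (if kill v a then 0 else
    if a = nn ∧ ∃ a ∈ A v, kill v a then 2 else 1) else 1 with hg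
  have hg0 : ∀ v a, 0 ≤ g v a := by
    intro v a; simp only [hg]; split_ifs <;> norm_num
  have hsum : ∀ v, ∑ a ∈ A v, g v a ≤ (A v).card := by
    intro v
    by_cases hv : v ∈ s
    · by_cases hex : ∃ a ∈ A v, kill v a
      · obtain ⟨a0, ha0, hka0⟩ := hex
        have hne : a0 ≠ nn := fun h => hk v hv (h ▸ hka0)
        have h1 : ∀ a ∈ A v, g v a ≤ 1 + (if a = nn then 1 else 0) - (if a = a0 then 1 else 0) := by
          intro a _
          simp only [hg, if_pos hv]
          by_cases e1 : a = a0
          · subst e1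
            simp [hka0, hne]
          · rw [if_neg e1]
            by_cases e2 : a = nn
            · subst e2
              rw [if_pos rfl]
              split_ifs <;> norm_num
            · rw [if_neg e2]
              simp only [e2, false_and, if_false]
              split_ifs <;> norm_num
        refine (Finset.sum_le_sum h1).trans (le_of_eq ?_)
        rw [Finset.sum_sub_distrib, Finset.sum_add_distrib, Finset.sum_ite_eq',
          Finset.sum_ite_eq', if_pos (hA v hv), if_pos ha0]
        simp
      · refine (Finset.sum_le_card_nsmul (A v) _ 1 (fun a _ => ?_)).trans (by simp)
        simp only [hg, hex, and_false, if_false]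
        split_ifs <;> norm_num
    · simp [hg, hv]
  have hprod : ∑ f ∈ Fintype.piFinset A, ∏ v, g v (f v) ≤ (Fintype.piFinset A).card := by
    rw [← Finset.prod_univ_sum, Fintype.card_piFinset]
    push_cast
    exact Finset.prod_le_prod (fun v _ => Finset.sum_nonneg (fun a _ => hg0 v a))
      (fun v _ => hsum v)
  set Bad := (Fintype.piFinset A).filter (fun f => (∀ v ∈ s, ¬ kill v (f v)) ∧
      t < ((s.filter (fun v => f v = nn ∧ ∃ a ∈ A v, kill v a)).card : ℝ)) with hBad
  have hlow : Bad.card * Real.exp (2 / 3 * t) ≤ ∑ f ∈ Fintype.piFinset A, ∏ v, g v (f v) := by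
    rw [← nsmul_eq_mul]
    calc Bad.card • Real.exp (2 / 3 * t) ≤ ∑ f ∈ Bad, ∏ v, g v (f v) := by
          refine Finset.card_nsmul_le_sum _ _ _ (fun f hf => ?_)
          obtain ⟨_, hk', hY⟩ := Finset.mem_filter.1 hf
          have e : ∏ v, g v (f v) =
              2 ^ (s.filter (fun v => f v = nn ∧ ∃ a ∈ A v, kill v a)).card := by
            rw [← Finset.prod_const, Finset.prod_filter]
            rw [← Finset.prod_subset (Finset.subset_univ s)
              (fun v _ hv => by simp [hg, hv])]
            refine Finset.prod_congr rfl (fun v hv => ?_)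
            simp only [hg, if_pos hv, if_neg (hk' v hv)]
          rw [e]
          set Y := (s.filter (fun v => f v = nn ∧ ∃ a ∈ A v, kill v a)).card
          have h2 : Real.exp (2 / 3) ≤ 2 := by
            rw [← Real.le_log_iff_exp_le (by norm_num)]
            linarith [Real.log_two_gt_d9]
          calc Real.exp (2 / 3 * t) ≤ Real.exp (Y * (2 / 3)) := Real.exp_le_exp.2 (by linarith)
            _ = Real.exp (2 / 3) ^ Y := by rw [← Real.exp_nat_mul]
            _ ≤ _ := pow_le_pow_left₀ (Real.exp_pos _).le h2 _
      _ ≤ _ := Finset.sum_le_sum_of_subset_of_nonneg (Finset.filter_subset _ _)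
            (fun f _ _ => Finset.prod_nonneg (fun v _ => hg0 _ _))
  have h := hlow.trans hprod
  rw [Real.exp_neg]
  have hpos := Real.exp_pos (2 / 3 * t)
  rw [← div_eq_inv_mul, le_div_iff₀ hpos]
  exact h

section graphpart

open Classical

/-- Colours of `v` that survive the partial colouring `f`. -/
noncomputable def keptL {V U : Type} (G : SimpleGraph V)
    (H : SimpleGraph U) (L : V → Finset U) (f : V → Option U) (v : V) : Finset U :=
  (L v).filter (fun d => ∀ w, (w = v ∨ G.Adj v w) → ∀ e, f w = some e → e ≠ d ∧ ¬ H.Adj d e)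

theorem mem_keptL {V U : Type} (G : SimpleGraph V)
    (H : SimpleGraph U) (L : V → Finset U) (f : V → Option U) (v : V) (d : U) :
    d ∈ keptL G H L f v ↔ d ∈ L v ∧
      ∀ w, (w = v ∨ G.Adj v w) → ∀ e, f w = some e → e ≠ d ∧ ¬ H.Adj d e := by
  rw [keptL, Finset.mem_filter]

noncomputable def nbrsL {V U : Type} [Fintype U] (G : SimpleGraph V)
    (H : SimpleGraph U) (L : V → Finset U) (f : V → Option U) (u : V) (c : U) : Finset U :=
  Finset.univ.filter (fun d => H.Adj c d ∧ ∃ v, G.Adj u v ∧ d ∈ keptL G H L f v)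

def badEv {V U : Type} [Fintype U] (G : SimpleGraph V)
    (H : SimpleGraph U) (L : V → Finset U) (l : V → ℝ) (t : ℝ) (u : V) (f : V → Option U) : Prop :=
  f u = none ∧ (((keptL G H L f u).card : ℝ) < l u ∨
    ∃ c ∈ keptL G H L f u, t < ((nbrsL G H L f u c).card : ℝ))

noncomputable def colourings {V U : Type} [Fintype V] [Fintype U]
    (H : SimpleGraph U) (L : V → Finset U) : Finset (V → Option U) :=
  Finset.univ.filter (fun f => (∀ v c, f v = some c → c ∈ L v) ∧
    ∀ v w c d, f v = some c → f w = some d → ¬ H.Adj c d)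

theorem fibre {V U : Type} [Fintype V] [Fintype U] (G : SimpleGraph V)
    [DecidableRel G.Adj]
    (H : SimpleGraph U) (L : V → Finset U) (htri : G.CliqueFree 3) (hcov : IsCover G H L)
    (l : V → ℝ) (t : ℝ) (u : V) (f0 : V → Option U) (hf0 : f0 ∈ colourings H L)
    (hr : ∀ v, G.Adj u v → f0 v = none) (hu : f0 u = none) (hC : (L u).Nonempty) :
    (((colourings H L).filter
      (fun f => (∀ v, ¬ G.Adj u v → f v = f0 v) ∧ badEv G H L l t u f)).card : ℝ) ≤
    (Real.exp (l u - (L u).card * Real.exp (-(G.degree u / (L u).card)) / 2)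
      + (L u).card * Real.exp (-(2 / 3 * t))) *
    ((colourings H L).filter (fun f => (∀ v, ¬ G.Adj u v → f v = f0 v))).card := by
  obtain ⟨hc1, hc2, hc3, hc4⟩ := hcov
  have hpart : ∀ c v w, c ∈ L v → c ∈ L w → v = w := fun c v w hv hw =>
    (hc1 c).unique hv hw
  simp only [colourings, Finset.mem_filter, Finset.mem_univ, true_and] at hf0
  set A : V → Finset (Option U) := fun v => if G.Adj u v then
    Finset.univ.filter (fun o => ∀ c, o = some c → c ∈ L v ∧ ∀ w d, f0 w = some d → ¬ H.Adj c d)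
    else {f0 v} with hA
  have hAadj : ∀ v, G.Adj u v → ∀ o, o ∈ A v ↔
      ∀ c, o = some c → c ∈ L v ∧ ∀ w d, f0 w = some d → ¬ H.Adj c d := by
    intro v hv o; simp only [hA, if_pos hv, Finset.mem_filter, Finset.mem_univ, true_and]
  have hAnadj : ∀ v, ¬ G.Adj u v → ∀ o, o ∈ A v ↔ o = f0 v := by
    intro v hv o; simp only [hA, if_neg hv, Finset.mem_singleton]
  have hF : (colourings H L).filter (fun f => (∀ v, ¬ G.Adj u v → f v = f0 v)) =
      Fintype.piFinset A := by
    ext f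
    simp only [colourings, Finset.mem_filter, Finset.mem_univ, true_and, Fintype.mem_piFinset]
    constructor
    · rintro ⟨⟨h1, h2⟩, h3⟩ v
      by_cases hv : G.Adj u v
      · rw [hAadj v hv]
        intro c hc
        refine ⟨h1 v c hc, fun w d hd => ?_⟩
        have hw : ¬ G.Adj u w := fun hw => by rw [hr w hw] at hd; cases hd
        exact h2 v w c d hc ((h3 w hw).trans hd)
      · rw [hAnadj v hv]; exact h3 v hv
    · intro h
      have h3 : ∀ v, ¬ G.Adj u v → f v = f0 v := fun v hv => (hAnadj v hv _).1 (h v)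
      have hL : ∀ v c, f v = some c → c ∈ L v := by
        intro v c hc
        by_cases hv : G.Adj u v
        · exact ((hAadj v hv _).1 (h v) c hc).1
        · exact hf0.1 v c ((h3 v hv) ▸ hc)
      refine ⟨⟨hL, ?_⟩, h3⟩
      intro v w c d hc hd hadj
      by_cases hv : G.Adj u v
      · by_cases hw : G.Adj u w
        · rcases hc3 c d hadj v w (hL v c hc) (hL w d hd) with rfl | hvw
          · rw [hc] at hd; cases hd; exact H.loopless.irrefl _ hadj
          · exact htri {u, v, w} (SimpleGraph.is3Clique_triple_iff.2 ⟨hv, hw, hvw⟩)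
        · exact ((hAadj v hv _).1 (h v) c hc).2 w d ((h3 w hw) ▸ hd) hadj
      · by_cases hw : G.Adj u w
        · exact ((hAadj w hw _).1 (h w) d hd).2 v c ((h3 v hv) ▸ hc) hadj.symm
        · exact hf0.2 v w c d ((h3 v hv) ▸ hc) ((h3 w hw) ▸ hd) hadj
  set kill : V → Option U → U → Prop := fun _ a c => ∃ d, a = some d ∧ H.Adj c d with hkill
  set s := G.neighborFinset u with hs
  have hms : ∀ v, v ∈ s ↔ G.Adj u v := fun v => by rw [hs, SimpleGraph.mem_neighborFinset]
  have hnone : ∀ v ∈ s, none ∈ A v := by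
    intro v hv
    rw [hAadj v ((hms v).1 hv)]
    intro c hc; cases hc
  have hnk : ∀ v c, ¬ kill v none c := by
    rintro v c ⟨d, hd, _⟩; cases hd
  have hAL : ∀ v ∈ s, ∀ d, some d ∈ A v → d ∈ L v := fun v hv d hd =>
    ((hAadj v ((hms v).1 hv) _).1 hd d rfl).1
  have T1 := kept_tail A (L u) kill s hC (fun v hv => ⟨none, hnone v hv, fun c _ => hnk v c⟩)
    (by
      rintro v hv a ha c hc c' hc' ⟨d, rfl, hd⟩ ⟨d', he, hd'⟩
      cases he
      exact hc4 v u ((hms v).1 hv).symm d (hAL v hv d ha) c hc c' hc' hd.symm hd'.symm)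
    (by
      rintro v hv c hc a ha a' ha' ⟨d, rfl, hd⟩ ⟨d', rfl, hd'⟩
      rw [hc4 u v ((hms v).1 hv) c hc d (hAL v hv d ha) d' (hAL v hv d' ha') hd hd'])
    (l u)
  have T2 : ∀ c ∈ L u, _ := fun c _ => deg_tail A s none (fun v a => kill v a c) hnone
    (fun v _ => hnk v c) t
  have hsub : (colourings H L).filter
      (fun f => (∀ v, ¬ G.Adj u v → f v = f0 v) ∧ badEv G H L l t u f) ⊆
      ((Fintype.piFinset A).filter (fun f =>
        (((L u).filter (fun c => ∀ v ∈ s, ¬ kill v (f v) c)).card : ℝ) < l u)) ∪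
      (L u).biUnion (fun c => (Fintype.piFinset A).filter (fun f =>
        (∀ v ∈ s, ¬ kill v (f v) c) ∧
        t < ((s.filter (fun v => f v = none ∧ ∃ a ∈ A v, kill v a c)).card : ℝ))) := by
    intro f hf
    rw [Finset.mem_filter] at hf
    obtain ⟨hfc, hf3, hfu, hbad⟩ := hf
    have hfA : f ∈ Fintype.piFinset A := by
      rw [← hF]; exact Finset.mem_filter.2 ⟨hfc, hf3⟩
    simp only [colourings, Finset.mem_filter, Finset.mem_univ, true_and] at hfc
    rw [Finset.mem_union]
    rcases hbad with hb | ⟨c, hc, hb⟩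
    · left
      refine Finset.mem_filter.2 ⟨hfA, lt_of_le_of_lt ?_ hb⟩
      have : (L u).filter (fun c => ∀ v ∈ s, ¬ kill v (f v) c) ⊆ keptL G H L f u := by
        intro c hc
        rw [Finset.mem_filter] at hc
        refine (mem_keptL ..).2 ⟨hc.1, ?_⟩
        rintro w (rfl | hw) e he
        · rw [hfu] at he; cases he
        · refine ⟨?_, fun hadj => hc.2 w ((hms w).2 hw) ⟨e, he, hadj⟩⟩
          rintro rfl
          have := hpart e u w hc.1 (hfc.1 w e he)
          subst this
          exact G.loopless.irrefl _ hw
      exact_mod_cast Finset.card_le_card this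
    · right
      have hcu : c ∈ L u := ((mem_keptL ..).1 hc).1
      have hck := ((mem_keptL ..).1 hc).2
      refine Finset.mem_biUnion.2 ⟨c, hcu, Finset.mem_filter.2 ⟨hfA, ?_, lt_of_lt_of_le hb ?_⟩⟩
      · rintro v hv ⟨d, hd, hadj⟩
        exact (hck v (Or.inr ((hms v).1 hv)) d hd).2 hadj
      · choose part hp1 hp2 using hc1
        have hpe : ∀ d v, d ∈ L v → part d = v := fun d v hd => hpart d _ _ (hp1 d) hd
        have hcard : (nbrsL G H L f u c).card ≤
            (s.filter (fun v => f v = none ∧ ∃ a ∈ A v, kill v a c)).card := by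
          refine Finset.card_le_card_of_injOn part ?_ ?_
          · intro d hd
            simp only [nbrsL, Finset.coe_filter, Finset.mem_univ, true_and, Set.mem_ofPred_eq] at hd
            obtain ⟨hcd, v, huv, hdv⟩ := hd
            obtain ⟨hdL, hdk⟩ := (mem_keptL ..).1 hdv
            rw [hpe d v hdL]
            refine Finset.mem_coe.2 (Finset.mem_filter.2 ⟨(hms v).2 huv, ?_, some d, ?_, d, rfl, hcd⟩)
            · cases hfv : f v with
              | none => rfl
              | some e =>
                exfalso
                have h1 := hdk v (Or.inl rfl) e hfv
                exact h1.2 (hc2 v d hdL e (hfc.1 v e hfv) (Ne.symm h1.1))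
            · rw [hAadj v huv]
              rintro c' he
              cases he
              refine ⟨hdL, fun w e he hadj => ?_⟩
              have hw : ¬ G.Adj u w := fun hw => by rw [hr w hw] at he; cases he
              have hfw : f w = some e := (hf3 w hw).trans he
              rcases hc3 d e hadj v w hdL (hfc.1 w e hfw) with h | h
              · exact (hdk w (Or.inl h.symm) e hfw).2 hadj
              · exact (hdk w (Or.inr h) e hfw).2 hadj
          · intro d hd d' hd' heq
            simp only [nbrsL, Finset.coe_filter, Finset.mem_univ, true_and, Set.mem_ofPred_eq]
              at hd hd'
            obtain ⟨hcd, v, huv, hdv⟩ := hd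
            obtain ⟨hcd', v', huv', hdv'⟩ := hd'
            have h1 := ((mem_keptL ..).1 hdv).1
            have h2 := ((mem_keptL ..).1 hdv').1
            rw [hpe d v h1, hpe d' v' h2] at heq
            subst heq
            exact hc4 u v huv c hcu d h1 d' h2 hcd hcd'
        exact_mod_cast hcard
  rw [hF]
  have hcard := (Finset.card_le_card hsub).trans ((Finset.card_union_le _ _).trans
        (Nat.add_le_add_left Finset.card_biUnion_le _))
  have hcardR : (((colourings H L).filter
      (fun f => (∀ v, ¬ G.Adj u v → f v = f0 v) ∧ badEv G H L l t u f)).card : ℝ) ≤ _ :=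
    Nat.cast_le.2 hcard
  refine hcardR.trans ?_
  push_cast
  have hsc : (s.card : ℝ) = G.degree u := by rw [hs, SimpleGraph.card_neighborFinset_eq_degree]
  rw [hsc] at T1
  have T3 := Finset.sum_le_card_nsmul (L u) _ _ T2
  rw [nsmul_eq_mul] at T3
  rw [add_mul, mul_assoc]
  exact add_le_add T1 T3

theorem local_bound {V U : Type} [Fintype V] [Fintype U] (G : SimpleGraph V)
    [DecidableRel G.Adj]
    (H : SimpleGraph U) (L : V → Finset U) (htri : G.CliqueFree 3) (hcov : IsCover G H L)
    (l : V → ℝ) (t p : ℝ) (hp : 0 ≤ p) (u : V) (hC : (L u).Nonempty)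
    (hpb : Real.exp (l u - (L u).card * Real.exp (-(G.degree u / (L u).card)) / 2)
      + (L u).card * Real.exp (-(2 / 3 * t)) ≤ p)
    (Q : (V → Option U) → Prop)
    (hQ : ∀ f g : V → Option U, (∀ v, ¬ G.Adj u v → f v = g v) → (Q f → Q g)) :
    (((colourings H L).filter (fun f => badEv G H L l t u f ∧ Q f)).card : ℝ) ≤
      p * ((colourings H L).filter Q).card := by
  set r : (V → Option U) → (V → Option U) := fun f v => if G.Adj u v then none else f v with hrdef
  have hr1 : ∀ f v, G.Adj u v → r f v = none := fun f v hv => by simp [hrdef, hv]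
  have hr2 : ∀ f v, ¬ G.Adj u v → r f v = f v := fun f v hv => by simp [hrdef, hv]
  have hrs : ∀ f v c, r f v = some c → f v = some c := by
    intro f v c h
    by_cases hv : G.Adj u v
    · rw [hr1 f v hv] at h; cases h
    · rwa [hr2 f v hv] at h
  rw [Finset.card_eq_sum_card_fiberwise (f := r) (t := Finset.univ) (fun _ _ => by simp),
    Finset.card_eq_sum_card_fiberwise (f := r) (t := Finset.univ)
      (s := (colourings H L).filter Q) (fun _ _ => by simp)]
  push_cast
  rw [Finset.mul_sum]
  refine Finset.sum_le_sum (fun f0 _ => ?_)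
  by_cases hemp : (((colourings H L).filter (fun f => badEv G H L l t u f ∧ Q f)).filter
    (fun f => r f = f0)) = ∅
  · rw [hemp]
    simp only [Finset.card_empty, Nat.cast_zero]
    positivity
  · obtain ⟨f1, hf1⟩ := Finset.nonempty_iff_ne_empty.2 hemp
    simp only [Finset.mem_filter] at hf1
    obtain ⟨⟨hf1c, hf1b, hf1Q⟩, hf1r⟩ := hf1
    have hf0c : f0 ∈ colourings H L := by
      simp only [colourings, Finset.mem_filter, Finset.mem_univ, true_and] at hf1c ⊢
      rw [← hf1r]
      exact ⟨fun v c h => hf1c.1 v c (hrs _ _ _ h),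
        fun v w c d h h' => hf1c.2 v w c d (hrs _ _ _ h) (hrs _ _ _ h')⟩
    have hr0 : ∀ v, G.Adj u v → f0 v = none := fun v hv => by rw [← hf1r]; exact hr1 _ v hv
    have hu0 : f0 u = none := by
      rw [← hf1r, hr2 _ _ (G.loopless.irrefl u)]; exact hf1b.1
    have hreq : ∀ f, r f = f0 ↔ ∀ v, ¬ G.Adj u v → f v = f0 v := by
      intro f
      constructor
      · rintro h v hv
        rw [← h, hr2 f v hv]
      · intro h
        funext v
        by_cases hv : G.Adj u v
        · rw [hr1 f v hv, hr0 v hv]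
        · rw [hr2 f v hv, h v hv]
    have hQ0 : Q f0 := hQ f1 f0 ((hreq f1).1 hf1r) hf1Q
    have hQf : ∀ f, r f = f0 → Q f := fun f hf =>
      hQ f0 f (fun v hv => ((hreq f).1 hf v hv).symm) hQ0
    have e1 : (((colourings H L).filter (fun f => badEv G H L l t u f ∧ Q f)).filter
        (fun f => r f = f0)) = (colourings H L).filter
        (fun f => (∀ v, ¬ G.Adj u v → f v = f0 v) ∧ badEv G H L l t u f) := by
      ext f
      simp only [Finset.mem_filter, ← hreq]
      have := hQf f
      tauto
    have e2 : (((colourings H L).filter Q).filter (fun f => r f = f0)) = (colourings H L).filter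
        (fun f => (∀ v, ¬ G.Adj u v → f v = f0 v)) := by
      ext f
      simp only [Finset.mem_filter, ← hreq]
      have := hQf f
      tauto
    rw [e1, e2]
    exact (fibre G H L htri hcov l t u f0 hf0c hr0 hu0 hC).trans
      (mul_le_mul_of_nonneg_right hpb (by positivity))

theorem keptL_congr {V U : Type} (G : SimpleGraph V)
    (H : SimpleGraph U) (L : V → Finset U) (f g : V → Option U) (v : V)
    (h : ∀ w, (w = v ∨ G.Adj v w) → f w = g w) : keptL G H L f v = keptL G H L g v := by
  ext d
  rw [mem_keptL, mem_keptL]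
  refine and_congr_right (fun _ => forall_congr' (fun w => ?_))
  constructor
  · intro h1 hw e he; exact h1 hw e ((h w hw).trans he)
  · intro h1 hw e he; exact h1 hw e ((h w hw).symm.trans he)

theorem badEv_congr {V U : Type} [Fintype U] (G : SimpleGraph V)
    (H : SimpleGraph U) (L : V → Finset U) (l : V → ℝ) (t : ℝ) (f g : V → Option U) (v : V)
    (h0 : f v = g v) (h1 : ∀ w, G.Adj v w → f w = g w)
    (h2 : ∀ w x, G.Adj v w → G.Adj w x → f x = g x) :
    badEv G H L l t v f → badEv G H L l t v g := by
  have e1 : keptL G H L f v = keptL G H L g v := by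
    apply keptL_congr
    rintro w (rfl | hw)
    · exact h0
    · exact h1 w hw
  have e2 : ∀ w, G.Adj v w → keptL G H L f w = keptL G H L g w := by
    intro w hw
    apply keptL_congr
    rintro x (rfl | hx)
    · exact h1 x hw
    · exact h2 w x hw hx
  have e3 : ∀ c, nbrsL G H L f v c = nbrsL G H L g v c := by
    intro c
    ext d
    simp only [nbrsL, Finset.mem_filter, Finset.mem_univ, true_and]
    refine and_congr_right (fun _ => exists_congr (fun w => and_congr_right (fun hw => ?_)))
    rw [e2 w hw]
  rintro ⟨a, b⟩
  refine ⟨h0 ▸ a, ?_⟩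
  rw [e1] at b
  simpa only [e3] using b

end graphpart

theorem combi {V U : Type} [Fintype V] [Fintype U] [DecidableEq U] (G : SimpleGraph V)
    [DecidableRel G.Adj] (H : SimpleGraph U) [DecidableRel H.Adj]
    (L : V → Finset U) (htri : G.CliqueFree 3) (hcov : IsCover G H L)
    (Δ : ℕ) (hdeg : ∀ v, G.degree v ≤ Δ)
    (l : V → ℝ) (t p : ℝ) (hp : 0 ≤ p) (hC : ∀ u, (L u).Nonempty)
    (hpb : ∀ u, Real.exp (l u - (L u).card * Real.exp (-(G.degree u / (L u).card)) / 2)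
      + (L u).card * Real.exp (-(2 / 3 * t)) ≤ p)
    (hpD : 4 * p * ((Δ * (1 + (Δ + Δ * Δ)) : ℕ) : ℝ) ≤ 1) (hp1 : 4 * p ≤ 1) :
    ∃ I : Finset U, IndepFinset H I ∧
      (∀ u : V, u ∉ domI L I → l u ≤ ((coverLI H L I u).card : ℝ)) ∧
      (∀ c : U, c ∉ closedNbhd H I → (degStarI H L I c : ℝ) ≤ t) := by
  classical
  have hcov' := hcov
  obtain ⟨hc1, hc2, hc3, hc4⟩ := hcov
  have hpart : ∀ c v w, c ∈ L v → c ∈ L w → v = w := fun c v w hv hw =>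
    (hc1 c).unique hv hw
  have hdeg' : ∀ v, (G.neighborFinset v).card ≤ Δ := fun v => by
    rw [SimpleGraph.card_neighborFinset_eq_degree]; exact hdeg v
  set Γ : V → Finset V := fun u => (G.neighborFinset u).biUnion (fun v =>
    insert v (G.neighborFinset v ∪ (G.neighborFinset v).biUnion (fun w => G.neighborFinset w)))
    with hΓ
  have hΓc : ∀ u, (Γ u).card ≤ Δ * (1 + (Δ + Δ * Δ)) := by
    intro u
    refine (Finset.card_biUnion_le_card_mul _ _ (1 + (Δ + Δ * Δ)) (fun v _ => ?_)).trans
      (Nat.mul_le_mul_right _ (hdeg' u))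
    refine (Finset.card_insert_le _ _).trans ?_
    have h1 := Finset.card_union_le (G.neighborFinset v)
      ((G.neighborFinset v).biUnion (fun w => G.neighborFinset w))
    have h2 := (Finset.card_biUnion_le_card_mul (G.neighborFinset v)
      (fun w => G.neighborFinset w) Δ (fun w _ => hdeg' w)).trans
      (Nat.mul_le_mul_right _ (hdeg' v))
    have h3 := hdeg' v
    omega
  have hne : (colourings H L).Nonempty :=
    ⟨fun _ => none, by simp [colourings]⟩
  have hloc : ∀ (u : V) (W : Finset V), Disjoint W (Γ u) →
      (((colourings H L).filter (fun f => badEv G H L l t u f ∧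
        ∀ w ∈ W, ¬ badEv G H L l t w f)).card : ℝ) ≤
        p * (((colourings H L).filter (fun f => ∀ w ∈ W, ¬ badEv G H L l t w f)).card : ℝ) := by
    intro u W hW
    have := local_bound G H L htri hcov' l t p hp u (hC u) (hpb u)
      (fun f => ∀ w ∈ W, ¬ badEv G H L l t w f) (by
        intro f g hfg hQ w hw hb
        refine hQ w hw ?_
        have hwΓ : w ∉ Γ u := Finset.disjoint_left.1 hW hw
        simp only [hΓ, Finset.mem_biUnion, Finset.mem_insert, Finset.mem_union,
          SimpleGraph.mem_neighborFinset, not_exists, not_and, not_or] at hwΓ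
        refine badEv_congr G H L l t g f w ?_ ?_ ?_ hb
        · exact (hfg w (fun h => (hwΓ w h).1 rfl)).symm
        · intro x hx
          exact (hfg x (fun h => (hwΓ x h).2.1 hx.symm)).symm
        · intro x y hx hy
          exact (hfg y (fun h => (hwΓ y h).2.2 x hy.symm hx.symm)).symm)
    convert this
  have hmain := lll (colourings H L) (badEv G H L l t) Γ p (Δ * (1 + (Δ + Δ * Δ))) hp hΓc hpD hp1
    hne (by
      intro u W hW
      have := hloc u W hW
      convert this) Finset.univ
  obtain ⟨f, hf, hgood⟩ := hmain
  simp only [colourings, Finset.mem_filter, Finset.mem_univ, true_and] at hf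
  refine ⟨Finset.univ.filter (fun c => ∃ v, f v = some c), ?_, ?_, ?_⟩
  · intro c hc d hd
    simp only [Finset.mem_filter, Finset.mem_univ, true_and] at hc hd
    obtain ⟨v, hv⟩ := hc
    obtain ⟨w, hw⟩ := hd
    exact hf.2 v w c d hv hw
  · intro u hu
    have hfu : f u = none := by
      cases h : f u with
      | none => rfl
      | some e =>
        exfalso
        apply hu
        simp only [domI, Finset.mem_filter, Finset.mem_univ, true_and]
        exact ⟨e, Finset.mem_inter.2 ⟨Finset.mem_filter.2 ⟨Finset.mem_univ _, u, h⟩, hf.1 u e h⟩⟩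
    have hg : ¬ ((keptL G H L f u).card : ℝ) < l u := fun h =>
      hgood u (Finset.mem_univ _) ⟨hfu, Or.inl h⟩
    refine (not_lt.1 hg).trans ?_
    have : keptL G H L f u ⊆ coverLI H L (Finset.univ.filter (fun c => ∃ v, f v = some c)) u := by
      intro d hd
      rw [mem_keptL] at hd
      simp only [coverLI, Finset.mem_sdiff, Finset.mem_biUnion, Finset.mem_filter,
        Finset.mem_univ, true_and, SimpleGraph.mem_neighborFinset]
      refine ⟨hd.1, ?_⟩
      rintro ⟨x, ⟨w, hw⟩, hadj⟩
      refine (hd.2 w ?_ x hw).2 hadj.symm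
      rcases hc3 d x hadj.symm u w hd.1 (hf.1 w x hw) with h | h
      · exact Or.inl h.symm
      · exact Or.inr h
    exact_mod_cast Finset.card_le_card this
  · intro c hc
    have hcl : ∀ d, d ∉ closedNbhd H (Finset.univ.filter (fun c => ∃ v, f v = some c)) →
        ∀ w e, f w = some e → e ≠ d ∧ ¬ H.Adj d e := by
      intro d hd w e he
      simp only [closedNbhd, Finset.mem_union, Finset.mem_biUnion, Finset.mem_filter,
        Finset.mem_univ, true_and, SimpleGraph.mem_neighborFinset, not_or] at hd
      refine ⟨?_, fun h => hd.2 ⟨e, ⟨w, he⟩, h.symm⟩⟩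
      rintro rfl
      exact hd.1 ⟨w, he⟩
    obtain ⟨u, hcu, -⟩ := hc1 c
    have hfu : f u = none := by
      cases h : f u with
      | none => rfl
      | some e =>
        exfalso
        have h1 := hcl c hc u e h
        exact h1.2 (hc2 u c hcu e (hf.1 u e h) (Ne.symm h1.1))
    have hck : c ∈ keptL G H L f u := (mem_keptL ..).2 ⟨hcu, fun w _ e he => hcl c hc w e he⟩
    have hg : ¬ t < ((nbrsL G H L f u c).card : ℝ) := fun h =>
      hgood u (Finset.mem_univ _) ⟨hfu, Or.inr ⟨c, hck, h⟩⟩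
    refine le_trans ?_ (not_lt.1 hg)
    have : (Finset.univ.filter fun d : U =>
        H.Adj c d ∧ d ∉ closedNbhd H (Finset.univ.filter (fun c => ∃ v, f v = some c)) ∧
          ∀ u : V, c ∈ L u → d ∉ L u) ⊆ nbrsL G H L f u c := by
      intro d hd
      simp only [Finset.mem_filter, Finset.mem_univ, true_and] at hd
      obtain ⟨hcd, hdn, hdu⟩ := hd
      simp only [nbrsL, Finset.mem_filter, Finset.mem_univ, true_and]
      obtain ⟨v, hdv, -⟩ := hc1 d
      refine ⟨hcd, v, ?_, (mem_keptL ..).2 ⟨hdv, fun w _ e he => hcl d hdn w e he⟩⟩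
      rcases hc3 c d hcd u v hcu hdv with h | h
      · subst h; exact absurd hdv (hdu u hcu)
      · exact h
    unfold degStarI
    exact_mod_cast Finset.card_le_card this

theorem analytic1 (ε : ℝ) (hε₀ : 0 < ε) (hε₁ : ε < 1) :
    ∃ X : ℝ, 3 ≤ X ∧ ∀ x, X ≤ x →
      4 * x ^ (ε / 2) ≤ (1 + ε) * (x / Real.log x) * Real.exp (-(Real.log x / (1 + ε))) := by
  set β : ℝ := 1 - 1 / (1 + ε) - ε / 2 with hβ
  have hβ0 : 0 < β := by
    have : β = ε * (1 - ε) / (2 * (1 + ε)) := by rw [hβ]; field_simp; ring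
    rw [this]
    exact div_pos (mul_pos hε₀ (by linarith)) (by linarith)
  have h1 := (isLittleO_log_rpow_atTop hβ0).bound (show (0:ℝ) < 1 / 4 by norm_num)
  obtain ⟨X, hX⟩ := Filter.eventually_atTop.1 h1
  refine ⟨max X 3, le_max_right _ _, fun x hx => ?_⟩
  have hx1 := hX x ((le_max_left _ _).trans hx)
  have hx3 : 3 ≤ x := (le_max_right _ _).trans hx
  have hx0 : 0 < x := by linarith
  have hlog : 0 < Real.log x := Real.log_pos (by linarith)
  rw [Real.norm_of_nonneg hlog.le, Real.norm_of_nonneg (Real.rpow_nonneg hx0.le _)] at hx1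
  have e1 : x * Real.exp (-(Real.log x / (1 + ε))) = x ^ (ε / 2) * x ^ β := by
    rw [← Real.rpow_add hx0, Real.rpow_def_of_pos hx0]
    nth_rewrite 1 [← Real.exp_log hx0]
    rw [← Real.exp_add]
    congr 1
    rw [hβ]; field_simp; ring
  have e2 : (1 + ε) * (x / Real.log x) * Real.exp (-(Real.log x / (1 + ε))) =
      (1 + ε) * (x ^ (ε / 2) * x ^ β) / Real.log x := by
    rw [← e1]; ring
  rw [e2, le_div_iff₀ hlog]
  have hp : 0 < x ^ (ε / 2) := Real.rpow_pos_of_pos hx0 _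
  have hpb : 0 < x ^ β := Real.rpow_pos_of_pos hx0 _
  have h3 : x ^ (ε / 2) * Real.log x ≤ x ^ (ε / 2) * (1 / 4 * x ^ β) :=
    mul_le_mul_of_nonneg_left hx1 hp.le
  have h4 : 0 < ε * (x ^ (ε / 2) * x ^ β) := by positivity
  linarith

theorem analytic2 (ε : ℝ) (hε₀ : 0 < ε) (X : ℝ) :
    ∃ Δ₀ : ℕ, 12 ≤ Δ₀ ∧ ∀ Δ : ℕ, Δ₀ ≤ Δ →
      X ≤ (192 * Real.log Δ) ^ (2 / ε) ∧ (192 * Real.log Δ) ^ (2 / ε) ≤ Δ := by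
  have ht : Filter.Tendsto (fun n : ℕ => (192 * Real.log n) ^ (2 / ε)) Filter.atTop Filter.atTop :=
    (tendsto_rpow_atTop (by positivity)).comp
      ((Real.tendsto_log_atTop.comp tendsto_natCast_atTop_atTop).const_mul_atTop (by norm_num))
  have h1 := ht.eventually_ge_atTop X
  have h2 := tendsto_natCast_atTop_atTop.eventually
    ((isLittleO_log_rpow_atTop (show 0 < ε / 2 by positivity)).bound
      (show (0:ℝ) < 1 / 192 by norm_num))
  obtain ⟨N, hN⟩ := Filter.eventually_atTop.1 (h1.and h2)
  refine ⟨max N 12, le_max_right _ _, fun Δ hΔ => ?_⟩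
  obtain ⟨a, b⟩ := hN Δ ((le_max_left _ _).trans hΔ)
  refine ⟨a, ?_⟩
  have h12 : (12:ℝ) ≤ Δ := by exact_mod_cast (le_max_right _ _).trans hΔ
  have hlog : 0 < Real.log Δ := Real.log_pos (by linarith)
  have h0 : (0:ℝ) ≤ Δ := by linarith
  rw [Real.norm_of_nonneg hlog.le, Real.norm_of_nonneg (Real.rpow_nonneg h0 _)] at b
  have h3 : 192 * Real.log Δ ≤ (Δ:ℝ) ^ (ε / 2) := by linarith
  calc (192 * Real.log Δ) ^ (2 / ε) ≤ ((Δ:ℝ) ^ (ε / 2)) ^ (2 / ε) :=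
        Real.rpow_le_rpow (by positivity) h3 (by positivity)
    _ = Δ := by
        rw [← Real.rpow_mul h0]
        have : ε / 2 * (2 / ε) = 1 := by field_simp
        rw [this, Real.rpow_one]

theorem per_vertex (ε : ℝ) (hε₀ : 0 < ε) (hε₁ : ε < 1) (X : ℝ) (hX3 : 3 ≤ X)
    (hX : ∀ x, X ≤ x →
      4 * x ^ (ε / 2) ≤ (1 + ε) * (x / Real.log x) * Real.exp (-(Real.log x / (1 + ε))))
    (Δ d k : ℕ) (hΔ12 : 12 ≤ Δ) (hd : d ≤ Δ) (δ : ℝ) (hδX : X ≤ δ) (hδΔ : δ ≤ Δ)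
    (hδε : δ ^ (ε / 2) = 192 * Real.log Δ)
    (hk : k = ⌈(1 + ε) * max ((d : ℝ) / Real.log d) (δ / Real.log δ)⌉₊) :
    0 < k ∧ Real.exp (max ((d:ℝ) ^ (ε / 2)) (δ ^ (ε / 2)) - k * Real.exp (-(d / k)) / 2)
      + k * Real.exp (-(2 / 3 * (24 * Real.log Δ))) ≤ ((Δ:ℝ) ^ 10)⁻¹ := by
  have hδ3 : 3 ≤ δ := hX3.trans hδX
  have hΔR : (12:ℝ) ≤ Δ := by exact_mod_cast hΔ12
  have hdR : (d:ℝ) ≤ Δ := by exact_mod_cast hd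
  have hd0 : (0:ℝ) ≤ d := by positivity
  have hlogδ : 1 ≤ Real.log δ := by
    rw [Real.le_log_iff_exp_le (by linarith)]
    linarith [Real.exp_one_lt_d9]
  have hlogΔ : 0 < Real.log Δ := Real.log_pos (by linarith)
  set M := max ((d : ℝ) / Real.log d) (δ / Real.log δ) with hM
  set x := max (d:ℝ) δ with hx
  have hxδ : δ ≤ x := le_max_right _ _
  have hx0 : 0 < x := by linarith
  have hlogx : 0 < Real.log x := Real.log_pos (by linarith)
  have hxM : x / Real.log x ≤ M := by
    rcases max_choice (d:ℝ) δ with h | h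
    · rw [hx, h]; exact le_max_left _ _
    · rw [hx, h]; exact le_max_right _ _
  have hM0 : 0 < x / Real.log x := by positivity
  have hkM : (1 + ε) * M ≤ k := by rw [hk]; exact Nat.le_ceil _
  have hkx : (1 + ε) * (x / Real.log x) ≤ k :=
    (mul_le_mul_of_nonneg_left hxM (by linarith)).trans hkM
  have hkpos : (0:ℝ) < k := lt_of_lt_of_le (by positivity) hkx
  refine ⟨by exact_mod_cast hkpos, ?_⟩
  have hdk : (d:ℝ) / k ≤ Real.log x / (1 + ε) := by
    rw [div_le_div_iff₀ hkpos (by linarith)]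
    have h1 : (d:ℝ) ≤ x := le_max_left _ _
    have h2 := mul_le_mul_of_nonneg_left hkx hlogx.le
    have h3 : Real.log x * ((1 + ε) * (x / Real.log x)) = (1 + ε) * x := by field_simp
    rw [h3] at h2
    nlinarith
  have hmu : 4 * x ^ (ε / 2) ≤ k * Real.exp (-(d / k)) := by
    refine (hX x (hδX.trans hxδ)).trans ?_
    refine mul_le_mul hkx (Real.exp_le_exp.2 (by linarith)) (Real.exp_pos _).le hkpos.le
  have hl1 : max ((d:ℝ) ^ (ε / 2)) (δ ^ (ε / 2)) ≤ x ^ (ε / 2) :=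
    max_le (Real.rpow_le_rpow hd0 (le_max_left _ _) (by positivity))
      (Real.rpow_le_rpow (by linarith) hxδ (by positivity))
  have hl2 : 192 * Real.log Δ ≤ x ^ (ε / 2) := by
    rw [← hδε]; exact Real.rpow_le_rpow (by linarith) hxδ (by positivity)
  have hE : Real.exp (-(2 / 3 * (24 * Real.log Δ))) = ((Δ:ℝ) ^ 16)⁻¹ := by
    have : -(2 / 3 * (24 * Real.log Δ)) = -((16:ℕ) * Real.log Δ) := by push_cast; ring
    rw [this, Real.exp_neg, Real.exp_nat_mul, Real.exp_log (by linarith)]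
  have hfirst : Real.exp (max ((d:ℝ) ^ (ε / 2)) (δ ^ (ε / 2)) - k * Real.exp (-(d / k)) / 2) ≤
      ((Δ:ℝ) ^ 16)⁻¹ := by
    rw [← hE]
    apply Real.exp_le_exp.2
    linarith
  have hMle : M ≤ 2 * Δ := by
    refine max_le ?_ ?_
    · rcases Nat.lt_or_ge d 2 with h | h
      · have : (d:ℝ) / Real.log d = 0 := by
          interval_cases d <;> simp
        rw [this]; linarith
      · have hd2 : (2:ℝ) ≤ d := by exact_mod_cast h
        have : Real.log 2 ≤ Real.log d := Real.log_le_log (by norm_num) hd2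
        have hl : 1 / 2 ≤ Real.log d := by linarith [Real.log_two_gt_d9]
        rw [div_le_iff₀ (by linarith)]
        nlinarith
    · rw [div_le_iff₀ (by linarith)]
      nlinarith
  have hkle : (k:ℝ) ≤ 5 * Δ := by
    have h1 := Nat.ceil_lt_add_one (show 0 ≤ (1 + ε) * M from
      mul_nonneg (by linarith) (hM0.le.trans hxM))
    rw [← hk] at h1
    have h2 : (1 + ε) * M ≤ 2 * (2 * Δ) :=
      mul_le_mul (by linarith) hMle (hM0.le.trans hxM) (by norm_num)
    linarith
  rw [hE]
  have hpos : (0:ℝ) < (Δ:ℝ) ^ 16 := by positivity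
  have h6 : (k:ℝ) + 1 ≤ (Δ:ℝ) ^ 6 := by
    have : (Δ:ℝ) * 12 ≤ (Δ:ℝ) ^ 6 := by
      have h5 : (12:ℝ) ≤ (Δ:ℝ) ^ 5 :=
        hΔR.trans (le_self_pow₀ (by linarith) (by norm_num))
      calc (Δ:ℝ) * 12 ≤ Δ * Δ ^ 5 := mul_le_mul_of_nonneg_left h5 (by linarith)
        _ = Δ ^ 6 := by ring
    linarith
  calc _ ≤ ((Δ:ℝ) ^ 16)⁻¹ + k * ((Δ:ℝ) ^ 16)⁻¹ := by linarith
    _ = (k + 1) * ((Δ:ℝ) ^ 16)⁻¹ := by ring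
    _ ≤ (Δ:ℝ) ^ 6 * ((Δ:ℝ) ^ 16)⁻¹ := mul_le_mul_of_nonneg_right h6 (by positivity)
    _ = ((Δ:ℝ) ^ 10)⁻¹ := by field_simp

/-- Lemma 9 of the paper (analogue of Bernshteyn's Lemma 3.5): for fixed `0 < ε < 1` and
sufficiently large `Δ`, with `δ = (192 log Δ)^(2/ε)`, given a triangle-free `G` of
maximum degree at most `Δ` and a cover `ℋ = (L, H)` with
`|L(u)| = ⌈(1+ε)·max(deg(u)/log deg(u), δ/log δ)⌉` and
`ℓ(u) = max(deg(u)^(ε/2), δ^(ε/2))`, the graph `H` has an independent set `I` with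
(1) `|L_I(u)| ≥ ℓ(u)` for all `u ∈ V(G_I)` and (2) `deg*_{ℋ_I}(c) ≤ 24 log Δ` for all
`c ∈ V(H_I)`. -/
theorem partial_colouring_lemma (ε : ℝ) (hε₀ : 0 < ε) (hε₁ : ε < 1) :
    ∃ Δ₀ : ℕ, ∀ Δ : ℕ, Δ₀ ≤ Δ →
      ∀ (V U : Type) [Fintype V] [Fintype U] [DecidableEq U]
        (G : SimpleGraph V) [DecidableRel G.Adj] (H : SimpleGraph U) [DecidableRel H.Adj]
        (L : V → Finset U),
        G.CliqueFree 3 →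
        (∀ v : V, G.degree v ≤ Δ) →
        IsCover G H L →
        (∀ u : V, (L u).card =
          ⌈(1 + ε) * max ((G.degree u : ℝ) / Real.log (G.degree u))
              (((192 * Real.log Δ) ^ (2 / ε)) /
                Real.log ((192 * Real.log Δ) ^ (2 / ε)))⌉₊) →
        ∃ I : Finset U, IndepFinset H I ∧
          (∀ u : V, u ∉ domI L I →
            max ((G.degree u : ℝ) ^ (ε / 2)) (((192 * Real.log Δ) ^ (2 / ε)) ^ (ε / 2)) ≤
              ((coverLI H L I u).card : ℝ)) ∧
          (∀ c : U, c ∉ closedNbhd H I →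
            (degStarI H L I c : ℝ) ≤ 24 * Real.log Δ) := by
  obtain ⟨X, hX3, hX⟩ := analytic1 ε hε₀ hε₁
  obtain ⟨Δ₀, hΔ₀, hΔ₀'⟩ := analytic2 ε hε₀ X
  refine ⟨Δ₀, fun Δ hΔ V U _ _ _ G _ H _ L htri hdeg hcov hL => ?_⟩
  obtain ⟨h1, h2⟩ := hΔ₀' Δ hΔ
  have h12 : 12 ≤ Δ := hΔ₀.trans hΔ
  have h12R : (12:ℝ) ≤ Δ := by exact_mod_cast h12
  have hlogΔ : 0 < Real.log Δ := Real.log_pos (by linarith)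
  have hδε : ((192 * Real.log Δ) ^ (2 / ε)) ^ (ε / 2) = 192 * Real.log Δ := by
    rw [← Real.rpow_mul (by positivity)]
    have : 2 / ε * (ε / 2) = 1 := by field_simp
    rw [this, Real.rpow_one]
  have hv := fun u => per_vertex ε hε₀ hε₁ X hX3 hX Δ (G.degree u) (L u).card h12 (hdeg u) _ h1 h2
    hδε (hL u)
  have h10 : (12:ℝ) * (Δ:ℝ) ^ 3 ≤ (Δ:ℝ) ^ 10 := by
    have h7 : (12:ℝ) ≤ (Δ:ℝ) ^ 7 := h12R.trans (le_self_pow₀ (by linarith) (by norm_num))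
    calc (12:ℝ) * (Δ:ℝ) ^ 3 ≤ (Δ:ℝ) ^ 7 * (Δ:ℝ) ^ 3 :=
          mul_le_mul_of_nonneg_right h7 (by positivity)
      _ = (Δ:ℝ) ^ 10 := by ring
  have h3 : (1:ℝ) ≤ (Δ:ℝ) ^ 3 := one_le_pow₀ (by linarith)
  have hpos : (0:ℝ) < (Δ:ℝ) ^ 10 := by positivity
  refine combi G H L htri hcov Δ hdeg (fun u => max ((G.degree u : ℝ) ^ (ε / 2))
    (((192 * Real.log Δ) ^ (2 / ε)) ^ (ε / 2))) (24 * Real.log Δ) ((Δ:ℝ) ^ 10)⁻¹ (by positivity)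
    (fun u => Finset.card_pos.1 (hv u).1) (fun u => (hv u).2) ?_ ?_
  · have hD : ((Δ * (1 + (Δ + Δ * Δ)) : ℕ) : ℝ) ≤ 3 * (Δ:ℝ) ^ 3 := by
      push_cast
      nlinarith [mul_self_nonneg ((Δ:ℝ)), mul_nonneg (show (0:ℝ) ≤ Δ by linarith)
        (mul_nonneg (show (0:ℝ) ≤ Δ by linarith) (show (0:ℝ) ≤ Δ - 1 by linarith)),
        mul_nonneg (show (0:ℝ) ≤ Δ by linarith) (show (0:ℝ) ≤ Δ - 1 by linarith)]
    rw [mul_assoc, mul_comm, mul_assoc, inv_mul_le_iff₀ hpos]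
    linarith
  · rw [← div_eq_mul_inv, div_le_one hpos]
    linarith
end
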